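/- There exist a finitely presented group G which has no subgroup isomorphic to the Baumslag–Solitar group BS(m,n) for any nonzero integers m and n (in particular no subgroup isomorphic to ℤ × ℤ), and a surjective group homomorphism φ : G → ℤ, such that the kernel of φ is of type FP₂ over ℤ but is not finitely presented. -/

import Mathlib

/-- The augmentation ring homomorphism `ℤH → ℤ` sending each group element to `1`. -/
noncomputable def augmentationMap (H : Type) [Group H] : MonoidAlgebra ℤ H →+* ℤ :=
  (MonoidAlgebra.lift ℤ ℤ H 1).toRingHom

/-- A group `H` is of type `FP₂` over `ℤ`: there is an exact sequence
`P₂ → P₁ → P₀ → ℤ → 0` of `ℤH`-modules with each `Pᵢ` finitely generated projective,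
where `ℤ` carries the trivial `H`-action (via the augmentation map). -/
def IsTypeFP2 (H : Type) [Group H] : Prop :=
  letI : Module (MonoidAlgebra ℤ H) ℤ := Module.compHom ℤ (augmentationMap H)
  ∃ (P₂ P₁ P₀ : Type) (_ : AddCommGroup P₂) (_ : AddCommGroup P₁) (_ : AddCommGroup P₀)
    (_ : Module (MonoidAlgebra ℤ H) P₂) (_ : Module (MonoidAlgebra ℤ H) P₁)
    (_ : Module (MonoidAlgebra ℤ H) P₀),
    Module.Finite (MonoidAlgebra ℤ H) P₂ ∧ Module.Projective (MonoidAlgebra ℤ H) P₂ ∧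
    Module.Finite (MonoidAlgebra ℤ H) P₁ ∧ Module.Projective (MonoidAlgebra ℤ H) P₁ ∧
    Module.Finite (MonoidAlgebra ℤ H) P₀ ∧ Module.Projective (MonoidAlgebra ℤ H) P₀ ∧
    ∃ (d₂ : P₂ →ₗ[MonoidAlgebra ℤ H] P₁) (d₁ : P₁ →ₗ[MonoidAlgebra ℤ H] P₀)
      (ε : P₀ →ₗ[MonoidAlgebra ℤ H] ℤ),
      Function.Surjective ε ∧
      LinearMap.range d₁ = LinearMap.ker ε ∧
      LinearMap.range d₂ = LinearMap.ker d₁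

/-- A group `H` is finitely presented: it is isomorphic to a presented group
`⟨x₁,…,xₙ | R⟩` with `R` a finite set of relators. -/
def IsFinitelyPresented (H : Type) [Group H] : Prop :=
  ∃ (n : ℕ) (R : Set (FreeGroup (Fin n))), R.Finite ∧ Nonempty (H ≃* PresentedGroup R)

/-- The single relator `y⁻¹ xᵐ y x⁻ⁿ` of the Baumslag–Solitar group `BS(m,n)`. -/
def BSRels (m n : ℤ) : Set (FreeGroup (Fin 2)) :=
  {(FreeGroup.of 1)⁻¹ * (FreeGroup.of 0) ^ m * FreeGroup.of 1 * (FreeGroup.of 0) ^ (-n)}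

/-- The Baumslag–Solitar group `BS(m,n) = ⟨x, y | y⁻¹xᵐyx⁻ⁿ⟩`. -/
abbrev BS (m n : ℤ) : Type := PresentedGroup (BSRels m n)

/-- `G` has no subgroup isomorphic to a Baumslag–Solitar group `BS(m,n)`
with `m, n` nonzero. -/
def HasNoBSSubgroup (G : Type) [Group G] : Prop :=
  ∀ m n : ℤ, m ≠ 0 → n ≠ 0 → ∀ K : Subgroup G, ¬ Nonempty (K ≃* BS m n)

/-- `BS(1,1)` is `ℤ × ℤ`. -/
theorem bs_one_one_equiv : Nonempty (Multiplicative (ℤ × ℤ) ≃* BS 1 1) := by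
  let f : Fin 2 → Multiplicative (ℤ × ℤ) :=
    ![Multiplicative.ofAdd (1, 0), Multiplicative.ofAdd (0, 1)]
  have hf : ∀ r ∈ BSRels 1 1, FreeGroup.lift f r = 1 := by
    intro r hr
    rw [BSRels, Set.mem_singleton_iff] at hr
    subst hr
    simp only [map_mul, map_inv, map_zpow, FreeGroup.lift_apply_of]
    rw [inv_mul_eq_div, div_mul_cancel, ← zpow_add]
    simp
  let F : BS 1 1 →* Multiplicative (ℤ × ℤ) := PresentedGroup.toGroup hf
  let x : BS 1 1 := PresentedGroup.of 0
  let y : BS 1 1 := PresentedGroup.of 1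
  have hxy : Commute x y := by
    have h : (PresentedGroup.mk (BSRels 1 1)) ((FreeGroup.of 1)⁻¹ * (FreeGroup.of 0) ^ (1 : ℤ) *
        FreeGroup.of 1 * (FreeGroup.of 0) ^ (-(1 : ℤ))) = 1 :=
      PresentedGroup.one_of_mem (by simp [BSRels])
    simp only [map_mul, map_inv, map_zpow] at h
    have h' : y⁻¹ * x ^ (1 : ℤ) * y * x ^ (-(1 : ℤ)) = 1 := h
    simp only [zpow_one, zpow_neg] at h'
    rw [mul_inv_eq_one, mul_assoc, inv_mul_eq_iff_eq_mul] at h'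
    exact h'
  let g : Multiplicative (ℤ × ℤ) →* BS 1 1 :=
    { toFun := fun v => x ^ v.toAdd.1 * y ^ v.toAdd.2
      map_one' := by simp
      map_mul' := by
        intro u v
        simp only [toAdd_mul, Prod.fst_add, Prod.snd_add, zpow_add]
        have hc := (hxy.zpow_zpow v.toAdd.1 u.toAdd.2).eq
        rw [mul_assoc, mul_assoc, ← mul_assoc (x ^ v.toAdd.1), hc, mul_assoc] }
  refine ⟨MulEquiv.ofBijective g ⟨?_, ?_⟩⟩
  · have hFg : ∀ v, F (g v) = v := by
      intro v
      have hx : F x = Multiplicative.ofAdd (1, 0) := PresentedGroup.toGroup.of hf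
      have hy : F y = Multiplicative.ofAdd (0, 1) := PresentedGroup.toGroup.of hf
      change F (x ^ v.toAdd.1 * y ^ v.toAdd.2) = v
      rw [map_mul, map_zpow, map_zpow, hx, hy]
      apply Multiplicative.toAdd.injective
      ext <;> simp
    exact Function.LeftInverse.injective hFg
  · have hgF : g.comp F = MonoidHom.id _ := by
      apply PresentedGroup.ext
      intro i
      have : F (PresentedGroup.of i) = f i := PresentedGroup.toGroup.of hf
      rw [MonoidHom.comp_apply, this]
      fin_cases i
      · simp [f, g, x]
      · simp [f, g, y]
    intro z
    exact ⟨F z, DFunLike.congr_fun hgF z⟩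

/-- The `ℤ × ℤ` clause of the theorem follows from the Baumslag-Solitar clause. -/
theorem no_int_sq_of_noBS {G : Type} [Group G] (h : HasNoBSSubgroup G) :
    ∀ K : Subgroup G, ¬ Nonempty (K ≃* Multiplicative (ℤ × ℤ)) := by
  rintro K ⟨e⟩
  obtain ⟨e'⟩ := bs_one_one_equiv
  exact h 1 1 one_ne_zero one_ne_zero K ⟨e.trans e'⟩

open Classical in
/-- A right-angled commutation structure. -/
class RA (E : Type) where
  C : E → E → Prop
  symm : ∀ {e f}, C e f → C f e
  irr : ∀ e, ¬ C e e

open RA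

section Gen
variable {E : Type} [RA E]

def raRels (E : Type) [RA E] : Set (FreeGroup E) :=
  {r | (∃ e, r = FreeGroup.of e * FreeGroup.of e) ∨
    ∃ e f, C e f ∧ r = FreeGroup.of e * FreeGroup.of f * FreeGroup.of e * FreeGroup.of f}

abbrev RW (E : Type) [RA E] : Type := PresentedGroup (raRels E)

def gs (e : E) : RW E := PresentedGroup.of e

@[simp] theorem gs_mul_self (e : E) : gs e * gs e = 1 :=
  PresentedGroup.one_of_mem (rels := raRels E) (Or.inl ⟨e, rfl⟩)

@[simp] theorem mul_gs_gs (g : RW E) (e : E) : g * gs e * gs e = g := by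
  rw [mul_assoc, gs_mul_self, mul_one]

@[simp] theorem gs_gs_mul (g : RW E) (e : E) : gs e * (gs e * g) = g := by
  rw [← mul_assoc, gs_mul_self, one_mul]

@[simp] theorem gs_inv (e : E) : (gs e)⁻¹ = gs e := by
  rw [inv_eq_iff_mul_eq_one]; simp

theorem gs_comm {e f : E} (h : C e f) : gs e * gs f = gs f * gs e := by
  have h1 : gs e * gs f * gs e * gs f = 1 :=
    PresentedGroup.one_of_mem (rels := raRels E) (Or.inr ⟨e, f, h, rfl⟩)
  have h2 : gs e * gs f * (gs e * gs f) = 1 := by rw [← h1]; group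
  have h3 := eq_inv_of_mul_eq_one_left h2
  simpa using h3

theorem mul_gs_comm (g : RW E) {e f : E} (h : C e f) : g * gs e * gs f = g * gs f * gs e := by
  rw [mul_assoc, gs_comm h, mul_assoc]

theorem RW_lift {G : Type*} [Group G] (φ : E → G) (h1 : ∀ e, φ e * φ e = 1)
    (h2 : ∀ e f, C e f → φ e * φ f = φ f * φ e) : ∃ Φ : RW E →* G, ∀ e, Φ (gs e) = φ e := by
  have H : ∀ r ∈ raRels E, FreeGroup.lift φ r = 1 := by
    rintro r (⟨e, rfl⟩ | ⟨e, f, h, rfl⟩)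
    · simp [h1]
    · simp only [map_mul, FreeGroup.lift_apply_of]
      rw [h2 e f h, mul_assoc (φ f), h1, mul_one, h1]
  exact ⟨PresentedGroup.toGroup H, fun e => PresentedGroup.toGroup.of H⟩

theorem RW_ind {p : RW E → Prop} (h1 : p 1) (h2 : ∀ g e, p g → p (g * gs e)) (g : RW E) : p g := by
  obtain ⟨x, rfl⟩ := PresentedGroup.mk_surjective (raRels E) g
  suffices H : ∀ x : FreeGroup E, ∀ g : RW E, p g → p (g * PresentedGroup.mk _ x) by
    simpa using H x 1 h1
  intro x
  induction x using FreeGroup.induction_on with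
  | C1 => simp
  | of e => exact fun g hg => h2 g e hg
  | inv_of e _ =>
    intro g hg
    rw [map_inv]
    exact (gs_inv e).symm ▸ h2 g e hg
  | mul x y hx hy =>
    intro g hg
    rw [map_mul, ← mul_assoc]
    exact hy _ (hx _ hg)

/-! ### Numbers game -/

open Classical in
noncomputable def fire (t : E) (a : E → ℤ) : E → ℤ := fun s =>
  if s = t then - a t else if C s t then a s else a s + 2 * a t

theorem fire_self (t : E) (a : E → ℤ) : fire t a t = - a t := by simp [fire]
theorem fire_C {s t : E} (h : C s t) (a : E → ℤ) : fire t a s = a s := by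
  have : s ≠ t := by rintro rfl; exact irr _ h
  simp [fire, this, h]
theorem fire_N {s t : E} (h : ¬ C s t) (h' : s ≠ t) (a : E → ℤ) :
    fire t a s = a s + 2 * a t := by
  simp [fire, h, h']

theorem fire_fire (t : E) (a : E → ℤ) : fire t (fire t a) = a := by
  funext s
  by_cases h : s = t
  · subst h; simp [fire_self]
  by_cases hc : C s t
  · simp [fire_C hc]
  · rw [fire_N hc h, fire_N hc h, fire_self]; ring

theorem fire_comm {r t : E} (h : C r t) (a : E → ℤ) : fire r (fire t a) = fire t (fire r a) := by
  have hrt : C t r := symm h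
  funext s
  by_cases hs : s = t
  · subst hs; rw [fire_C hrt, fire_self, fire_self, fire_C hrt]
  by_cases hs' : s = r
  · subst hs'; rw [fire_C h, fire_self, fire_self, fire_C h]
  by_cases h1 : C s t <;> by_cases h2 : C s r
  · simp [fire_C h1, fire_C h2]
  · rw [fire_N h2 hs', fire_C h1, fire_C h1, fire_N h2 hs', fire_C h]
  · rw [fire_N h1 hs, fire_C h2, fire_C h2, fire_N h1 hs, fire_C hrt]
  · rw [fire_N h2 hs', fire_N h1 hs, fire_N h1 hs, fire_N h2 hs', fire_C h, fire_C hrt]; ring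

theorem num_exists : ∃ Φ : RW E →* Equiv.Perm (E → ℤ), ∀ e a, Φ (gs e) a = fire e a := by
  obtain ⟨Φ, h⟩ := RW_lift (E := E) (G := Equiv.Perm (E → ℤ))
    (fun e => ⟨fire e, fire e, fire_fire e, fire_fire e⟩)
    (fun e => by ext1 a; exact fire_fire e a)
    (fun e f h => by ext1 a; exact fire_comm h a)
  exact ⟨Φ, fun e a => by rw [h]; rfl⟩

noncomputable def num (g : RW E) : E → ℤ := num_exists.choose g⁻¹ (fun _ => 1)

theorem num_one : num (1 : RW E) = fun _ => 1 := by simp [num]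
theorem num_mul (g : RW E) (e : E) : num (g * gs e) = fire e (num g) := by
  simp [num, num_exists.choose_spec]

inductive Rch : ℕ → (E → ℤ) → Prop
  | nil : Rch 0 (fun _ => 1)
  | step {n a} (t : E) : Rch n a → 0 < a t → Rch (n + 1) (fire t a)

theorem Rch.inv {n : ℕ} {a : E → ℤ} (h : Rch n a) :
    (∀ s, a s % 2 = 1) ∧ ∀ s t, s ≠ t → ¬ C s t → 0 < a s + a t := by
  induction h with
  | nil => simp
  | @step n a r _ hr ih =>
    obtain ⟨i1, i2⟩ := ih
    have key : ∀ s, s = r ∧ fire r a s = - a r ∨ s ≠ r ∧ C s r ∧ fire r a s = a s ∨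
        s ≠ r ∧ ¬ C s r ∧ fire r a s = a s + 2 * a r := by
      intro s
      by_cases h : s = r
      · subst h; simp [fire_self]
      by_cases h' : C s r
      · simp [fire_C h', h, h']
      · simp [fire_N h' h, h, h']
    constructor
    · intro s
      have := i1 s; have := i1 r
      rcases key s with h | h | h <;> omega
    · intro s t hst hC
      have h1 := i2 s t hst hC
      rcases key s with ⟨rfl, h⟩ | ⟨_, h', h⟩ | ⟨_, h', h⟩ <;>
        rcases key t with ⟨rfl, k⟩ | ⟨_, k', k⟩ | ⟨_, k', k⟩ <;>
        first | omega | exact absurd (symm k') hC | exact absurd h' hC | (exact absurd rfl hst)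

theorem Rch.neg : ∀ {n : ℕ} {a : E → ℤ}, Rch n a → ∀ t, a t < 0 →
    ∃ m, m < n ∧ n ≤ m + 1 ∧ Rch m (fire t a) := by
  intro n
  induction n with
  | zero => rintro a ⟨⟩ t h; simp at h
  | succ n ih =>
    intro a ha t ht
    have hinv := ha.inv
    cases ha with
    | @step _ b f hb hf =>
      by_cases htf : t = f
      · subst htf; exact ⟨n, by omega, le_rfl, by rwa [fire_fire]⟩
      have hC : C t f := by
        by_contra hC
        have := hinv.2 t f htf hC
        rw [fire_self] at this; omega
      rw [fire_C hC] at ht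
      obtain ⟨m, h1, h2, h3⟩ := ih hb t ht
      refine ⟨m + 1, by omega, by omega, ?_⟩
      rw [fire_comm hC]
      exact h3.step f (by rwa [fire_C (symm hC)])

theorem num_rch (g : RW E) : ∃ n, Rch n (num g) := by
  induction g using RW_ind with
  | h1 => exact ⟨0, by rw [num_one]; exact .nil⟩
  | h2 g e ih =>
    obtain ⟨n, h⟩ := ih
    rw [num_mul]
    rcases lt_trichotomy (num g e) 0 with h' | h' | h'
    · obtain ⟨m, _, _, h3⟩ := h.neg e h'; exact ⟨m, h3⟩
    · have := h.inv.1 e; omega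
    · exact ⟨_, h.step e h'⟩

/-- right descents -/
def De (g : RW E) (e : E) : Prop := num g e < 0

theorem De_one (e : E) : ¬ De (1 : RW E) e := by simp [De, num_one]
theorem De_comm {g : RW E} {e f : E} (he : De g e) (hf : De g f) (hef : e ≠ f) : C e f := by
  by_contra h
  obtain ⟨n, hn⟩ := num_rch g
  have := hn.inv.2 e f hef h
  unfold De at *; omega
theorem De_mul_C {g : RW E} {e f : E} (h : C e f) : De (g * gs f) e ↔ De g e := by
  rw [De, num_mul, fire_C h, De]
theorem De_mul_self {g : RW E} {e : E} : De (g * gs e) e ↔ ¬ De g e := by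
  obtain ⟨n, hn⟩ := num_rch g
  have := hn.inv.1 e
  rw [De, num_mul, fire_self, De]; omega

/-! ### Traced words, holonomy -/

structure Vd (val : RW E → E → Prop) : Prop where
  back : ∀ {g e}, val g e → val (g * gs e) e
  sq : ∀ {g e f}, C e f → val g e → val g f → val (g * gs e) f

structure Flat {A : Type} [Group A] (val : RW E → E → Prop) (Q : RW E → Prop)
    (c : RW E → E → A) : Prop where
  inv : ∀ {g e}, val g e → Q g → Q (g * gs e) → c g e * c (g * gs e) e = 1
  sq : ∀ {g e f}, C e f → val g e → val g f → Q g → Q (g * gs e) → Q (g * gs f) →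
    Q (g * gs e * gs f) → c g e * c (g * gs e) f = c g f * c (g * gs f) e

def Down (Q : RW E → Prop) : Prop := ∀ {g e}, Q g → De g e → Q (g * gs e)

inductive Tr {A : Type} [Group A] (val : RW E → E → Prop) (Q : RW E → Prop)
    (c : RW E → E → A) : ℕ → RW E → A → Prop
  | nil : Q 1 → Tr val Q c 0 1 1
  | step {n g a} (e : E) : Tr val Q c n g a → val g e → Q (g * gs e) →
      Tr val Q c (n + 1) (g * gs e) (a * c g e)

variable {A : Type} [Group A] {val : RW E → E → Prop} {Q : RW E → Prop} {c : RW E → E → A}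

theorem Tr.q {n g a} (h : Tr val Q c n g a) : Q g := by cases h <;> assumption

theorem Tr.P (hv : Vd val) (hQ : Down Q) (hF : Flat val Q c) : ∀ (n : ℕ) {g a},
    Tr val Q c n g a → ∀ e, De g e → val g e ∧ ∃ m < n, ∃ b, Tr val Q c m (g * gs e) b ∧
      a = b * c (g * gs e) e := by
  intro n
  induction n using Nat.strong_induction_on with
  | _ n ih =>
    intro g a h e he
    cases h with
    | nil => exact absurd he (De_one e)
    | @step n g a f h hval hq =>
      have hg := h.q
      by_cases hef : e = f
      · subst hef
        refine ⟨hv.back hval, n, by omega, a, by simpa using h, by simp⟩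
      by_cases hf : De (g * gs f) f
      · have hC := De_comm he hf hef
        have he' := (De_mul_C hC).1 he
        obtain ⟨v1, m, hm, b, hb, rfl⟩ := ih n (by omega) h e he'
        have v2 := hv.sq (symm hC) hval v1
        refine ⟨v2, m + 1, by omega, b * c (g * gs e) f, ?_, ?_⟩
        · rw [mul_gs_comm _ (symm hC)]
          exact hb.step f (hv.sq hC v1 hval) (by rw [mul_gs_comm _ hC]; exact hQ hq he)
        · have hq1 : Q (g * gs e * gs f) := by rw [mul_gs_comm _ hC]; exact hQ hq he
          have v3 := hv.back v1
          have := hF.sq hC v3 (hv.sq hC v1 hval) hb.q (by simpa using hg) hq1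
            (by rw [mul_gs_gs]; exact hq)
          rw [mul_gs_gs] at this
          rw [mul_assoc, this, ← mul_assoc, mul_gs_comm _ hC]
      · rw [De_mul_self, not_not] at hf
        obtain ⟨v1, m, hm, b, hb, rfl⟩ := ih n (by omega) h f hf
        obtain ⟨v2, m', hm', b', hb', rfl⟩ := ih m (by omega) hb e he
        refine ⟨v2, m', by omega, b', hb', ?_⟩
        have := hF.inv (hv.back hval) hq (by simpa using hg)
        rw [mul_gs_gs] at this
        rw [mul_assoc _ _ (c g f), this, mul_one]

theorem Tr.shorten (hv : Vd val) (hQ : Down Q) (hF : Flat val Q c) {n g a}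
    (h : Tr val Q c n g a) (hn : 0 < n) (hD : ∀ e, ¬ De g e) : ∃ m < n, Tr val Q c m g a := by
  cases h with
  | nil => omega
  | @step n g a f h hval hq =>
    have hf : De g f := by have := hD f; rwa [De_mul_self, not_not] at this
    obtain ⟨v1, m, hm, b, hb, rfl⟩ := h.P hv hQ hF n f hf
    refine ⟨m, by omega, ?_⟩
    have := hF.inv (hv.back hval) hq (by simpa using h.q)
    rw [mul_gs_gs] at this
    rwa [mul_assoc, this, mul_one]

theorem Tr.uniq (hv : Vd val) (hQ : Down Q) (hF : Flat val Q c) : ∀ (k : ℕ) {n m g a b}, n + m ≤ k →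
    Tr val Q c n g a → Tr val Q c m g b → a = b := by
  intro k
  induction k with
  | zero =>
    intro n m g a b hk ha hb
    obtain rfl : n = 0 := by omega
    obtain rfl : m = 0 := by omega
    cases ha; cases hb; rfl
  | succ k ih =>
    intro n m g a b hk ha hb
    by_cases hD : ∃ e, De g e
    · obtain ⟨e, he⟩ := hD
      obtain ⟨_, n', hn, a', ha', rfl⟩ := ha.P hv hQ hF _ e he
      obtain ⟨_, m', hm, b', hb', rfl⟩ := hb.P hv hQ hF _ e he
      rw [ih (by omega) ha' hb']
    · push Not at hD
      rcases Nat.eq_zero_or_pos n with h0 | h0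
      · rcases Nat.eq_zero_or_pos m with h1 | h1
        · exact ih (by omega) ha hb
        · obtain ⟨m', hm, hb'⟩ := hb.shorten hv hQ hF h1 hD
          exact ih (by omega) ha hb'
      · obtain ⟨n', hn, ha'⟩ := ha.shorten hv hQ hF h0 hD
        exact ih (by omega) ha' hb

/-- vertices reachable by traced words -/
def Xn (val : RW E → E → Prop) (n : ℕ) (g : RW E) : Prop :=
  Tr val (fun _ => True) (fun _ _ => (1 : Unit)) n g 1
def Xt (val : RW E → E → Prop) (g : RW E) : Prop := ∃ n, Xn val n g

theorem flatUnit : Flat val Q (fun _ _ => (1 : Unit)) := ⟨fun _ _ _ => rfl, fun _ _ _ _ _ _ _ => rfl⟩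

theorem Xt.one : Xt val 1 := ⟨0, .nil trivial⟩
theorem Xt.step {g e} (h : Xt val g) (hv : val g e) : Xt val (g * gs e) := by
  obtain ⟨n, h⟩ := h; exact ⟨n + 1, h.step e hv trivial⟩

theorem Xt.ind {p : RW E → Prop} (h1 : p 1) (h2 : ∀ g e, Xt val g → val g e → p g → p (g * gs e))
    {g} (hg : Xt val g) : p g := by
  obtain ⟨n, h⟩ := hg
  suffices H : ∀ n g (a : Unit), Tr val (fun _ => True) (fun _ _ => (1 : Unit)) n g a → p g from
    H _ _ _ h
  clear h
  intro n g a h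
  induction h with
  | nil => exact h1
  | @step n g a e h hval _ ih => exact h2 g e ⟨n, h⟩ hval ih

theorem Xn.P (hv : Vd val) {n g e} (h : Xn val n g) (he : De g e) :
    val g e ∧ ∃ m < n, Xn val m (g * gs e) := by
  obtain ⟨h1, m, hm, b, hb, _⟩ := Tr.P hv (fun _ _ => trivial) flatUnit n h e he
  exact ⟨h1, m, hm, hb⟩

theorem Xt.val_of_De (hv : Vd val) {g e} (h : Xt val g) (he : De g e) : val g e :=
  (Xn.P hv h.choose_spec he).1

theorem Xt.De_mul (hv : Vd val) {g e} (h : Xt val g) (he : De g e) : Xt val (g * gs e) :=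
  h.step (h.val_of_De hv he)

theorem Xn.exists_De (hv : Vd val) : ∀ {n g}, Xn val n g → g ≠ 1 → ∃ e, De g e := by
  intro n
  induction n using Nat.strong_induction_on with
  | _ n ih =>
    intro g h hg
    by_contra hD
    push Not at hD
    rcases Nat.eq_zero_or_pos n with rfl | h0
    · cases h; exact hg rfl
    · obtain ⟨m, hm, h'⟩ := Tr.shorten hv (fun _ _ => trivial) flatUnit h h0 hD
      obtain ⟨e, he⟩ := ih m hm h' hg
      exact hD e he

theorem Xt.tr (hv : Vd val) (hQ : Down Q) {g} (h : Xt val g) (hq : Q g) :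
    ∃ n a, Tr val Q c n g a := by
  obtain ⟨n, h⟩ := h
  induction n using Nat.strong_induction_on generalizing g with
  | _ n ih =>
    by_cases hg : g = 1
    · subst hg; exact ⟨0, 1, .nil hq⟩
    obtain ⟨e, he⟩ := Xn.exists_De hv h hg
    obtain ⟨hval, m, hm, h'⟩ := Xn.P hv h he
    obtain ⟨n', a, ht⟩ := ih m hm (hQ hq he) h'
    have := ht.step e (hv.back hval) (by simpa using hq)
    rw [mul_gs_gs] at this
    exact ⟨_, _, this⟩

/-- Simple connectivity: flat connections have potentials. -/
theorem pot (hv : Vd val) (hQ : Down Q) (hF : Flat val Q c) : ∃ F : RW E → A,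
    (∀ {n g a}, Tr val Q c n g a → F g = a) ∧ F 1 = 1 ∧
    ∀ {g e}, Xt val g → val g e → Q g → Q (g * gs e) → F (g * gs e) = F g * c g e := by
  classical
  let F : RW E → A := fun g => if h : ∃ a n, Tr val Q c n g a then h.choose else 1
  have hFF : ∀ {n g a}, Tr val Q c n g a → F g = a := by
    intro n g a h
    have hex : ∃ a n, Tr val Q c n g a := ⟨a, n, h⟩
    have : F g = hex.choose := dif_pos hex
    rw [this]
    obtain ⟨m, hm⟩ := hex.choose_spec
    exact Tr.uniq hv hQ hF _ le_rfl hm h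
  refine ⟨F, hFF, ?_, ?_⟩
  · by_cases h : Q 1
    · exact hFF (.nil h)
    · have : ¬ ∃ a n, Tr val Q c n 1 a := by rintro ⟨a, n, hn⟩; exact h hn.q
      exact dif_neg this
  · intro g e hx hval hq hq'
    obtain ⟨n, a, ht⟩ := hx.tr (c := c) hv hQ hq
    rw [hFF ht, hFF (ht.step e hval hq')]

/-! rebasing -/
def shift (val : RW E → E → Prop) (g : RW E) : RW E → E → Prop := fun p e => val (g * p) e

theorem Vd.shift (hv : Vd val) (g : RW E) : Vd (shift val g) :=
  ⟨fun h => by simpa [_root_.shift, mul_assoc] using hv.back h,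
   fun h h1 h2 => by simpa [_root_.shift, mul_assoc] using hv.sq h h1 h2⟩

theorem Xt.mul {g p} (h : Xt val g) (hp : Xt (shift val g) p) : Xt val (g * p) := by
  refine Xt.ind (p := fun p => Xt val (g * p)) (by simpa using h) (fun q e _ hval ih => ?_) hp
  rw [← mul_assoc]; exact ih.step hval

theorem shift_shift (g p : RW E) : shift (shift val g) p = shift val (g * p) := by
  funext q e; simp [shift, mul_assoc]
theorem shift_one : shift val 1 = val := by funext q e; simp [shift]

theorem Xt.inv (hv : Vd val) {g} (h : Xt val g) : Xt (shift val g) g⁻¹ := by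
  refine Xt.ind (p := fun g => Xt (shift val g) g⁻¹) (by simpa using Xt.one)
    (fun g e _ hval ih => ?_) h
  rw [mul_inv_rev, gs_inv]
  apply Xt.mul
  · have : Xt (shift val (g * gs e)) (1 * gs e) := Xt.one.step (by
      simpa [shift] using hv.back hval)
    simpa using this
  · rw [shift_shift]; simpa using ih

/-! ### Length -/
def wd (l : List E) : RW E := (l.map gs).prod
@[simp] theorem wd_nil : wd ([] : List E) = 1 := rfl
@[simp] theorem wd_cons (e : E) (l : List E) : wd (e :: l) = gs e * wd l := by simp [wd]
@[simp] theorem wd_append (l l' : List E) : wd (l ++ l') = wd l * wd l' := by simp [wd]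
theorem wd_reverse (l : List E) : wd l.reverse = (wd l)⁻¹ := by
  induction l with
  | nil => simp
  | cons e l ih => simp [ih]

theorem wd_surj (g : RW E) : ∃ n l, wd l = g ∧ l.length = n := by
  induction g using RW_ind with
  | h1 => exact ⟨0, [], rfl, rfl⟩
  | h2 g e ih => obtain ⟨_, l, rfl, _⟩ := ih; exact ⟨_, l ++ [e], by simp, rfl⟩

open Classical in
noncomputable def len (g : RW E) : ℕ := Nat.find (wd_surj g)

theorem len_spec (g : RW E) : ∃ l, wd l = g ∧ l.length = len g := by
  classical exact Nat.find_spec (wd_surj g)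
theorem len_le (l : List E) : len (wd l) ≤ l.length := by
  classical exact Nat.find_min' (wd_surj (wd l)) ⟨l, rfl, rfl⟩

theorem Xn_true (l : List E) : Xn (fun _ _ => True) l.length (wd l) := by
  induction l using List.reverseRecOn with
  | nil => exact .nil trivial
  | append_singleton l e ih =>
    have : Xn (fun _ _ => True) (l.length + 1) (wd l * gs e) := ih.step e trivial trivial
    simpa using this
theorem Xn.len_le {n g} (h : Xn val n g) : len g ≤ n := by
  suffices H : ∀ n g (a : Unit), Tr val (fun _ => True) (fun _ _ => (1 : Unit)) n g a →
      ∃ l, wd l = g ∧ l.length = n by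
    obtain ⟨l, rfl, rfl⟩ := H _ _ _ h; exact _root_.len_le l
  intro n g a h
  induction h with
  | nil => exact ⟨[], rfl, rfl⟩
  | @step n g a e h hval _ ih => obtain ⟨l, rfl, rfl⟩ := ih; exact ⟨l ++ [e], by simp, by simp⟩

theorem VdT : Vd (fun (_ : RW E) (_ : E) => True) := ⟨fun _ => trivial, fun _ _ _ => trivial⟩

@[simp] theorem len_one : len (1 : RW E) = 0 := Nat.le_zero.1 (len_le [])
theorem len_mul_le (g h : RW E) : len (g * h) ≤ len g + len h := by
  obtain ⟨l, rfl, hl⟩ := len_spec g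
  obtain ⟨l', rfl, hl'⟩ := len_spec h
  rw [← hl, ← hl', ← wd_append, ← List.length_append]; exact len_le _
theorem len_inv_le (g : RW E) : len g⁻¹ ≤ len g := by
  obtain ⟨l, rfl, hl⟩ := len_spec g
  rw [← hl, ← wd_reverse, ← List.length_reverse]; exact len_le _
@[simp] theorem len_inv (g : RW E) : len g⁻¹ = len g :=
  le_antisymm (len_inv_le g) (by simpa using len_inv_le g⁻¹)
theorem len_gs_le (e : E) : len (gs e) ≤ 1 := by simpa using len_le [e]
theorem len_De {g : RW E} {e : E} (h : De g e) : len (g * gs e) + 1 = len g := by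
  obtain ⟨l, rfl, hl⟩ := len_spec g
  obtain ⟨_, m, hm, h'⟩ := Xn.P VdT (Xn_true l) h
  have h1 := h'.len_le
  have h2 := len_mul_le (wd l * gs e) (gs e)
  have h3 := len_gs_le e
  rw [mul_gs_gs] at h2
  omega
theorem len_nDe {g : RW E} {e : E} (h : ¬ De g e) : len (g * gs e) = len g + 1 := by
  have := len_De (De_mul_self.2 h); rw [mul_gs_gs] at this; exact this.symm
theorem De_iff {g : RW E} {e : E} : De g e ↔ len (g * gs e) < len g := by
  constructor
  · intro h; have := len_De h; omega
  · intro h; by_contra h'; have := len_nDe h'; omega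
theorem exists_De {g : RW E} (h : g ≠ 1) : ∃ e, De g e := by
  obtain ⟨l, rfl, -⟩ := len_spec g
  exact Xn.exists_De VdT (Xn_true l) h
theorem len_eq_zero {g : RW E} (h : len g = 0) : g = 1 := by
  by_contra h'; obtain ⟨e, he⟩ := exists_De h'; have := len_De he; omega
theorem De_mono {x : RW E} {e f : E} (h : ¬ De x⁻¹ e) (hf : De x f) : De (gs e * x) f := by
  have h1 := len_nDe h
  rw [← gs_inv e, ← mul_inv_rev, len_inv, len_inv] at h1
  have h2 := len_De hf
  have h3 := len_mul_le (gs e) (x * gs f)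
  have h4 := len_gs_le e
  rw [De_iff, mul_assoc]; omega
theorem De_gs {e f : E} : De (gs e) f ↔ f = e := by
  constructor
  · intro h
    by_contra hne
    have h1 : De (gs e) e := by
      have := (De_mul_self (g := (1 : RW E)) (e := e)).2 (De_one e); simpa using this
    have := (De_mul_C (g := 1) (De_comm h h1 hne)).1 (by simpa using h)
    exact De_one _ this
  · rintro rfl
    have := (De_mul_self (g := (1 : RW E)) (e := f)).2 (De_one f); simpa using this
end Gen

open RA
set_option linter.unusedSectionVars false
set_option linter.unusedSimpArgs false
open RA
section Proj
variable {E : Type} [RA E]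

def Red (l : List E) : Prop := len (wd l) = l.length

theorem Red.left {l l' : List E} (h : Red (l ++ l')) : Red l := by
  unfold Red at *
  have h1 := len_le l; have h2 := len_le l'
  have h3 := len_mul_le (wd l) (wd l')
  rw [wd_append, List.length_append] at h; omega

theorem Red.De {l : List E} {e : E} (h : Red (l ++ [e])) : De (wd (l ++ [e])) e := by
  rw [De_iff]
  have h1 := h.left
  unfold Red at *
  rw [h]; simp [h1]

theorem red_snoc {g : RW E} {e : E} (h : De g e) {l : List E} (hl : Red l)
    (hw : wd l = g * gs e) : Red (l ++ [e]) ∧ wd (l ++ [e]) = g := by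
  have h2 : wd (l ++ [e]) = g := by simp [hw]
  refine ⟨?_, h2⟩
  have := len_De h
  unfold Red at *
  rw [h2]; rw [hw] at hl; simp; omega

open Classical in
noncomputable def fl (s t : E) (l : List E) : List E := l.filter (fun x => x = s ∨ x = t)

theorem fl_append (s t : E) (l l' : List E) : fl s t (l ++ l') = fl s t l ++ fl s t l' := by
  simp [fl]

theorem exists_red (g : RW E) : ∃ l, Red l ∧ wd l = g := by
  obtain ⟨l, h, h'⟩ := len_spec g; exact ⟨l, by rw [Red, h, h'], h⟩

theorem fl_uniq {s t : E} (hst : ¬ C s t) : ∀ (n : ℕ) {l l' : List E}, l.length = n → Red l → Red l' →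
    wd l = wd l' → fl s t l = fl s t l' := by
  intro n
  induction n using Nat.strong_induction_on with
  | _ n ih =>
    intro l l' hn hl hl' hw
    have hll : l.length = l'.length := by rw [Red] at hl hl'; rw [← hl, ← hl', hw]
    rcases List.eq_nil_or_concat' l with rfl | ⟨l1, e, rfl⟩
    · have : l' = [] := List.length_eq_zero_iff.1 hll.symm
      rw [this]
    rcases List.eq_nil_or_concat' l' with rfl | ⟨l2, f, rfl⟩
    · simp at hll
    have he := hl.De; have hf := hl'.De
    by_cases hef : e = f
    · subst hef
      have : wd l1 = wd l2 := by simpa using hw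
      rw [fl_append, fl_append, ih l1.length (by rw [← hn]; simp) rfl hl.left hl'.left this]
    rw [← hw] at hf
    have hC := De_comm he hf hef
    set g := wd (l1 ++ [e]) with hg
    have h1 : wd l1 = g * gs e := by simp [hg]
    have h2 : wd l2 = g * gs f := by rw [hw]; simp
    have d1 : De (g * gs e) f := (De_mul_C (symm hC)).2 hf
    have d2 : De (g * gs f) e := (De_mul_C hC).2 he
    obtain ⟨l3, r3, w3⟩ := exists_red (g * gs e * gs f)
    obtain ⟨a1, a2⟩ := red_snoc d1 r3 w3
    obtain ⟨b1, b2⟩ := red_snoc d2 r3 (by rw [w3, mul_gs_comm _ hC])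
    have e1 := ih l1.length (by rw [← hn]; simp) rfl hl.left a1 (by rw [h1, a2])
    have e2 := ih l2.length (by rw [← hn, hll]; simp) rfl hl'.left b1 (by rw [h2, b2])
    rw [fl_append, fl_append, e1, e2, fl_append, fl_append, List.append_assoc, List.append_assoc]
    congr 1
    have : ¬ ((e = s ∨ e = t) ∧ (f = s ∨ f = t)) := by
      rintro ⟨rfl | rfl, rfl | rfl⟩
      · exact hef rfl
      · exact hst hC
      · exact hst (symm hC)
      · exact hef rfl
    by_cases h1 : e = s ∨ e = t
    · have h2 : ¬ (f = s ∨ f = t) := fun h => this ⟨h1, h⟩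
      simp [fl, h1, h2]
    · simp [fl, h1]

noncomputable def rw' (g : RW E) : List E := (exists_red g).choose
theorem rw_red (g : RW E) : Red (rw' g) := (exists_red g).choose_spec.1
theorem wd_rw (g : RW E) : wd (rw' g) = g := (exists_red g).choose_spec.2
theorem len_rw (g : RW E) : (rw' g).length = len g := by rw [← rw_red g, wd_rw]

noncomputable def Pr (s t : E) (g : RW E) : List E := fl s t (rw' g)

theorem Pr_eq {s t : E} (hst : ¬ C s t) {l : List E} (hl : Red l) : Pr s t (wd l) = fl s t l :=
  fl_uniq hst _ rfl (rw_red _) hl (wd_rw _)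

theorem Pr_mul {s t : E} (hst : ¬ C s t) {g h : RW E} (H : len (g * h) = len g + len h) :
    Pr s t (g * h) = Pr s t g ++ Pr s t h := by
  have : Red (rw' g ++ rw' h) := by
    rw [Red, wd_append, wd_rw, wd_rw, H, List.length_append, len_rw, len_rw]
  have h2 := Pr_eq hst this
  rw [wd_append, wd_rw, wd_rw] at h2
  rw [h2, fl_append]; rfl

theorem Pr_inv {s t : E} (hst : ¬ C s t) (g : RW E) : Pr s t g⁻¹ = (Pr s t g).reverse := by
  have : Red (rw' g).reverse := by
    rw [Red, wd_reverse, wd_rw, len_inv, List.length_reverse, len_rw]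
  have h2 := Pr_eq hst this
  rw [wd_reverse, wd_rw] at h2
  rw [h2, Pr, fl, fl, List.filter_reverse]

/-- number of occurrences -/
noncomputable def ct (s : E) (g : RW E) : ℕ := (Pr s s g).length

theorem Pr_one (s t : E) : Pr s t (1 : RW E) = [] := by
  have : rw' (1 : RW E) = [] := List.length_eq_zero_iff.1 (by rw [len_rw, len_one])
  rw [Pr, this]; rfl

open Classical in
theorem ct_eq (s t : E) (g : RW E) : ct s g = (Pr s t g).count s := by
  rw [ct, Pr, Pr, fl, fl, ← List.countP_eq_length_filter, List.count, List.countP_filter]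
  congr 1; funext x; by_cases h : x = s <;> simp [h]

open Classical in
theorem ct_eq' (s t : E) (g : RW E) : ct s g = (Pr t s g).count s := by
  rw [ct_eq s t, Pr, Pr, fl, fl]; congr 2; funext x; simp [or_comm]

theorem len_Pr {s t : E} (h : s ≠ t) (g : RW E) : (Pr s t g).length = ct s g + ct t g := by
  classical
  rw [ct_eq s t, ct_eq' t s]
  have : ∀ x ∈ Pr s t g, x = s ∨ x = t := by
    intro x hx; simpa using (List.mem_filter.1 hx).2
  generalize Pr s t g = l at this
  induction l with
  | nil => rfl
  | cons x l ih =>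
    have := ih (fun y hy => this y (by simp [hy]))
    rcases ‹∀ y ∈ x :: l, _› x (by simp) with rfl | rfl
    · simp [List.count_cons, h]; omega
    · simp [List.count_cons, h.symm]; omega

theorem ct_mul {s : E} {g h : RW E} (H : len (g * h) = len g + len h) :
    ct s (g * h) = ct s g + ct s h := by
  rw [ct, Pr_mul (irr s) H, List.length_append]; rfl

theorem ct_pos {s : E} {l : List E} (hl : Red l) : 0 < ct s (wd l) ↔ s ∈ l := by
  classical
  rw [ct, Pr_eq (irr s) hl, List.length_pos_iff_exists_mem]
  simp [fl]

theorem De_iff_last {g : RW E} {e : E} : De g e ↔ 0 < ct e g ∧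
    ∀ t, ¬ C e t → (Pr e t g).getLast? = some e := by
  constructor
  · intro h
    obtain ⟨l, hl, hw⟩ := exists_red (g * gs e)
    obtain ⟨h1, h2⟩ := red_snoc h hl hw
    rw [← h2, ct_pos h1]
    refine ⟨by simp, fun t ht => ?_⟩
    rw [Pr_eq ht h1, fl_append]
    simp [fl]
  · obtain ⟨l, hl, rfl⟩ := exists_red g
    rw [ct_pos hl]
    rintro ⟨h1, h2⟩
    have h2' : ∀ t, ¬ C e t → (fl e t l).getLast? = some e := fun t ht => by
      rw [← Pr_eq ht hl]; exact h2 t ht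
    clear h2
    induction l using List.reverseRecOn with
    | nil => simp at h1
    | append_singleton l f ih =>
      by_cases hf : e = f
      · subst hf; exact hl.De
      have hC : C e f := by
        by_contra hC
        have := h2' f hC
        rw [fl_append] at this
        simp [fl] at this
        exact hf this.symm
      rw [wd_append]
      simp only [wd_cons, wd_nil, mul_one]
      rw [De_mul_C hC]
      refine ih hl.left (by simpa [hf] using h1) (fun t ht => ?_)
      have := h2' t ht
      have hne : ¬ (f = e ∨ f = t) := by rintro (rfl | rfl) <;> tauto
      rw [fl_append] at this
      simpa [fl, hne] using this

theorem Pr_ext : ∀ {u v : RW E}, (∀ s t, ¬ C s t → Pr s t u = Pr s t v) → u = v := by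
  suffices H : ∀ (n : ℕ) (u v : RW E), len u = n → (∀ s t, ¬ C s t → Pr s t u = Pr s t v) → u = v from
    fun {u v} h => H _ u v rfl h
  intro n
  induction n with
  | zero =>
    intro u v hu h
    have hu := len_eq_zero hu
    subst hu
    symm
    apply len_eq_zero
    rw [← len_rw, List.length_eq_zero_iff, List.eq_nil_iff_forall_not_mem]
    intro a ha
    have h1 := (ct_pos (rw_red v)).2 ha
    rw [wd_rw, ct, ← h a a (irr a), Pr_one] at h1
    simp at h1
  | succ n ih =>
    intro u v hu h
    obtain ⟨e, he⟩ : ∃ e, De u e := exists_De (by rintro rfl; simp at hu)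
    have hv : De v e := by
      rw [De_iff_last] at he ⊢
      rw [ct, ← h e e (irr e)]
      exact ⟨he.1, fun t ht => by rw [← h e t ht]; exact he.2 t ht⟩
    have key : ∀ x : RW E, De x e → ∀ s t, ¬ C s t → Pr s t x = Pr s t (x * gs e) ++ Pr s t (gs e) := by
      intro x hx s t hst
      have h1 := len_De hx
      have h2 : len (gs e) = 1 := by
        have := len_nDe (De_one e); simpa using this
      rw [← Pr_mul hst, mul_gs_gs]
      rw [mul_gs_gs]; omega
    have := len_De he
    have h3 := ih (u * gs e) (v * gs e) (by omega) (fun s t hst => by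
      have := h s t hst
      rw [key u he s t hst, key v hv s t hst] at this
      exact List.append_cancel_right this)
    exact mul_right_cancel h3

/-- additivity of length -/
theorem len_mul_of_disj : ∀ (n : ℕ) {u v : RW E}, len v = n → (∀ e, De u e → ¬ De v⁻¹ e) →
    len (u * v) = len u + len v := by
  intro n
  induction n with
  | zero => intro u v hv _; rw [len_eq_zero hv]; simp
  | succ n ih =>
    intro u v hv h
    obtain ⟨e, he⟩ : ∃ e, De v⁻¹ e := exists_De (by
      intro h; rw [inv_eq_one] at h; subst h; simp at hv)
    have hu : ¬ De u e := fun h' => h e h' he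
    have h1 := len_De he
    have h2 : v⁻¹ * gs e = (gs e * v)⁻¹ := by simp
    rw [h2, len_inv, len_inv] at h1
    have h3 := ih (u := u * gs e) (v := gs e * v) (by omega) (by
      intro f hf hf'
      rw [← h2] at hf'
      by_cases hfe : f = e
      · subst hfe; rw [De_mul_self] at hf'; exact hf' he
      have hC := De_comm hf (De_mul_self.2 hu) hfe
      rw [De_mul_C hC] at hf hf'
      exact h f hf hf')
    have h4 := len_nDe hu
    rw [mul_assoc, gs_gs_mul] at h3
    omega

/-! ### cyclically reduced elements -/
def CR (w : RW E) : Prop := ∀ e, De w e → ¬ De w⁻¹ e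

theorem CR.pow {w : RW E} (hw : CR w) (n : ℕ) : len (w ^ n) = n * len w ∧
    ∀ s t, ¬ C s t → Pr s t (w ^ n) = (List.replicate n (Pr s t w)).flatten := by
  induction n with
  | zero => simp [Pr_one]
  | succ n ih =>
    have key : len (w ^ n * w) = len (w ^ n) + len w := by
      apply len_mul_of_disj _ rfl
      intro e he
      apply hw
      rw [De_iff_last] at he ⊢
      obtain ⟨h1, h2⟩ := he
      have hn : ∀ t, ¬ C e t → (Pr e t w).getLast? = some e := by
        intro t ht
        have := h2 t ht
        rw [ih.2 e t ht] at this
        cases n with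
        | zero => simp at this
        | succ n =>
          rw [List.replicate_succ', List.flatten_append] at this
          simp only [List.flatten_cons, List.flatten_nil, List.append_nil] at this
          cases h : Pr e t w with
          | nil => rw [h] at this; simp at this
          | cons a l => rw [h] at this; simpa using this
      refine ⟨?_, hn⟩
      have := hn e (irr e)
      rw [ct, List.length_pos_iff_exists_mem]
      exact ⟨e, List.mem_of_getLast? this⟩
    refine ⟨by rw [pow_succ, key, ih.1]; ring, fun s t hst => ?_⟩
    rw [pow_succ, Pr_mul hst key, ih.2 s t hst, List.replicate_succ', List.flatten_append]
    simp

def Split (g : RW E) : Prop := ∃ S : E → Prop, (∃ e, 0 < ct e g ∧ S e) ∧ (∃ e, 0 < ct e g ∧ ¬ S e) ∧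
  ∀ e f, 0 < ct e g → 0 < ct f g → S e → ¬ S f → C e f

theorem list_pow_comm {u v : List E} (h : u ++ v = v ++ u) (n : ℕ) :
    u ++ (List.replicate n v).flatten = (List.replicate n v).flatten ++ u := by
  induction n with
  | zero => simp
  | succ n ih =>
    simp only [List.replicate_succ, List.flatten_cons]
    rw [← List.append_assoc, h, List.append_assoc, ih, List.append_assoc]

theorem comm_aux {w h : RW E} (hw1 : w ≠ 1) (hw : CR w) (hc : w * h = h * w)
    (hl : len (w * h) = len w + len h) (s1 : ¬ Split w) (s2 : ¬ Split (w * h)) :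
    ∃ a b : ℕ, 0 < a ∧ h ^ a = w ^ b := by
  classical
  have hl' : len (h * w) = len h + len w := by rw [← hc, hl, add_comm]
  have hcomm : ∀ s t, ¬ C s t → Pr s t w ++ Pr s t h = Pr s t h ++ Pr s t w := fun s t hst => by
    rw [← Pr_mul hst hl, ← Pr_mul hst hl', hc]
  have hpow : ∀ s t, ¬ C s t → ∀ a b : ℕ, a * (Pr s t h).length = b * (Pr s t w).length →
      (List.replicate a (Pr s t h)).flatten = (List.replicate b (Pr s t w)).flatten := by
    intro s t hst a b hab
    have h1 := list_pow_comm (list_pow_comm (hcomm s t hst) a).symm b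
    exact (List.append_inj h1 (by simpa using hab)).1
  have hprop : ∀ s t, s ≠ t → ¬ C s t → ct s w * ct t h = ct t w * ct s h := by
    intro s t hne hst
    have h1 := congrArg (List.count s) (hpow s t hst (Pr s t w).length (Pr s t h).length (mul_comm _ _))
    simp only [List.count_flatten, List.map_replicate, List.sum_replicate, smul_eq_mul] at h1
    rw [← ct_eq, ← ct_eq, len_Pr hne, len_Pr hne] at h1
    nlinarith
  obtain ⟨e0, he0⟩ : ∃ e, 0 < ct e w := by
    obtain ⟨e, he⟩ := exists_De hw1; exact ⟨e, (De_iff_last.1 he).1⟩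
  have hS : ∀ e, 0 < ct e w → ct e0 w * ct e h = ct e w * ct e0 h := by
    by_contra hcon
    push Not at hcon
    obtain ⟨f0, hf0, hf0'⟩ := hcon
    refine s1 ⟨fun e => ct e0 w * ct e h = ct e w * ct e0 h, ⟨e0, he0, rfl⟩, ⟨f0, hf0, hf0'⟩, ?_⟩
    intro e f he hf h1 h2
    by_contra hC
    have hne : e ≠ f := by rintro rfl; exact h2 h1
    have h3 := hprop e f hne hC
    apply h2
    apply Nat.eq_of_mul_eq_mul_left he
    calc ct e w * (ct e0 w * ct f h) = ct e0 w * (ct e w * ct f h) := by ring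
      _ = ct f w * (ct e0 w * ct e h) := by rw [h3]; ring
      _ = _ := by rw [h1]; ring
  have hS0 : ∀ f, ct f w = 0 → ct f h = 0 := by
    intro f hf
    by_contra hfh
    refine s2 ⟨fun e => 0 < ct e w, ⟨e0, by rw [ct_mul hl]; omega, he0⟩,
      ⟨f, by rw [ct_mul hl]; omega, by omega⟩, ?_⟩
    intro e f' _ hf' he hf1
    rw [ct_mul hl] at hf'
    by_contra hC
    have hne : e ≠ f' := by rintro rfl; exact hf1 he
    have h3 := hprop e f' hne hC
    have h0 : ct f' w = 0 := by omega
    rw [h0, zero_mul] at h3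
    rcases Nat.mul_eq_zero.1 h3 with h4 | h4 <;> omega
  have hall : ∀ e, ct e0 w * ct e h = ct e0 h * ct e w := by
    intro e
    rcases Nat.eq_zero_or_pos (ct e w) with h | h
    · rw [h, hS0 e h]; simp
    · rw [hS e h]; ring
  have last : ∀ {x y : RW E}, (∀ s t, ¬ C s t → Pr s t x ++ Pr s t y = Pr s t y ++ Pr s t x) →
      (∀ e, 0 < ct e y → 0 < ct e x) → ∀ e, De y e → De x e := by
    intro x y hxy hct e he
    rw [De_iff_last] at he ⊢
    refine ⟨hct _ he.1, fun t ht => ?_⟩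
    have h1 := he.2 t ht
    have h2 := hxy e t ht
    have h3 : Pr e t x ≠ [] := by
      intro h0; have := hct _ he.1; rw [ct_eq e t, h0] at this; simp at this
    have h4 : (Pr e t x ++ Pr e t y).getLast? = some e := by
      rw [List.getLast?_append, h1]; simp
    rw [h2, List.getLast?_append] at h4
    rw [List.getLast?_eq_some_getLast h3] at h4 ⊢
    simpa using h4
  have hsub : ∀ e, 0 < ct e h → 0 < ct e w := fun e he => by
    by_contra h0; have := hS0 e (by omega); omega
  have hCR : CR h := by
    intro e he he'
    have cinv : ∀ (x : RW E) e, ct e x⁻¹ = ct e x := fun x e => by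
      rw [ct, Pr_inv (irr e), List.length_reverse]; rfl
    refine hw e (last hcomm hsub e he) (last (x := w⁻¹) (y := h⁻¹) ?_ ?_ e he')
    · intro s t hst
      rw [Pr_inv hst, Pr_inv hst, ← List.reverse_append, ← List.reverse_append, hcomm s t hst]
    · intro e; rw [cinv, cinv]; exact hsub e
  refine ⟨ct e0 w, ct e0 h, he0, Pr_ext fun s t hst => ?_⟩
  rw [(hCR.pow _).2 s t hst, (hw.pow _).2 s t hst]
  apply hpow s t hst
  by_cases hne : s = t
  · subst hne; exact hall s
  · rw [len_Pr hne, len_Pr hne, mul_add, mul_add, hall, hall]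

theorem comm_thm {w h : RW E} (hw1 : w ≠ 1) (hw : CR w) (hc : w * h = h * w)
    (hs : ∀ k : ℕ, ¬ Split (w ^ k * h)) (hs' : ¬ Split w) :
    ∃ (a : ℕ) (b : ℤ), 0 < a ∧ h ^ a = w ^ b := by
  obtain ⟨k, hk⟩ : ∃ k, len (w ^ (k + 1) * h) = len w + len (w ^ k * h) := by
    by_contra hcon
    push Not at hcon
    have h1 : ∀ k, len (w ^ k * h) + k ≤ k * len w + len h := by
      intro k
      induction k with
      | zero => simp
      | succ k ih =>
        have h2 := hcon k
        have h3 := len_mul_le w (w ^ k * h)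
        rw [← mul_assoc, ← pow_succ'] at h3
        rw [add_mul]; omega
    have h4 := h1 (2 * len h + 1)
    have h5 := (hw.pow (2 * len h + 1)).1
    have h6 := len_mul_le (w ^ (2 * len h + 1) * h) h⁻¹
    rw [mul_inv_cancel_right, len_inv] at h6
    omega
  have hck : Commute w (w ^ k * h) := (Commute.pow_right rfl k).mul_right hc
  obtain ⟨a, b, ha, hab⟩ := comm_aux (h := w ^ k * h) hw1 hw hck
    (by rw [← mul_assoc, ← pow_succ', hk]) hs' (by rw [← mul_assoc, ← pow_succ']; exact hs _)
  have hcc : Commute (w ^ k) h := Commute.pow_left hc k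
  refine ⟨a, b - k * a, ha, ?_⟩
  rw [hcc.mul_pow, ← pow_mul] at hab
  have h8 : h ^ a = (w ^ (k * a))⁻¹ * w ^ b := eq_inv_mul_of_mul_eq hab
  rw [h8, ← zpow_natCast, ← zpow_natCast, ← zpow_neg, ← zpow_add]
  congr 1; push_cast; ring
end Proj

section FM
theorem freeMod {H Wt K Ω : Type} [Group H] [Group Wt] [Finite Ω] (ι : H →* Wt)
    (hι : Function.Injective ι) (Y : Wt → K → Prop) (o : Wt → K → Ω)
    (hinv : ∀ h g k, Y g k → Y (ι h * g) k)
    (ho : ∀ {g k g' k'}, Y g k → Y g' k' → (o g k = o g' k' ↔ k = k' ∧ ∃ h, g' = ι h * g)) :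
    ∃ (P : Type) (_ : AddCommGroup P) (_ : Module (MonoidAlgebra ℤ H) P) (b : Wt → K → P),
      Module.Finite (MonoidAlgebra ℤ H) P ∧ Module.Projective (MonoidAlgebra ℤ H) P ∧
      (∀ (N : Type) [AddCommGroup N] [Module (MonoidAlgebra ℤ H) N] (φ : Wt → K → N),
        (∀ h g k, Y g k → φ (ι h * g) k = (MonoidAlgebra.single h 1 : MonoidAlgebra ℤ H) • φ g k) →
        ∃ L : P →ₗ[MonoidAlgebra ℤ H] N, ∀ g k, Y g k → L (b g k) = φ g k) ∧
      (∀ (A : Type) [AddCommGroup A] (φ : Wt → K → A),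
        ∃ L : P →+ A, ∀ g k, Y g k → L (b g k) = φ g k) ∧
      (∀ (A : Type) [AddCommGroup A] (L L' : P →+ A),
        (∀ g k, Y g k → L (b g k) = L' (b g k)) → L = L') ∧
      (∀ h g k, Y g k → b (ι h * g) k = (MonoidAlgebra.single h 1 : MonoidAlgebra ℤ H) • b g k) := by
  classical
  let Ω' := {ω : Ω // ∃ y : Wt × K, Y y.1 y.2 ∧ o y.1 y.2 = ω}
  let r : Ω' → Wt × K := fun ω => ω.2.choose
  have r1 : ∀ ω, Y (r ω).1 (r ω).2 := fun ω => ω.2.choose_spec.1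
  have r2 : ∀ ω : Ω', o (r ω).1 (r ω).2 = ω.1 := fun ω => ω.2.choose_spec.2
  let q : ∀ g k, Y g k → Ω' := fun g k h => ⟨o g k, (g, k), h, rfl⟩
  have hq : ∀ g k (h : Y g k), ∃ x, g = ι x * (r (q g k h)).1 := fun g k h =>
    ((ho (r1 (q g k h)) h).1 (r2 _)).2
  have hqk : ∀ g k (h : Y g k), (r (q g k h)).2 = k := fun g k h =>
    ((ho (r1 (q g k h)) h).1 (r2 _)).1
  let b : Wt → K → (Ω' →₀ MonoidAlgebra ℤ H) := fun g k =>
    if h : Y g k then Finsupp.single (q g k h) (MonoidAlgebra.single (hq g k h).choose 1) else 0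
  have hb : ∀ ω x, b (ι x * (r ω).1) (r ω).2 = Finsupp.single ω (MonoidAlgebra.single x 1) := by
    intro ω x
    have hY := hinv x _ _ (r1 ω)
    have h1 : q _ _ hY = ω := Subtype.ext (by
      rw [← r2 ω]; exact ((ho (r1 ω) hY).2 ⟨rfl, x, rfl⟩).symm)
    have h2 := (hq _ _ hY).choose_spec
    have h3 : (hq _ _ hY).choose = x := by
      apply hι
      have h4 : (r (q _ _ hY)).1 = (r ω).1 := by rw [h1]
      exact (mul_right_cancel (h2.trans (congrArg (ι _ * ·) h4))).symm
    have : b (ι x * (r ω).1) (r ω).2 = Finsupp.single (q _ _ hY) (MonoidAlgebra.single (hq _ _ hY).choose 1) :=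
      dif_pos hY
    rw [this, h3, h1]
  have hY : ∀ {g k}, Y g k → ∃ ω x, g = ι x * (r ω).1 ∧ k = (r ω).2 := fun {g k} h =>
    ⟨q g k h, (hq g k h).choose, (hq g k h).choose_spec, (hqk g k h).symm⟩
  refine ⟨Ω' →₀ MonoidAlgebra ℤ H, inferInstance, inferInstance, b, inferInstance, inferInstance,
    ?_, ?_, ?_, ?_⟩
  · intro N _ _ φ hφ
    refine ⟨Finsupp.linearCombination _ (fun ω => φ (r ω).1 (r ω).2), fun g k h => ?_⟩
    obtain ⟨ω, x, rfl, rfl⟩ := hY h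
    rw [hb, Finsupp.linearCombination_single, hφ _ _ _ (r1 ω)]
  · intro A _ φ
    refine ⟨Finsupp.liftAddHom (fun ω => (Finsupp.liftAddHom (fun x : H =>
      (zmultiplesHom A (φ (ι x * (r ω).1) (r ω).2)))).comp
        (MonoidAlgebra.coeffAddEquiv).toAddMonoidHom), fun g k h => ?_⟩
    obtain ⟨ω, x, rfl, rfl⟩ := hY h
    rw [hb]
    simp
  · intro A _ L L' h
    ext ω x
    have := h _ _ (hinv x _ _ (r1 ω))
    rw [hb] at this
    simpa using this
  · intro h g k hy
    obtain ⟨ω, x, rfl, rfl⟩ := hY hy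
    rw [← mul_assoc, ← map_mul, hb, hb, Finsupp.smul_single, smul_eq_mul,
      MonoidAlgebra.single_mul_single, one_mul]
end FM

/-! ### State systems -/
class Sys (E S : Type) [RA E] where
  v : S → E → Prop
  mv : S → E → S
  dh : S → E → ℤ
  back : ∀ {s e}, v s e → v (mv s e) e
  mvmv : ∀ {s e}, v s e → mv (mv s e) e = s
  sq : ∀ {s e f}, C e f → v s e → v s f → v (mv s e) f
  mvc : ∀ {s e f}, C e f → v s e → v s f → mv (mv s e) f = mv (mv s f) e
  dhb : ∀ {s e}, v s e → dh (mv s e) e = - dh s e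
  dhs : ∀ {s e f}, C e f → v s e → v s f → dh (mv s e) f = dh s f
  dh1 : ∀ {s e}, v s e → dh s e = 1 ∨ dh s e = -1

section SysS
variable {E S : Type} [RA E] [Sys E S]
open Sys

open Classical in
noncomputable def act (e : E) (p : S × ℤ) : S × ℤ :=
  if v p.1 e then (mv p.1 e, p.2 + dh p.1 e) else p

theorem act_act (e : E) (p : S × ℤ) : act e (act e p) = p := by
  unfold act
  by_cases h : v p.1 e
  · simp [h, back h, mvmv h, dhb h]
  · simp [h]

theorem sq_iff {s : S} {e f : E} (h : C e f) (h1 : v s e) : v (mv s e) f ↔ v s f :=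
  ⟨fun h2 => by have := Sys.sq h (back h1) h2; rwa [mvmv h1] at this, Sys.sq h h1⟩

theorem act_comm {e f : E} (h : C e f) (p : S × ℤ) : act e (act f p) = act f (act e p) := by
  unfold act
  have h' := RA.symm h
  by_cases h1 : v p.1 e <;> by_cases h2 : v p.1 f
  · simp only [h1, h2, if_true, sq_iff h h1, sq_iff h' h2, mvc h h1 h2, dhs h h1 h2, dhs h' h2 h1]
    rw [add_right_comm]
  all_goals simp [h1, h2, sq_iff h, sq_iff h']

theorem act_exists : ∃ Φ : RW E →* Equiv.Perm (S × ℤ), ∀ e a, Φ (gs e) a = act e a := by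
  obtain ⟨Φ, h⟩ := RW_lift (E := E) (G := Equiv.Perm (S × ℤ))
    (fun e => ⟨act e, act e, act_act e, act_act e⟩)
    (fun e => by ext1 a; exact act_act e a)
    (fun e f h => by ext1 a; exact act_comm h a)
  exact ⟨Φ, fun e a => by rw [h]; rfl⟩

noncomputable def sx (x : S) (p : RW E) : S := (act_exists.choose p⁻¹ (x, 0)).1
noncomputable def hx (x : S) (p : RW E) : ℤ := (act_exists.choose p⁻¹ (x, 0)).2

@[simp] theorem sx_one (x : S) : sx x (1 : RW E) = x := by simp [sx]
@[simp] theorem hx_one (x : S) : hx x (1 : RW E) = 0 := by simp [hx]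

theorem st_step (x : S) (g : RW E) (e : E) :
    (sx x (g * gs e), hx x (g * gs e)) = act e (sx x g, hx x g) := by
  simp only [sx, hx, mul_inv_rev, gs_inv, map_mul, Equiv.Perm.mul_apply, Prod.mk.eta]
  exact (act_exists (E := E) (S := S)).choose_spec e _

theorem sx_v {x : S} {g : RW E} {e : E} (h : v (sx x g) e) : sx x (g * gs e) = mv (sx x g) e := by
  have := congrArg Prod.fst (st_step x g e); simpa [act, h] using this
theorem hx_v {x : S} {g : RW E} {e : E} (h : v (sx x g) e) :
    hx x (g * gs e) = hx x g + dh (sx x g) e := by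
  have := congrArg Prod.snd (st_step x g e); simpa [act, h] using this
theorem sx_n {x : S} {g : RW E} {e : E} (h : ¬ v (sx x g) e) : sx x (g * gs e) = sx x g := by
  have := congrArg Prod.fst (st_step x g e); simpa [act, h] using this
theorem hx_n {x : S} {g : RW E} {e : E} (h : ¬ v (sx x g) e) : hx x (g * gs e) = hx x g := by
  have := congrArg Prod.snd (st_step x g e); simpa [act, h] using this

theorem st_mul (x : S) (g p : RW E) : sx x (g * p) = sx (sx x g) p ∧
    hx x (g * p) = hx x g + hx (sx x g) p := by
  induction p using RW_ind with
  | h1 => simp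
  | h2 p e ih =>
    rw [← mul_assoc]
    by_cases h : v (sx (sx x g) p) e
    · rw [sx_v h, hx_v h, sx_v (by rwa [ih.1]), hx_v (by rwa [ih.1]), ih.1, ih.2, add_assoc]; simp
    · rw [sx_n h, hx_n h, sx_n (by rwa [ih.1]), hx_n (by rwa [ih.1]), ih.1, ih.2]; simp
theorem sx_mul (x : S) (g p : RW E) : sx x (g * p) = sx (sx x g) p := (st_mul x g p).1
theorem hx_mul (x : S) (g p : RW E) : hx x (g * p) = hx x g + hx (sx x g) p := (st_mul x g p).2
theorem sx_inv {x y : S} {g : RW E} (h : sx x g = y) : sx y g⁻¹ = x := by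
  rw [← h, ← sx_mul]; simp
theorem hx_inv {x y : S} {g : RW E} (h : sx x g = y) : hx y g⁻¹ = - hx x g := by
  have := hx_mul x g g⁻¹
  rw [h] at this; simp at this; omega

def vx (x : S) (g : RW E) (e : E) : Prop := v (sx x g) e

theorem vdx (x : S) : Vd (vx (E := E) x) :=
  ⟨fun h => by unfold vx at *; rw [sx_v h]; exact back h,
   fun h h1 h2 => by unfold vx at *; rw [sx_v h1]; exact Sys.sq h h1 h2⟩

theorem shift_vx (x : S) (g : RW E) : shift (vx x) g = vx (sx x g) := by
  funext p e; simp [shift, vx, sx_mul]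

theorem Xm {x y : S} {g p : RW E} (h : Xt (vx x) g) (hy : sx x g = y) (h2 : Xt (vx y) p) :
    Xt (vx x) (g * p) := h.mul (by rwa [shift_vx, hy])
theorem Xi {x y : S} {g : RW E} (h : Xt (vx x) g) (hy : sx x g = y) : Xt (vx y) g⁻¹ := by
  have := h.inv (vdx x); rwa [shift_vx, hy] at this

/-- fundamental group -/
def Gx (E : Type) {S : Type} [RA E] [Sys E S] (x : S) : Subgroup (RW E) where
  carrier := {g | Xt (vx x) g ∧ sx x g = x}
  one_mem' := ⟨.one, sx_one x⟩
  mul_mem' := fun {a b} ha hb => ⟨Xm ha.1 ha.2 hb.1, by rw [sx_mul, ha.2, hb.2]⟩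
  inv_mem' := fun {a} ha => ⟨Xi ha.1 ha.2, sx_inv ha.2⟩

noncomputable def ph (E : Type) {S : Type} [RA E] [Sys E S] (x : S) : Gx E x →* Multiplicative ℤ where
  toFun g := Multiplicative.ofAdd (hx x g.1)
  map_one' := by simp
  map_mul' a b := by
    rw [← ofAdd_add]; congr 1
    have := hx_mul x a.1 b.1
    rwa [a.2.2] at this

end SysS

/-! ### Extension across levels -/
section Ext
variable {E S : Type} [RA E] [Sys E S]
open Sys

def Oct (x : S) (τ : ℤ) (e : E) : Prop := v x e ∧ dh x e = τ

def OctC (E : Type) {S : Type} [RA E] [Sys E S] (x : S) (τ : ℤ) : Prop :=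
  (∃ e : E, Oct x τ e) ∧ ∀ (T : Type) (f : E → T),
    (∀ e e', Oct x τ e → Oct x τ e' → C e e' → f e = f e') →
    ∀ e e', Oct x τ e → Oct x τ e' → f e = f e'

def OctH (E : Type) {S : Type} [RA E] [Sys E S] (x : S) (τ : ℤ) : Prop :=
  ∀ (M : Type) [CommGroup M] (b : E → E → M),
    (∀ e f, Oct x τ e → Oct x τ f → C e f → b e f * b f e = 1) →
    (∀ e f g, Oct x τ e → Oct x τ f → Oct x τ g → C e f → C f g → C e g →
      b e f * b f g = b e g) →
    ∃ p : E → M, ∀ e f, Oct x τ e → Oct x τ f → C e f → p e * b e f = p f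

def IsPM (σ : ℤ) : Prop := σ = 1 ∨ σ = -1

variable (x0 : S) (σ : ℤ) (lo : RW E → Prop)

def Vl (n : ℤ) (g : RW E) : Prop := lo g ∧ σ * hx x0 g ≤ n

variable {x0 σ lo}

theorem ht_step {g : RW E} {e : E} (h : vx x0 g e) :
    σ * hx x0 (g * gs e) = σ * hx x0 g + σ * dh (sx x0 g) e := by
  rw [hx_v h]; ring

theorem pm_dh (hσ : IsPM σ) {x : S} {e : E} (h : v x e) : IsPM (σ * dh x e) := by
  rcases hσ with rfl | rfl <;> rcases dh1 h with h | h <;> rw [h] <;> simp [IsPM]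

theorem oct_iff (hσ : IsPM σ) {x : S} {e : E} : Oct x (-σ) e ↔ v x e ∧ σ * dh x e = -1 := by
  unfold Oct
  rcases hσ with rfl | rfl <;> simp

theorem dh_back {g : RW E} {e : E} (h : vx x0 g e) :
    dh (sx x0 (g * gs e)) e = - dh (sx x0 g) e := by
  rw [sx_v h, dhb h]
theorem dh_sq {g : RW E} {e f : E} (h : C e f) (h1 : vx x0 g e) (h2 : vx x0 g f) :
    dh (sx x0 (g * gs e)) f = dh (sx x0 g) f := by
  rw [sx_v h1, dhs h h1 h2]

def PotOn {A : Type} [Group A] (val : RW E → E → Prop) (Q : RW E → Prop) (c : RW E → E → A)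
    (f : RW E → A) : Prop :=
  ∀ g e, val g e → Q g → Q (g * gs e) → f (g * gs e) = f g * c g e

theorem E0step (hσ : IsPM σ) (hO : ∀ x : S, OctC E x (-σ)) {n : ℤ}
    (hX : ∀ g, lo g → Xt (vx x0) g) (hlo : ∀ g, Xt (vx x0) g → n - 1 ≤ σ * hx x0 g → lo g)
    {A : Type} [Group A] {c : RW E → E → A} {f : RW E → A}
    (hc : Flat (vx x0) (Vl x0 σ lo (n + 1)) c) (hf : PotOn (vx x0) (Vl x0 σ lo n) c f) :
    ∃ f', (∀ g, σ * hx x0 g ≤ n → f' g = f g) ∧ PotOn (vx x0) (Vl x0 σ lo (n + 1)) c f' := by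
  classical
  have hv := vdx (E := E) x0
  choose d hd using fun g : RW E => (hO (sx x0 g)).1
  let f' : RW E → A := fun g => if σ * hx x0 g ≤ n then f g else f (g * gs (d g)) * c (g * gs (d g)) (d g)
  have low : ∀ g, σ * hx x0 g ≤ n → f' g = f g := fun g h => if_pos h
  have top : ∀ g, lo g → σ * hx x0 g = n + 1 → ∀ e, vx x0 g e → σ * dh (sx x0 g) e = -1 →
      f' g = f (g * gs e) * c (g * gs e) e := by
    intro g hg hn e he hde
    have h0 : f' g = f (g * gs (d g)) * c (g * gs (d g)) (d g) := if_neg (by omega)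
    rw [h0]
    refine (hO (sx x0 g)).2 A (fun e => f (g * gs e) * c (g * gs e) e) ?_ _ _ (hd g)
      ((oct_iff hσ).2 ⟨he, hde⟩)
    intro e e' h1 h2 hC
    rw [oct_iff hσ] at h1 h2
    have hX0 := hX g hg
    have a1 : Xt (vx x0) (g * gs e) := hX0.step h1.1
    have a2 : Xt (vx x0) (g * gs e') := hX0.step h2.1
    have b1 := ht_step (σ := σ) (x0 := x0) h1.1
    have b2 := ht_step (σ := σ) (x0 := x0) h2.1
    have v1 : vx x0 (g * gs e) e' := hv.sq hC h1.1 h2.1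
    have v2 : vx x0 (g * gs e') e := hv.sq (RA.symm hC) h2.1 h1.1
    have a3 := a1.step v1
    have b3 := ht_step (σ := σ) (x0 := x0) v1
    rw [dh_sq hC h1.1 h2.1] at b3
    have e12 : g * gs e' * gs e = g * gs e * gs e' := mul_gs_comm g (RA.symm hC)
    have w1 := hv.back v1
    have w2 := hv.back v2
    rw [e12] at w2
    have l1 := hlo _ a1 (by omega)
    have l2 := hlo _ a2 (by omega)
    have l3 := hlo _ a3 (by omega)
    have p1 := hf _ _ w1 ⟨l3, by omega⟩ ⟨by simpa using l1, by simp; omega⟩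
    have q2 : g * gs e * gs e' * gs e = g * gs e' := by rw [← e12]; simp
    have p2 := hf _ _ w2 ⟨l3, by omega⟩ ⟨by rwa [q2], by rw [q2]; omega⟩
    rw [q2] at p2
    simp only [mul_gs_gs] at p1
    have s := hc.sq (g := g * gs e * gs e') hC w2 w1 ⟨l3, by omega⟩ ⟨by rwa [q2], by rw [q2]; omega⟩
      ⟨by simpa using l1, by simp; omega⟩ ⟨by simpa [q2] using hg, by simp [q2]; omega⟩
    rw [q2, mul_gs_gs] at s
    rw [p1, p2, mul_assoc (f _), mul_assoc (f _), s]
  refine ⟨f', low, ?_⟩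
  intro g e he h1 h2
  have b1 := ht_step (σ := σ) (x0 := x0) he
  have pm := pm_dh hσ he
  by_cases t1 : σ * hx x0 g ≤ n
  · by_cases t2 : σ * hx x0 (g * gs e) ≤ n
    · rw [low _ t1, low _ t2]; exact hf _ _ he ⟨h1.1, t1⟩ ⟨h2.1, t2⟩
    · rw [low _ t1, top (g * gs e) h2.1 (by have := h2.2; omega) e (hv.back he), mul_gs_gs]
      rw [dh_back he]; rcases pm with h | h <;> [linarith; omega]
  · have t3 : σ * dh (sx x0 g) e = -1 := by
      rcases pm with h | h
      · have := h2.2; omega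
      · exact h
    rw [top g h1.1 (by have := h1.2; omega) e he t3, low _ (by have := h1.2; omega), mul_assoc]
    have := hc.inv (hv.back he) h2 (by simpa using h1)
    rw [mul_gs_gs] at this
    rw [this, mul_one]

theorem flat_of_top (hσ : IsPM σ) {Q : RW E → Prop} {A : Type} [Group A] {c : RW E → E → A}
    (h1 : ∀ {g e}, vx x0 g e → Q g → Q (g * gs e) → c g e * c (g * gs e) e = 1)
    (h2 : ∀ {g e f}, C e f → vx x0 g e → vx x0 g f → Q g → Q (g * gs e) → Q (g * gs f) →
    Q (g * gs e * gs f) → σ * dh (sx x0 g) e = -1 → σ * dh (sx x0 g) f = -1 →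
    c g e * c (g * gs e) f = c g f * c (g * gs f) e) : Flat (vx x0) Q c := by
  have hv := vdx (E := E) x0
  have key : ∀ {g e f}, C e f → vx x0 g e → vx x0 g f → Q g → Q (g * gs e) → Q (g * gs f) →
    Q (g * gs e * gs f) → c (g * gs e) e * c g f = c (g * gs e) f * c (g * gs e * gs f) e →
    c g e * c (g * gs e) f = c g f * c (g * gs f) e := by
    intro g e f hC he hf q0 q1 q2 q3 h
    have e12 : g * gs e * gs f = g * gs f * gs e := mul_gs_comm g hC
    have i1 := h1 he q0 q1
    have i2 := h1 (hv.sq (RA.symm hC) hf he) q2 (by rwa [← e12])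
    rw [e12, eq_inv_of_mul_eq_one_right i1, eq_inv_of_mul_eq_one_right i2, inv_mul_eq_iff_eq_mul,
      ← mul_assoc, eq_mul_inv_iff_mul_eq] at h
    exact h.symm
  have step2 : ∀ {g e f}, C e f → vx x0 g e → vx x0 g f → Q g → Q (g * gs e) → Q (g * gs f) →
    Q (g * gs e * gs f) → σ * dh (sx x0 g) f = -1 →
    c g e * c (g * gs e) f = c g f * c (g * gs f) e := by
    intro g e f hC he hf q0 q1 q2 q3 hd
    have e12 : g * gs e * gs f = g * gs f * gs e := mul_gs_comm g hC
    rcases pm_dh hσ he with hp | hp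
    · refine key hC he hf q0 q1 q2 q3 ?_
      have q4 : g * gs e * gs f * gs e = g * gs f := by rw [e12]; simp
      have := h2 (g := g * gs e) hC (hv.back he) (hv.sq hC he hf) q1 (by simpa) q3
        (by simpa) (by rw [dh_back he]; linarith) (by rw [dh_sq hC he hf]; exact hd)
      simpa using this
    · exact h2 hC he hf q0 q1 q2 q3 hp hd
  refine ⟨h1, ?_⟩
  intro g e f hC he hf q0 q1 q2 q3
  have e12 : g * gs e * gs f = g * gs f * gs e := mul_gs_comm g hC
  rcases pm_dh hσ hf with hp | hp
  · refine (key (RA.symm hC) hf he q0 q2 q1 (by rwa [← e12]) ?_).symm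
    have := step2 (g := g * gs f) hC (hv.sq (RA.symm hC) hf he) (hv.back hf) q2 (by rwa [← e12]) (by simpa)
        (by rw [← e12]; simpa) (by rw [dh_back hf]; linarith)
    simpa using this.symm
  · exact step2 hC he hf q0 q1 q2 q3 hp

theorem E1step (hσ : IsPM σ) (hO : ∀ x : S, OctH E x (-σ)) {n : ℤ}
    (hX : ∀ g, lo g → Xt (vx x0) g) (hlo : ∀ g, Xt (vx x0) g → n - 2 ≤ σ * hx x0 g → lo g)
    {A : Type} [CommGroup A] {c : RW E → E → A} (hc : Flat (vx x0) (Vl x0 σ lo n) c) :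
    ∃ c' : RW E → E → A, (∀ g e, σ * hx x0 g ≤ n → σ * hx x0 (g * gs e) ≤ n → c' g e = c g e) ∧
      Flat (vx x0) (Vl x0 σ lo (n + 1)) c' := by
  classical
  have hv := vdx (E := E) x0
  have hp : ∀ g : RW E, ∃ p : E → A, lo g → σ * hx x0 g = n + 1 → ∀ e f, Oct (sx x0 g) (-σ) e →
      Oct (sx x0 g) (-σ) f → C e f → p e * (c (g * gs e) f * (c (g * gs f) e)⁻¹) = p f := by
    intro g
    by_cases hg : lo g ∧ σ * hx x0 g = n + 1
    swap
    · exact ⟨fun _ => 1, fun h1 h2 => absurd ⟨h1, h2⟩ hg⟩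
    have hX0 := hX g hg.1
    have hn := hg.2
    have one : ∀ e, Oct (sx x0 g) (-σ) e → vx x0 g e ∧ Xt (vx x0) (g * gs e) ∧
        σ * hx x0 (g * gs e) = n := by
      intro e he
      rw [oct_iff hσ] at he
      have b1 := ht_step (σ := σ) (x0 := x0) he.1
      exact ⟨he.1, hX0.step he.1, by omega⟩
    have two : ∀ e f, Oct (sx x0 g) (-σ) e → Oct (sx x0 g) (-σ) f → C e f →
        vx x0 (g * gs e) f ∧ Xt (vx x0) (g * gs e * gs f) ∧ σ * hx x0 (g * gs e * gs f) = n - 1 ∧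
        σ * dh (sx x0 (g * gs e)) f = -1 := by
      intro e f he hf hC
      obtain ⟨h1, h2, h3⟩ := one e he
      have w : vx x0 (g * gs e) f := hv.sq hC h1 hf.1
      have b1 := ht_step (σ := σ) (x0 := x0) w
      rw [oct_iff hσ] at hf
      rw [dh_sq hC h1 hf.1] at *
      exact ⟨w, h2.step w, by omega, hf.2⟩
    have three : ∀ e f k, Oct (sx x0 g) (-σ) e → Oct (sx x0 g) (-σ) f → Oct (sx x0 g) (-σ) k →
        C e f → C f k → C e k → c (g * gs e) f * c (g * gs e * gs f) k =
          c (g * gs e) k * c (g * gs e * gs k) f := by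
      intro e f k he hf hk h1 h2 h3
      obtain ⟨a1, a2, a3⟩ := one e he
      obtain ⟨b1, b2, b3, _⟩ := two e f he hf h1
      obtain ⟨d1, d2, d3, d4⟩ := two e k he hk h3
      have w := hv.sq h2 b1 d1
      have t := ht_step (σ := σ) (x0 := x0) w
      rw [dh_sq h2 b1 d1] at t
      exact hc.sq h2 b1 d1 ⟨hlo _ a2 (by omega), by omega⟩ ⟨hlo _ b2 (by omega), by omega⟩
        ⟨hlo _ d2 (by omega), by omega⟩ ⟨hlo _ (b2.step w) (by omega), by omega⟩
    suffices H : _ by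
      obtain ⟨p, hp⟩ := hO (sx x0 g) A (fun e f => c (g * gs e) f * (c (g * gs f) e)⁻¹)
        (fun e f _ _ _ => by simp) H
      exact ⟨p, fun _ _ => hp⟩
    · intro e f k he hf hk h1 h2 h3
      have s1 := three e f k he hf hk h1 h2 h3
      have s2 := three f e k hf he hk (RA.symm h1) h3 h2
      have s3 := three k e f hk he hf (RA.symm h3) h1 (RA.symm h2)
      rw [mul_gs_comm g (RA.symm h1)] at s2
      rw [mul_gs_comm g (RA.symm h3), mul_gs_comm g (RA.symm h2)] at s3
      generalize c (g * gs e) f = a1 at *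
      generalize c (g * gs e) k = a2 at *
      generalize c (g * gs f) e = a3 at *
      generalize c (g * gs f) k = a4 at *
      generalize c (g * gs k) e = a5 at *
      generalize c (g * gs k) f = a6 at *
      generalize c (g * gs e * gs f) k = u at *
      generalize c (g * gs e * gs k) f = w at *
      generalize c (g * gs f * gs k) e = z at *
      have e1 := eq_mul_inv_of_mul_eq s1
      have e2 := eq_mul_inv_of_mul_eq s2
      have e3 := eq_mul_inv_of_mul_eq s3
      rw [e1, e2, e3]
      simp only [mul_inv_rev, inv_inv]
      apply_fun (fun t => t * (a2⁻¹ * a6 * z * w⁻¹))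
      · beta_reduce
        have : a2 * w * u⁻¹ * (u * (z⁻¹ * a4⁻¹)) * (a4 * a6⁻¹) * (a2⁻¹ * a6 * z * w⁻¹) = 1 := by
          have : a2 * w * u⁻¹ * (u * (z⁻¹ * a4⁻¹)) * (a4 * a6⁻¹) * (a2⁻¹ * a6 * z * w⁻¹) =
            (a2 * a2⁻¹) * (w * w⁻¹) * (u * u⁻¹) * (z * z⁻¹) * (a4 * a4⁻¹) * (a6 * a6⁻¹) := by ac_rfl
          rw [this]; simp
        rw [this]
        have : a2 * (w * (z⁻¹ * a6⁻¹)) * (a2⁻¹ * a6 * z * w⁻¹) = 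
            (a2 * a2⁻¹) * (w * w⁻¹) * (z * z⁻¹) * (a6 * a6⁻¹) := by ac_rfl
        rw [this]; simp
      · exact mul_left_injective _
  choose p hp using hp
  let c' : RW E → E → A := fun g e => if σ * hx x0 g ≤ n then
    (if σ * hx x0 (g * gs e) ≤ n then c g e else (p (g * gs e) e)⁻¹) else p g e
  have r1 : ∀ g e, σ * hx x0 g ≤ n → σ * hx x0 (g * gs e) ≤ n → c' g e = c g e := by
    intro g e h1 h2; simp [c', h1, h2]
  have r2 : ∀ g e, ¬ σ * hx x0 g ≤ n → c' g e = p g e := by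
    intro g e h1; simp [c', h1]
  have r3 : ∀ g e, σ * hx x0 g ≤ n → ¬ σ * hx x0 (g * gs e) ≤ n → c' g e = (p (g * gs e) e)⁻¹ := by
    intro g e h1 h2; simp only [c']; rw [if_pos h1, if_neg h2]
  refine ⟨c', r1, flat_of_top hσ ?_ ?_⟩
  · intro g e he q1 q2
    have b1 := ht_step (σ := σ) (x0 := x0) he
    have pm := pm_dh hσ he
    have := q1.2
    have := q2.2
    by_cases t1 : σ * hx x0 g ≤ n
    · by_cases t2 : σ * hx x0 (g * gs e) ≤ n
      · rw [r1 _ _ t1 t2, r1 _ _ t2 (by simpa), hc.inv he ⟨q1.1, t1⟩ ⟨q2.1, t2⟩]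
      · rw [r3 _ _ t1 t2, r2 _ _ t2]; simp
    · have t2 : σ * hx x0 (g * gs e) ≤ n := by rcases pm with h | h <;> omega
      rw [r2 _ _ t1, r3 _ _ t2 (by rwa [mul_gs_gs])]; simp
  · intro g e f hC he hf q0 q1 q2 q3 hde hdf
    have b1 := ht_step (σ := σ) (x0 := x0) he
    have b2 := ht_step (σ := σ) (x0 := x0) hf
    have b3 := ht_step (σ := σ) (x0 := x0) (hv.sq hC he hf)
    have e12 : g * gs e * gs f = g * gs f * gs e := mul_gs_comm g hC
    rw [dh_sq hC he hf] at b3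
    have hq := q0.2
    rw [r1 (g * gs e) f (by omega) (by omega), r1 (g * gs f) e (by omega) (by rw [← e12]; omega)]
    by_cases t : σ * hx x0 g ≤ n
    · rw [r1 _ _ t (by omega), r1 _ _ t (by omega)]
      exact hc.sq hC he hf ⟨q0.1, t⟩ ⟨q1.1, by omega⟩ ⟨q2.1, by omega⟩ ⟨q3.1, by omega⟩
    · rw [r2 _ _ t, r2 _ _ t, ← hp g q0.1 (by omega) e f ((oct_iff hσ).2 ⟨he, hde⟩)
        ((oct_iff hσ).2 ⟨hf, hdf⟩) hC]
      simp [mul_assoc]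

theorem seqlem {Z A : Type} (lev : Z → ℤ) (N : ℤ) (P : ℤ → (Z → A) → Prop) (f0 : Z → A)
    (h0 : P N f0) (step : ∀ n ≥ N, ∀ f, P n f → ∃ f', (∀ z, lev z ≤ n → f' z = f z) ∧ P (n + 1) f') :
    ∃ F : Z → A, (∀ z, lev z ≤ N → F z = f0 z) ∧
      ∀ n ≥ N, ∃ f, P n f ∧ ∀ z, lev z ≤ n → F z = f z := by
  have step' : ∀ k : ℕ, ∀ f : {f // P (N + k) f}, ∃ f' : {f // P (N + (k + 1 : ℕ)) f},
      ∀ z, lev z ≤ N + k → f'.1 z = f.1 z := by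
    intro k f
    obtain ⟨f', h1, h2⟩ := step (N + k) (by omega) f.1 f.2
    exact ⟨⟨f', by push_cast; rwa [← add_assoc]⟩, h1⟩
  choose nx hnx using step'
  let s : ∀ k : ℕ, {f // P (N + k) f} := fun k => Nat.rec ⟨f0, by simpa using h0⟩ (fun k f => nx k f) k
  have hs : ∀ k j z, lev z ≤ N + (k : ℕ) → (s (k + j)).1 z = (s k).1 z := by
    intro k j z hz
    induction j with
    | zero => rfl
    | succ j ih => rw [← ih]; exact hnx (k + j) _ z (by push_cast; omega)
  have hF : ∀ (k : ℕ) z, lev z ≤ N + k → (s (lev z - N).toNat).1 z = (s k).1 z := by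
    intro k z hz
    have := hs (lev z - N).toNat (k - (lev z - N).toNat) z (by omega)
    rw [Nat.add_sub_cancel' (by omega)] at this
    exact this.symm
  refine ⟨fun z => (s (lev z - N).toNat).1 z, fun z hz => hF 0 z (by simpa), fun n hn => ?_⟩
  refine ⟨(s (n - N).toNat).1, ?_, fun z hz => hF _ z (by omega)⟩
  obtain ⟨k, rfl⟩ : ∃ k : ℕ, n = N + k := ⟨(n - N).toNat, by omega⟩
  rw [show (N + (k : ℤ) - N).toNat = k by omega]
  exact (s k).2

theorem E1all (hσ : IsPM σ) (hO : ∀ x : S, OctH E x (-σ)) {N : ℤ}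
    (hX : ∀ g, lo g → Xt (vx x0) g) (hlo : ∀ g, Xt (vx x0) g → N - 2 ≤ σ * hx x0 g → lo g)
    {A : Type} [CommGroup A] {c : RW E → E → A} (hc : Flat (vx x0) (Vl x0 σ lo N) c) :
    ∃ c' : RW E → E → A, (∀ g e, σ * hx x0 g ≤ N → σ * hx x0 (g * gs e) ≤ N → c' g e = c g e) ∧
      Flat (vx x0) lo c' := by
  obtain ⟨F, h1, h2⟩ := seqlem (Z := RW E × E) (A := A)
    (fun z => max (σ * hx x0 z.1) (σ * hx x0 (z.1 * gs z.2))) N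
    (fun n f => Flat (vx x0) (Vl x0 σ lo n) (fun g e => f (g, e))) (fun z => c z.1 z.2) hc
    (fun n hn f hf => by
      obtain ⟨c', h1, h2⟩ := E1step hσ hO hX (fun g hg h => hlo g hg (by omega)) hf
      exact ⟨fun z => c' z.1 z.2, fun z hz => h1 _ _ (le_of_max_le_left hz) (le_of_max_le_right hz), h2⟩)
  refine ⟨fun g e => F (g, e), fun g e a b => h1 (g, e) (max_le a b), ⟨?_, ?_⟩⟩
  · intro g e he q1 q2
    obtain ⟨f, hf, hF⟩ := h2 (max N (max (σ * hx x0 g) (σ * hx x0 (g * gs e)))) (le_max_left _ _)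
    rw [hF _ (by grind), hF _ (by grind [mul_gs_gs])]
    exact hf.inv he ⟨q1, by simp⟩ ⟨q2, by simp⟩
  · intro g e k hC he hk q0 q1 q2 q3
    have e12 : g * gs e * gs k = g * gs k * gs e := mul_gs_comm g hC
    obtain ⟨f, hf, hF⟩ := h2 (max N (max (max (σ * hx x0 g) (σ * hx x0 (g * gs e)))
      (max (σ * hx x0 (g * gs k)) (σ * hx x0 (g * gs e * gs k))))) (le_max_left _ _)
    rw [hF _ (by grind), hF _ (by grind), hF _ (by grind), hF _ (by grind)]
    exact hf.sq hC he hk ⟨q0, by simp⟩ ⟨q1, by simp⟩ ⟨q2, by simp⟩ ⟨q3, by simp⟩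

theorem E0all (hσ : IsPM σ) (hO : ∀ x : S, OctC E x (-σ)) {N : ℤ}
    (hX : ∀ g, lo g → Xt (vx x0) g) (hlo : ∀ g, Xt (vx x0) g → N - 1 ≤ σ * hx x0 g → lo g)
    {A : Type} [Group A] {c : RW E → E → A} {f : RW E → A} (hc : Flat (vx x0) lo c)
    (hf : PotOn (vx x0) (Vl x0 σ lo N) c f) :
    ∃ f' : RW E → A, (∀ g, σ * hx x0 g ≤ N → f' g = f g) ∧ PotOn (vx x0) lo c f' := by
  obtain ⟨F, h1, h2⟩ := seqlem (Z := RW E) (A := A)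
    (fun z => σ * hx x0 z) N (fun n f => PotOn (vx x0) (Vl x0 σ lo n) c f) f hf
    (fun n hn f hf => E0step hσ hO hX (fun g hg h => hlo g hg (by omega))
      ⟨fun h1 h2 h3 => hc.inv h1 h2.1 h3.1,
        fun h0 h1 h2 h3 h4 h5 h6 => hc.sq h0 h1 h2 h3.1 h4.1 h5.1 h6.1⟩ hf)
  refine ⟨F, h1, ?_⟩
  intro g e he q1 q2
  obtain ⟨f, hf, hF⟩ := h2 (max N (max (σ * hx x0 g) (σ * hx x0 (g * gs e)))) (le_max_left _ _)
  rw [hF _ (by simp), hF _ (by simp)]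
  exact hf g e he ⟨q1, by simp⟩ ⟨q2, by simp⟩
end Ext

/-! ### FP2 -/
section FP2S
variable {E S : Type} [RA E] [Sys E S]
open Sys

theorem Flat.mono {A : Type} [Group A] {val : RW E → E → Prop} {Q Q' : RW E → Prop}
    {c : RW E → E → A} (h : Flat val Q c) (hq : ∀ g, Q' g → Q g) : Flat val Q' c :=
  ⟨fun h1 h2 h3 => h.inv h1 (hq _ h2) (hq _ h3),
    fun h0 h1 h2 h3 h4 h5 h6 => h.sq h0 h1 h2 (hq _ h3) (hq _ h4) (hq _ h5) (hq _ h6)⟩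

def Sl (x0 : S) (g : RW E) : Prop := Xt (vx x0) g ∧ 0 ≤ hx x0 g ∧ hx x0 g ≤ 2

theorem slab1 {x0 : S} (hH : ∀ (x : S) τ, IsPM τ → OctH E x τ) {A : Type} [CommGroup A]
    {c : RW E → E → A} (hc : Flat (vx x0) (Sl x0) c) :
    ∃ c' : RW E → E → A, (∀ g e, Sl x0 g → Sl x0 (g * gs e) → c' g e = c g e) ∧
      Flat (vx x0) (Xt (vx x0)) c' := by
  obtain ⟨c1, h1, h2⟩ := E1all (σ := 1) (lo := fun g => Xt (vx x0) g ∧ 0 ≤ hx x0 g) (x0 := x0) (N := 2)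
    (Or.inl rfl) (fun x => hH x _ (Or.inr rfl)) (fun g h => h.1) (fun g h h' => ⟨h, by omega⟩)
    (hc.mono (fun g h => ⟨h.1.1, h.1.2, by have := h.2; omega⟩))
  obtain ⟨c2, h3, h4⟩ := E1all (σ := -1) (lo := Xt (vx x0)) (x0 := x0) (N := 0)
    (Or.inr rfl) (fun x => hH x _ (Or.inl rfl)) (fun g h => h) (fun g h h' => h)
    (h2.mono (fun g h => ⟨h.1, by have := h.2; omega⟩))
  exact ⟨c2, fun g e hg hg' => (h3 g e (by have := hg.2; omega) (by have := hg'.2; omega)).trans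
    (h1 g e (by have := hg.2; omega) (by have := hg'.2; omega)), h4⟩

theorem slab0 {x0 : S} (hC : ∀ (x : S) τ, IsPM τ → OctC E x τ) {A : Type} [Group A]
    {f : RW E → A} (hf : ∀ g e, vx x0 g e → Sl x0 g → Sl x0 (g * gs e) → f (g * gs e) = f g)
    {g : RW E} (hg : Sl x0 g) : f g = f 1 := by
  have fl : ∀ Q : RW E → Prop, Flat (A := A) (vx x0) Q (fun _ _ => 1) := fun Q =>
    ⟨fun _ _ _ => by simp, fun _ _ _ _ _ _ _ => rfl⟩
  obtain ⟨c1, h1, h2⟩ := E0all (σ := 1) (lo := fun g => Xt (vx x0) g ∧ 0 ≤ hx x0 g) (x0 := x0) (N := 2)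
    (Or.inl rfl) (fun x => hC x _ (Or.inr rfl)) (fun g h => h.1) (fun g h h' => ⟨h, by omega⟩)
    (f := f) (fl _) (fun g e he h h' => by
      rw [hf g e he ⟨h.1.1, h.1.2, by have := h.2; omega⟩ ⟨h'.1.1, h'.1.2, by have := h'.2; omega⟩, mul_one])
  obtain ⟨c2, h3, h4⟩ := E0all (σ := -1) (lo := Xt (vx x0)) (x0 := x0) (N := 0)
    (Or.inr rfl) (fun x => hC x _ (Or.inl rfl)) (fun g h => h) (fun g h h' => h)
    (f := c1) (fl _) (fun g e he h h' => h2 g e he ⟨h.1, by have := h.2; omega⟩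
      ⟨h'.1, by have := h'.2; omega⟩)
  have key : ∀ g, Sl x0 g → c2 g = f g := fun g hg =>
    (h3 g (by have := hg.2; omega)).trans (h1 g (by have := hg.2; omega))
  rw [← key g hg, ← key 1 ⟨.one, by simp⟩]
  refine Xt.ind (p := fun g => c2 g = c2 1) rfl (fun g e hg he ih => ?_) hg.1
  rw [h4 g e he hg (hg.step he), mul_one, ih]

variable (x0 : S)

noncomputable def iH : (ph E x0).ker →* RW E := (Gx E x0).subtype.comp (ph E x0).ker.subtype
theorem iH_inj : Function.Injective (iH (E := E) x0) := fun _ _ h => Subtype.ext (Subtype.ext h)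
variable {x0}
theorem iH_spec (h : (ph E x0).ker) : Xt (vx x0) (iH x0 h) ∧ sx x0 (iH x0 h) = x0 ∧ hx x0 (iH x0 h) = 0 :=
  ⟨h.1.2.1, h.1.2.2, ofAdd_eq_one.1 h.2⟩
theorem iH_ex {g : RW E} (h1 : Xt (vx x0) g) (h2 : sx x0 g = x0) (h3 : hx x0 g = 0) :
    ∃ h : (ph E x0).ker, iH x0 h = g := ⟨⟨⟨g, h1, h2⟩, ofAdd_eq_one.2 h3⟩, rfl⟩
theorem sx_iH (h : (ph E x0).ker) (g : RW E) : sx x0 (iH x0 h * g) = sx x0 g := by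
  rw [sx_mul, (iH_spec h).2.1]
theorem hx_iH (h : (ph E x0).ker) (g : RW E) : hx x0 (iH x0 h * g) = hx x0 g := by
  rw [hx_mul, (iH_spec h).2.1, (iH_spec h).2.2, zero_add]
theorem vx_iH (h : (ph E x0).ker) (g : RW E) : vx x0 (iH x0 h * g) = vx x0 g := by
  funext e; rw [vx, sx_iH, vx]
theorem Xt_iH (h : (ph E x0).ker) {g : RW E} (hg : Xt (vx x0) g) : Xt (vx x0) (iH x0 h * g) :=
  Xm (iH_spec h).1 (iH_spec h).2.1 hg
theorem Sl_iH (h : (ph E x0).ker) {g : RW E} (hg : Sl x0 g) : Sl x0 (iH x0 h * g) :=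
  ⟨Xt_iH h hg.1, by rw [hx_iH]; exact hg.2⟩

theorem slab_ho {K : Type} {Y : RW E → K → Prop} (hY : ∀ g k, Y g k → Sl x0 g) : ∀ {g k g' k'}, Y g k → Y g' k' →
    ((sx x0 g, ((hx x0 g : ℤ) : ZMod 3), k) = (sx x0 g', ((hx x0 g' : ℤ) : ZMod 3), k') ↔
      k = k' ∧ ∃ h, g' = iH x0 h * g) := by
    intro g k g' k' h h'
    have a := hY _ _ h
    have a' := hY _ _ h'
    constructor
    · intro h
      simp only [Prod.mk.injEq] at h
      obtain ⟨h1, h2, h3⟩ := h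
      refine ⟨h3, ?_⟩
      have e : hx x0 g = hx x0 g' := by
        have := (ZMod.intCast_eq_intCast_iff_dvd_sub _ _ 3).1 h2
        have := a.2; have := a'.2; omega
      obtain ⟨k, hk⟩ := iH_ex (x0 := x0) (g := g' * g⁻¹) (Xm a'.1 rfl (h1 ▸ Xi a.1 rfl))
        (by rw [sx_mul, ← h1, sx_inv rfl]) (by rw [hx_mul, ← h1, hx_inv rfl]; omega)
      exact ⟨k, by rw [hk]; simp⟩
    · rintro ⟨rfl, h, rfl⟩
      simp only [sx_iH, hx_iH]

theorem fp2 [Finite S] [Finite E] (hC : ∀ (x : S) τ, IsPM τ → OctC E x τ)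
    (hH : ∀ (x : S) τ, IsPM τ → OctH E x τ) : IsTypeFP2 (ph E x0).ker := by
  have : Finite (ZMod 3) := inferInstanceAs (Finite (Fin 3))
  have hv := vdx (E := E) x0
  obtain ⟨P0, _, _, b0, fin0, pr0, lin0, add0, ext0, eq0⟩ := freeMod (K := Unit) (iH (E := E) x0) (iH_inj x0)
    (fun g _ => Sl x0 g) _ (fun h _ _ hg => Sl_iH h hg) (slab_ho (fun _ _ h => h))
  let Y1 : RW E → E → Prop := fun g e => vx x0 g e ∧ Sl x0 g ∧ Sl x0 (g * gs e)
  have Y1i : ∀ h g k, Y1 g k → Y1 (iH x0 h * g) k := fun h g k hg => by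
    refine ⟨by rw [vx_iH]; exact hg.1, Sl_iH h hg.2.1, ?_⟩
    rw [mul_assoc]; exact Sl_iH h hg.2.2
  obtain ⟨P1, _, _, b1, fin1, pr1, lin1, add1, ext1, eq1⟩ := freeMod (iH x0) (iH_inj x0) Y1 _ Y1i
    (slab_ho (fun _ _ h => h.2.1))
  let Y2 : RW E → (E × E) ⊕ E → Prop := fun g k => match k with
    | .inl (e, f) => C e f ∧ Y1 g e ∧ Y1 g f ∧ Y1 (g * gs e) f ∧ Y1 (g * gs f) e
    | .inr e => Y1 g e ∧ Y1 (g * gs e) e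
  obtain ⟨P2, _, _, b2, fin2, pr2, lin2, add2, ext2, eq2⟩ := freeMod (iH x0) (iH_inj x0) Y2 _
    (fun h g k hg => by
      rcases k with ⟨e, f⟩ | e
      · obtain ⟨h0, h1, h2, h3, h4⟩ := hg
        exact ⟨h0, Y1i _ _ _ h1, Y1i _ _ _ h2, by rw [mul_assoc]; exact Y1i _ _ _ h3,
          by rw [mul_assoc]; exact Y1i _ _ _ h4⟩
      · exact ⟨Y1i _ _ _ hg.1, by rw [mul_assoc]; exact Y1i _ _ _ hg.2⟩)
    (slab_ho (fun g k h => by rcases k with ⟨e, f⟩ | e; exacts [h.2.1.2.1, h.1.2.1]))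
  obtain ⟨d1, hd1⟩ := lin1 P0 (fun g e => b0 (g * gs e) () - b0 g ()) (fun h g e hg => by
    rw [mul_assoc, eq0 _ _ _ hg.2.2, eq0 _ _ _ hg.2.1, smul_sub])
  let φ2 : RW E → (E × E) ⊕ E → P1 := fun g k => match k with
    | .inl (e, f) => b1 g e + b1 (g * gs e) f - b1 g f - b1 (g * gs f) e
    | .inr e => b1 g e + b1 (g * gs e) e
  obtain ⟨d2, hd2⟩ := lin2 P1 φ2 (fun h g k hg => by
    rcases k with ⟨e, f⟩ | e
    · obtain ⟨h0, h1, h2, h3, h4⟩ := hg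
      simp only [φ2]
      rw [mul_assoc, mul_assoc, eq1 _ _ _ h1, eq1 _ _ _ h2, eq1 _ _ _ h3, eq1 _ _ _ h4, smul_sub,
        smul_sub, smul_add]
    · simp only [φ2]
      rw [mul_assoc, eq1 _ _ _ hg.1, eq1 _ _ _ hg.2, smul_add])
  letI inst : Module (MonoidAlgebra ℤ (ph E x0).ker) ℤ := Module.compHom ℤ (augmentationMap _)
  unfold IsTypeFP2
  have hsm : ∀ (r : MonoidAlgebra ℤ (ph E x0).ker) (n : ℤ), r • n = augmentationMap _ r * n :=
    fun r n => rfl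
  obtain ⟨ε, hε⟩ := lin0 ℤ (fun _ _ => 1) (fun h g k hg => by
    rw [hsm]; simp [augmentationMap])
  have S1 : Sl (E := E) x0 1 := ⟨.one, by simp⟩
  refine ⟨P2, P1, P0, _, _, _, _, _, _, fin2, pr2, fin1, pr1, fin0, pr0, d2, d1, ε, ?_, ?_, ?_⟩
  · intro n
    exact ⟨n • b0 1 (), by rw [map_zsmul, hε _ _ S1]; simp⟩
  · apply le_antisymm
    · rw [LinearMap.range_le_ker_iff]
      have : (ε.comp d1).toAddMonoidHom = 0 := ext1 _ _ _ (fun g e hg => by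
        simp [hd1 _ _ hg, hε _ _ hg.2.1, hε _ _ hg.2.2])
      ext p; exact DFunLike.congr_fun this p
    · intro p hp
      let π := (LinearMap.range d1).mkQ
      have hπ : ∀ g, Sl x0 g → π (b0 g ()) = π (b0 1 ()) := fun g hg =>
        slab0 (A := Multiplicative (P0 ⧸ LinearMap.range d1)) hC (f := fun g => .ofAdd (π (b0 g ())))
          (fun g e he h1 h2 => by
            congr 1
            rw [← sub_eq_zero, ← map_sub, ← hd1 g e ⟨he, h1, h2⟩]
            simp [π]) hg
      have : π.toAddMonoidHom = (zmultiplesHom _ (π (b0 1 ()))).comp ε.toAddMonoidHom :=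
        ext0 _ _ _ (fun g k hg => by simp [hε _ _ hg, hπ g hg])
      have h2 := DFunLike.congr_fun this p
      have h3 : π p = 0 := by simpa [LinearMap.mem_ker.1 hp] using h2
      simpa [π] using h3
  · apply le_antisymm
    · rw [LinearMap.range_le_ker_iff]
      have : (d1.comp d2).toAddMonoidHom = 0 := ext2 _ _ _ (fun g k hg => by
        rcases k with ⟨e, f⟩ | e
        · show d1 (d2 (b2 g _)) = 0
          rw [hd2 _ _ hg]; simp only [φ2]
          obtain ⟨h0, h1, h2, h3, h4⟩ := hg
          rw [map_sub, map_sub, map_add, hd1 _ _ h1, hd1 _ _ h2, hd1 _ _ h3, hd1 _ _ h4,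
            mul_gs_comm g h0]
          simp
        · show d1 (d2 (b2 g _)) = 0
          rw [hd2 _ _ hg]; simp only [φ2]
          rw [map_add, hd1 _ _ hg.1, hd1 _ _ hg.2]; simp)
      ext p; exact DFunLike.congr_fun this p
    · intro p hp
      let π := (LinearMap.range d2).mkQ
      have hπ : ∀ g k, Y2 g k → π (φ2 g k) = 0 := fun g k h => by
        rw [← hd2 g k h]; simp [π]
      let c : RW E → E → Multiplicative (P1 ⧸ LinearMap.range d2) := fun g e => .ofAdd (π (b1 g e))
      have hc : Flat (vx x0) (Sl x0) c := by
        constructor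
        · intro g e he h1 h2
          have := hπ g (.inr e) ⟨⟨he, h1, h2⟩, hv.back he, h2, by simpa⟩
          rw [← ofAdd_add, ← map_add]; exact ofAdd_eq_one.2 this
        · intro g e f h0 he hf h1 h2 h3 h4
          have := hπ g (.inl (e, f)) ⟨h0, ⟨he, h1, h2⟩, ⟨hf, h1, h3⟩, ⟨hv.sq h0 he hf, h2, h4⟩,
            hv.sq (RA.symm h0) hf he, h3, by rwa [mul_gs_comm g (RA.symm h0)]⟩
          rw [← ofAdd_add, ← ofAdd_add, ← map_add, ← map_add]
          congr 1
          rw [← sub_eq_zero, ← map_sub, ← sub_sub]; exact this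
      obtain ⟨c', hc1, hc2⟩ := slab1 hH hc
      obtain ⟨F, -, -, hF⟩ := pot hv (fun h1 h2 => h1.De_mul hv h2) hc2
      obtain ⟨L, hL⟩ := add0 (P1 ⧸ LinearMap.range d2) (fun g _ => (F g).toAdd)
      have : π.toAddMonoidHom = L.comp d1.toAddMonoidHom := ext1 _ _ _ (fun g e hg => by
        simp only [LinearMap.toAddMonoidHom_coe, AddMonoidHom.comp_apply]
        rw [hd1 _ _ hg, map_sub, hL _ _ hg.2.1, hL _ _ hg.2.2, hF hg.2.1.1 hg.1 hg.2.1.1 hg.2.2.1,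
          hc1 _ _ hg.2.1 hg.2.2]
        simp [c])
      have h2 := DFunLike.congr_fun this p
      have h3 : π p = 0 := by simpa [LinearMap.mem_ker.1 hp] using h2
      simpa [π] using h3
end FP2S

/-! ### finite presentation -/
section FPS
variable {E S : Type} [RA E] [Sys E S]
open Sys

theorem isFP_of {α H : Type} [Finite α] [Group H] {R : Set (FreeGroup α)} (hR : R.Finite)
    (h : Nonempty (H ≃* PresentedGroup R)) : IsFinitelyPresented H := by
  obtain ⟨n, ⟨e⟩⟩ := Finite.exists_equiv_fin α
  obtain ⟨h⟩ := h
  exact ⟨n, _, hR.image _, ⟨h.trans (PresentedGroup.equivPresentedGroup R e)⟩⟩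

theorem gfp [Finite S] [Finite E] (x0 : S) : IsFinitelyPresented (Gx E x0) := by
  classical
  let rc : S → Prop := fun x => ∃ p, Xt (vx (E := E) x0) p ∧ sx x0 p = x
  have hv := vdx (E := E) x0
  let c0 : RW E → E → FreeGroup (S × E) := fun g e => .of (sx x0 g, e)
  have hp : ∀ x, ∃ (p : RW E) (a : FreeGroup (S × E)), (rc x → Xt (vx x0) p ∧ sx x0 p = x ∧
      ∃ n, Tr (vx x0) (fun _ => True) c0 n p a) ∧ (x = x0 → p = 1) := by
    intro x
    by_cases h : x = x0
    · exact ⟨1, 1, fun _ => ⟨.one, by simp [h], 0, .nil trivial⟩, fun _ => rfl⟩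
    · by_cases hr : rc x
      · obtain ⟨p, h1, h2⟩ := hr
        obtain ⟨n, a, ha⟩ := h1.tr (c := c0) (Q := fun _ => True) hv (fun _ _ => trivial) trivial
        exact ⟨p, a, fun _ => ⟨h1, h2, n, ha⟩, fun h' => absurd h' h⟩
      · exact ⟨1, 1, fun h' => absurd h' hr, fun h' => absurd h' h⟩
  choose p a hp hp0 using hp
  have rcm : ∀ {x : S} {e : E}, rc x → v x e → rc (mv x e) := by
    rintro x e ⟨q, h1, rfl⟩ h2
    exact ⟨q * gs e, h1.step h2, sx_v h2⟩
  have rcg : ∀ {g : RW E}, Xt (vx x0) g → rc (sx x0 g) := fun {g} h => ⟨g, h, rfl⟩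
  let O : S → E → FreeGroup (S × E) := fun x e => .of (x, e)
  let R : Set (FreeGroup (S × E)) := {r | (∃ (x : S) (e : E), rc x ∧ v x e ∧ r = O x e * O (mv x e) e) ∨
    (∃ (x : S) (e f : E), rc x ∧ C e f ∧ v x e ∧ v x f ∧
      r = O x e * O (mv x e) f * (O x f * O (mv x f) e)⁻¹) ∨
    (∃ (x : S) (e : E), ¬ (rc x ∧ v x e) ∧ r = O x e) ∨ (∃ x, rc x ∧ r = a x)}
  have Rfin : R.Finite := by
    refine Set.Finite.subset ((Set.finite_range (fun z : S × E => O z.1 z.2 * O (mv z.1 z.2) z.2)).union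
      ((Set.finite_range (fun z : S × E × E => O z.1 z.2.1 * O (mv z.1 z.2.1) z.2.2 *
        (O z.1 z.2.2 * O (mv z.1 z.2.2) z.2.1)⁻¹)).union
      ((Set.finite_range (fun z : S × E => O z.1 z.2)).union (Set.finite_range a)))) ?_
    rintro r (⟨x, e, _, _, rfl⟩ | ⟨x, e, f, _, _, _, _, rfl⟩ | ⟨x, e, _, rfl⟩ | ⟨x, _, rfl⟩)
    · exact Or.inl ⟨(x, e), rfl⟩
    · exact Or.inr (Or.inl ⟨(x, e, f), rfl⟩)
    · exact Or.inr (Or.inr (Or.inl ⟨(x, e), rfl⟩))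
    · exact Or.inr (Or.inr (Or.inr ⟨x, rfl⟩))
  refine isFP_of Rfin ?_
  let mk := PresentedGroup.mk R
  have mk1 : ∀ {r}, r ∈ R → mk r = 1 := fun h => PresentedGroup.one_of_mem h
  have hF : Flat (vx x0) (Xt (vx x0)) (fun g e => mk (O (sx x0 g) e)) := by
    constructor
    · intro g e he hg _
      rw [sx_v he, ← map_mul]
      exact mk1 (Or.inl ⟨_, _, rcg hg, he, rfl⟩)
    · intro g e f hC he hf hg _ _ _
      rw [sx_v he, sx_v hf, ← map_mul, ← map_mul, ← mul_inv_eq_one, ← map_inv, ← map_mul]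
      exact mk1 (Or.inr (Or.inl ⟨_, _, _, rcg hg, hC, he, hf, rfl⟩))
  obtain ⟨F, -, F1, Fs⟩ := pot hv (fun h1 h2 => h1.De_mul hv h2) hF
  replace Fs : ∀ {g : RW E} {e : E}, Xt (vx x0) g → vx x0 g e → F (g * gs e) = F g * mk (O (sx x0 g) e) :=
    fun h1 h2 => Fs h1 h2 h1 (h1.step h2)
  have FT : ∀ {n g b}, Tr (vx x0) (fun _ => True) c0 n g b → Xt (vx x0) g ∧ F g = mk b := by
    intro n g b h
    induction h with
    | nil => exact ⟨.one, by rw [F1, map_one]⟩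
    | step e _ hval _ ih => exact ⟨ih.1.step hval, by rw [Fs ih.1 hval, ih.2, map_mul]⟩
  have Fp : ∀ x, rc x → F (p x) = 1 := by
    intro x hx
    obtain ⟨n, hn⟩ := (hp x hx).2.2
    rw [(FT hn).2]; exact mk1 (Or.inr (Or.inr (Or.inr ⟨x, hx, rfl⟩)))
  have Fm : ∀ {g q : RW E}, g ∈ Gx E x0 → Xt (vx x0) q → F (g * q) = F g * F q := by
    intro g q hg hq
    refine Xt.ind (p := fun q => F (g * q) = F g * F q) (by simp [F1]) (fun q e h1 h2 ih => ?_) hq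
    have e1 : sx x0 (g * q) = sx x0 q := by rw [sx_mul, hg.2]
    rw [← mul_assoc, Fs (Xm hg.1 hg.2 h1) (by rw [vx, e1]; exact h2), ih, Fs h1 h2, e1, mul_assoc]
  have hq : ∀ (x : S) (e : E), rc x ∧ v x e → p x * gs e * (p (mv x e))⁻¹ ∈ Gx E x0 := by
    intro x e ⟨h1, h2⟩
    obtain ⟨a1, a2, -⟩ := hp x h1
    obtain ⟨b1, b2, -⟩ := hp _ (rcm h1 h2)
    have h3 : vx x0 (p x) e := by rw [vx, a2]; exact h2
    have h4 : sx x0 (p x * gs e) = mv x e := by rw [sx_v h3, a2]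
    exact ⟨Xm (a1.step h3) h4 (Xi b1 b2), by rw [sx_mul, h4, sx_inv b2]⟩
  let q : S × E → Gx E x0 := fun z => if h : rc z.1 ∧ v z.1 z.2 then ⟨_, hq z.1 z.2 h⟩ else 1
  have q1 : ∀ {x : S} {e : E}, rc x → v x e → (q (x, e) : RW E) = p x * gs e * (p (mv x e))⁻¹ := by
    intro x e h1 h2; simp only [q]; rw [dif_pos ⟨h1, h2⟩]
  have q0 : ∀ {x : S} {e : E}, ¬ (rc x ∧ v x e) → q (x, e) = 1 := by
    intro x e h; simp only [q]; rw [dif_neg h]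
  have LT : ∀ {n g b}, Tr (vx x0) (fun _ => True) c0 n g b →
      Xt (vx x0) g ∧ (FreeGroup.lift q b : RW E) = g * (p (sx x0 g))⁻¹ := by
    intro n g b h
    induction h with
    | nil => exact ⟨.one, by rw [map_one, sx_one, hp0 x0 rfl]; simp⟩
    | step e _ hval _ ih =>
      refine ⟨ih.1.step hval, ?_⟩
      rw [map_mul, Subgroup.coe_mul, ih.2, FreeGroup.lift_apply_of, q1 (rcg ih.1) hval, sx_v hval]
      group
  have hrel : ∀ r ∈ R, FreeGroup.lift q r = 1 := by
    rintro r (⟨x, e, h1, h2, rfl⟩ | ⟨x, e, f, h1, h2, h3, h4, rfl⟩ | ⟨x, e, h, rfl⟩ | ⟨x, h, rfl⟩)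
    · apply Subtype.ext
      simp only [O, map_mul, FreeGroup.lift_apply_of, Subgroup.coe_mul]
      rw [q1 h1 h2, q1 (rcm h1 h2) (back h2), mvmv h2]
      simp [mul_assoc]
    · rw [map_mul, map_inv, mul_inv_eq_one]
      apply Subtype.ext
      simp only [O, map_mul, FreeGroup.lift_apply_of, Subgroup.coe_mul]
      rw [q1 h1 h3, q1 h1 h4, q1 (rcm h1 h3) (Sys.sq h2 h3 h4), q1 (rcm h1 h4) (Sys.sq (RA.symm h2) h4 h3),
        mvc h2 h3 h4]
      simp only [mul_assoc, inv_mul_cancel_left]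
      rw [← mul_assoc (gs e), gs_comm h2, mul_assoc]
    · simp only [O, FreeGroup.lift_apply_of]; exact q0 h
    · obtain ⟨h1, h2, n, hn⟩ := hp x h
      apply Subtype.ext
      rw [(LT hn).2, h2]; simp
  let Ψ : PresentedGroup R →* Gx E x0 := PresentedGroup.toGroup hrel
  have Ψm : ∀ r, Ψ (mk r) = FreeGroup.lift q r := fun r => rfl
  have ΨF : ∀ {g : RW E}, Xt (vx x0) g → (Ψ (F g) : RW E) = g * (p (sx x0 g))⁻¹ := by
    intro g hg
    refine Xt.ind (p := fun g => (Ψ (F g) : RW E) = g * (p (sx x0 g))⁻¹) ?_ (fun g e h1 h2 ih => ?_) hg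
    · rw [F1, map_one, sx_one, hp0 x0 rfl]; simp
    · rw [Fs h1 h2, map_mul, Subgroup.coe_mul, ih, Ψm, FreeGroup.lift_apply_of, q1 (rcg h1) h2, sx_v h2]
      group
  let Fh : Gx E x0 →* PresentedGroup R :=
    { toFun := fun g => F g.1, map_one' := F1, map_mul' := fun g h => Fm g.2 h.2.1 }
  have FΨ : Fh.comp Ψ = MonoidHom.id _ := by
    apply PresentedGroup.ext
    rintro ⟨x, e⟩
    have e0 : Ψ (PresentedGroup.of (x, e)) = q (x, e) := PresentedGroup.toGroup.of hrel
    simp only [MonoidHom.comp_apply, MonoidHom.id_apply, e0]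
    by_cases h : rc x ∧ v x e
    · have h1 := hp x h.1
      have h2 := hp _ (rcm h.1 h.2)
      have h3 : F ((q (x, e) : RW E) * p (mv x e)) = F (q (x, e)) * F (p (mv x e)) := Fm (q (x, e)).2 h2.1
      rw [Fp _ (rcm h.1 h.2), mul_one, q1 h.1 h.2, inv_mul_cancel_right,
        Fs h1.1 (by rw [vx, h1.2.1]; exact h.2), Fp _ h.1, one_mul, h1.2.1] at h3
      show F (q (x, e)) = _
      rw [q1 h.1 h.2, ← h3]; rfl
    · rw [q0 h, map_one]
      exact (mk1 (Or.inr (Or.inr (Or.inl ⟨x, e, h, rfl⟩)))).symm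
  refine ⟨(MulEquiv.ofBijective Ψ ⟨?_, ?_⟩).symm⟩
  · intro y z h
    have := DFunLike.congr_fun FΨ
    exact (this y).symm.trans ((congrArg Fh h).trans (this z))
  · intro g
    refine ⟨F g, Subtype.ext ?_⟩
    rw [ΨF g.2.1, g.2.2, hp0 x0 rfl]; simp
end FPS

/-! ### No Baumslag-Solitar subgroups -/
section NBS
variable {E S : Type} [RA E] [Sys E S]
open Sys

theorem sandwich {x : RW E} {e : E} (h1 : ¬ De x⁻¹ e) (h2 : De (gs e * x) e) (h3 : ¬ De x e)
    {t : E} (ht : 0 < ct t x) : C e t := by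
  classical
  obtain ⟨l, hl, rfl⟩ := exists_red x
  have h4 := len_nDe h1
  rw [← gs_inv e, ← mul_inv_rev, len_inv, len_inv] at h4
  have hr : Red (e :: l) := by
    have : wd (e :: l) = gs e * wd l := wd_append [e] l |>.trans (by simp)
    rw [Red, this, h4, hl]; rfl
  have hw : wd (e :: l) = gs e * wd l := wd_append [e] l |>.trans (by simp)
  rw [← hw, De_iff_last] at h2
  rw [ct_pos hl] at ht
  by_contra hc
  have key : ∀ t, ¬ C e t → fl e t l ≠ [] → (fl e t l).getLast? = some e := by
    intro t ht hne
    have := h2.2 t ht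
    rw [Pr_eq ht hr] at this
    have e1 : fl e t (e :: l) = e :: fl e t l := by simp [fl]
    rw [e1] at this
    cases hfl : fl e t l with
    | nil => exact absurd hfl hne
    | cons a b => rw [hfl, List.getLast?_cons_cons] at this; exact this
  have he : e ∈ l := by
    have m : t ∈ fl e t l := by simp [fl, ht]
    have := List.mem_of_getLast? (key t hc (List.ne_nil_of_mem m))
    exact (List.mem_filter.1 this).1
  refine h3 (De_iff_last.2 ⟨(ct_pos hl).2 he, fun t ht => ?_⟩)
  rw [Pr_eq ht hl]
  exact key t ht (List.ne_nil_of_mem (a := e) (by simp [fl, he]))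

theorem no_loop {y : S} {e : E} (h : v y e) (h2 : sx y (gs e) = y) : False := by
  have h3 : sx y ((1 : RW E) * gs e) = mv y e := by rw [sx_v (by simpa using h), sx_one]
  rw [one_mul, h2] at h3
  have h4 := dhb h
  rw [← h3] at h4
  rcases dh1 h with h | h <;> omega

theorem ct_one (e : E) : ct e (1 : RW E) = 0 := by simp [ct, Pr_one]

theorem not_split_one : ¬ Split (1 : RW E) := by
  rintro ⟨_, ⟨e, h, _⟩, _⟩; rw [ct_one] at h; omega

variable (hZ : ∀ (x : S) (g : RW E), g ∈ Gx E x → g ≠ 1 → ¬ Split g)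
include hZ

theorem exists_CR {x0 : S} {g : RW E} (hg : g ∈ Gx E x0) (h1 : g ≠ 1) :
    ∃ c, Xt (vx x0) c ∧ CR (c⁻¹ * g * c) := by
  classical
  have hex : ∃ n, ∃ c, Xt (vx x0) c ∧ len (c⁻¹ * g * c) = n := ⟨_, 1, .one, rfl⟩
  obtain ⟨c, hc, hn⟩ := Nat.find_spec hex
  have hmin : ∀ d, Xt (vx x0) d → len (c⁻¹ * g * c) ≤ len (d⁻¹ * g * d) := fun d hd => by
    rw [hn]; exact Nat.find_min' hex ⟨d, hd, rfl⟩
  refine ⟨c, hc, fun e he he' => ?_⟩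
  generalize hw : c⁻¹ * g * c = w at *
  obtain ⟨y, hy⟩ : ∃ y, sx x0 c = y := ⟨_, rfl⟩
  have hwX : w ∈ Gx E y := by
    rw [← hw]
    have a1 := Xi hc hy
    have a2 := sx_inv hy
    have a3 : sx y (c⁻¹ * g) = x0 := by rw [sx_mul, a2, hg.2]
    exact ⟨Xm (Xm a1 a2 hg.1) a3 hc, by rw [sx_mul, a3, hy]⟩
  have hwe : v y e := by
    have := hwX.1.val_of_De (vdx y) he
    rwa [vx, hwX.2] at this
  have hce : Xt (vx x0) (c * gs e) := hc.step (by rw [vx, hy]; exact hwe)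
  have hm := hmin _ hce
  have e1 : (c * gs e)⁻¹ * g * (c * gs e) = gs e * w * gs e := by
    rw [← hw]; simp only [mul_inv_rev, gs_inv, mul_assoc]
  rw [e1] at hm
  have l1 := len_De he'
  have e2 : w⁻¹ * gs e = (gs e * w)⁻¹ := by simp [gs_inv]
  rw [e2, len_inv, len_inv] at l1
  have n1 : ¬ De (gs e * w) e := fun h => by have := len_De h; omega
  have n2 : ¬ De (gs e * w)⁻¹ e := by
    rw [← e2, De_mul_self]; simpa using he'
  have e3 : gs e * (gs e * w) = w := by rw [← mul_assoc, gs_mul_self, one_mul]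
  have key : ∀ t, 0 < ct t (gs e * w) → C e t := fun t ht =>
    sandwich n2 (by rwa [e3]) n1 ht
  by_cases hx1 : gs e * w = 1
  · have : w = gs e := by rw [← e3, hx1, mul_one]
    exact no_loop hwe (this ▸ hwX.2)
  · have hlen : len (gs e * (gs e * w)) = len (gs e) + len (gs e * w) := by
      have := len_De (De_gs.2 rfl : De (gs e) e)
      rw [gs_mul_self, len_one] at this
      rw [e3]; omega
    have hct : ∀ t, ct t w = ct t (gs e) + ct t (gs e * w) := fun t => by
      rw [← ct_mul hlen, e3]
    have hr : Red [e] := by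
      have := len_De (De_gs.2 rfl : De (gs e) e)
      rw [gs_mul_self, len_one] at this
      rw [Red]; simp; omega
    have hce : ∀ t, 0 < ct t (gs e) ↔ t = e := fun t => by
      have := ct_pos (s := t) hr; simpa using this
    have w1 : w ≠ 1 := fun h => by
      rw [h] at he; exact De_one e he
    refine hZ y w hwX w1 ⟨fun t => t = e, ⟨e, ?_, rfl⟩, ?_, ?_⟩
    · rw [hct]; have := (hce e).2 rfl; omega
    · obtain ⟨l, hl, hlw⟩ := exists_red (gs e * w)
      cases l with
      | nil => exact absurd (by simpa using hlw.symm) hx1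
      | cons a b =>
        have ha : 0 < ct a (gs e * w) := by rw [← hlw, ct_pos hl]; simp
        refine ⟨a, by rw [hct]; omega, fun h => ?_⟩
        exact irr e (by have := key a ha; rwa [h] at this)
    · rintro a b ha hb rfl hab
      apply key
      rw [hct] at hb
      by_contra hcon
      exact hab ((hce b).1 (by omega))

omit hZ in
theorem conj_mem {x0 : S} {g c : RW E} (hg : g ∈ Gx E x0) (hc : Xt (vx x0) c) :
    c⁻¹ * g * c ∈ Gx E (sx x0 c) := by
  have a1 := Xi hc rfl
  have a2 := sx_inv (x := x0) (g := c) rfl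
  have a3 : sx (sx x0 c) (c⁻¹ * g) = x0 := by rw [sx_mul, a2, hg.2]
  exact ⟨Xm (Xm a1 a2 hg.1) a3 hc, by rw [sx_mul, a3]⟩

theorem centr {x0 : S} {g h : RW E} (hg : g ∈ Gx E x0) (h1 : g ≠ 1) (hh : h ∈ Gx E x0)
    (hc : g * h = h * g) : ∃ (a : ℕ) (b : ℤ), 0 < a ∧ h ^ a = g ^ b := by
  obtain ⟨c, hcX, hCR⟩ := exists_CR hZ hg h1
  have ns : ∀ g, g ∈ Gx E (sx x0 c) → ¬ Split g := fun g hg => by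
    by_cases h : g = 1
    · rw [h]; exact not_split_one
    · exact hZ _ g hg h
  have m1 := conj_mem hg hcX
  have m2 := conj_mem hh hcX
  have cj : ∀ z : RW E, c⁻¹ * z * c = MulAut.conj c⁻¹ z := fun z => by simp
  obtain ⟨a, b, ha, hab⟩ := comm_thm (w := c⁻¹ * g * c) (h := c⁻¹ * h * c)
    (fun h => h1 ((MulAut.conj c⁻¹).injective (by rw [← cj, h, map_one]))) hCR
    (by simp only [cj, ← map_mul, hc]) (fun k => ns _ (mul_mem (pow_mem m1 k) m2)) (ns _ m1)
  refine ⟨a, b, ha, ?_⟩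
  rw [cj, cj, ← map_pow, ← map_zpow] at hab
  exact (MulAut.conj c⁻¹).injective hab

theorem len_pow {x0 : S} {g : RW E} (hg : g ∈ Gx E x0) (h1 : g ≠ 1) :
    ∃ L k : ℕ, 0 < L ∧ ∀ m : ℤ, len (g ^ m) ≤ m.natAbs * L + k ∧ m.natAbs * L ≤ len (g ^ m) + k := by
  obtain ⟨c, hcX, hCR⟩ := exists_CR hZ hg h1
  have hp : ∀ m : ℤ, len ((c⁻¹ * g * c) ^ m) = m.natAbs * len (c⁻¹ * g * c) := by
    intro m
    generalize hk : m.natAbs = k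
    rcases Int.natAbs_eq m with h | h
    · rw [h, hk, zpow_natCast, (hCR.pow _).1]
    · rw [h, hk, zpow_neg, len_inv, zpow_natCast, (hCR.pow _).1]
  have cj : ∀ z : RW E, c⁻¹ * z * c = MulAut.conj c⁻¹ z := fun z => by simp
  refine ⟨len (c⁻¹ * g * c), 2 * len c, ?_, fun m => ?_⟩
  · by_contra h
    have := len_eq_zero (by omega : len (c⁻¹ * g * c) = 0)
    exact h1 ((MulAut.conj c⁻¹).injective (by rw [← cj, this, map_one]))
  · rw [← hp m]
    have e1 : (c⁻¹ * g * c) ^ m = c⁻¹ * g ^ m * c := by rw [cj, cj, map_zpow]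
    have e2 : g ^ m = c * (c⁻¹ * g ^ m * c) * c⁻¹ := by group
    rw [e1]
    have i1 := len_mul_le (c⁻¹ * g ^ m) c
    have i2 := len_mul_le c⁻¹ (g ^ m)
    have i3 := len_mul_le (c * (c⁻¹ * g ^ m * c)) c⁻¹
    have i4 := len_mul_le c (c⁻¹ * g ^ m * c)
    rw [len_inv] at i2 i3
    rw [← e2] at i3
    omega

omit [RA E] [Sys E S] hZ in
theorem bs_x {m n : ℤ} (hm : m ≠ 0) (hn : n ≠ 0) :
    ((PresentedGroup.of 0 : BS m n) ≠ 1) ∧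
    ∃ ε : BS m n →* Multiplicative ℤ, ε (.of 0) = 1 ∧ ε (.of 1) = .ofAdd 1 := by
  constructor
  · have hq : (m / n : ℚ) ≠ 0 := by
      apply div_ne_zero <;> exact_mod_cast ‹_›
    have zp : ∀ (k : ℤ) (t : ℚ), ((Equiv.addRight (1 : ℚ)) ^ k : Equiv.Perm ℚ) t = t + k := by
      intro k
      induction k using Int.induction_on with
      | zero => simp
      | succ k ih => intro t; rw [zpow_add_one, Equiv.Perm.mul_apply, ih]; simp; ring
      | pred k ih =>
        intro t
        rw [zpow_sub_one, Equiv.Perm.mul_apply, ih]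
        have : ((Equiv.addRight (1 : ℚ))⁻¹ : Equiv.Perm ℚ) t = t - 1 := by
          rw [Equiv.Perm.inv_eq_iff_eq]; simp
        rw [this]; push_cast; ring
    let f : Fin 2 → Equiv.Perm ℚ := ![Equiv.addRight 1, Equiv.mulRight₀ _ hq]
    have hf : ∀ r ∈ BSRels m n, FreeGroup.lift f r = 1 := by
      intro r hr
      rw [BSRels, Set.mem_singleton_iff] at hr
      subst hr
      simp only [map_mul, map_inv, map_zpow, FreeGroup.lift_apply_of]
      simp only [f, Matrix.cons_val_zero, Matrix.cons_val_one]
      rw [mul_assoc, mul_assoc, inv_mul_eq_one]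
      ext t
      simp only [Equiv.Perm.mul_apply, zp, Equiv.mulRight₀_apply]
      have : (n : ℚ) ≠ 0 := by exact_mod_cast hn
      simp
      field_simp
      ring
    intro h
    have := congrArg (PresentedGroup.toGroup hf) h
    rw [PresentedGroup.toGroup.of, map_one] at this
    have := DFunLike.congr_fun this (0 : ℚ)
    simp [f] at this
  · let f : Fin 2 → Multiplicative ℤ := ![1, .ofAdd 1]
    have hf : ∀ r ∈ BSRels m n, FreeGroup.lift f r = 1 := by
      intro r hr
      rw [BSRels, Set.mem_singleton_iff] at hr
      subst hr
      simp [f]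
    exact ⟨PresentedGroup.toGroup hf, PresentedGroup.toGroup.of hf, PresentedGroup.toGroup.of hf⟩

theorem noBS (x0 : S) : HasNoBSSubgroup (Gx E x0) := by
  rintro m n hm hn K ⟨Θ⟩
  obtain ⟨hx1, ε, εx, εy⟩ := bs_x hm hn
  let ι : BS m n →* RW E := (Gx E x0).subtype.comp (K.subtype.comp Θ.symm.toMonoidHom)
  have ιi : Function.Injective ι :=
    (Subtype.val_injective.comp Subtype.val_injective).comp Θ.symm.injective
  have ιm : ∀ z, ι z ∈ Gx E x0 := fun z => (Θ.symm z).1.2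
  generalize hX : (PresentedGroup.of 0 : BS m n) = X at *
  generalize hY : (PresentedGroup.of 1 : BS m n) = Y at *
  have rel : Y⁻¹ * X ^ m * Y = X ^ n := by
    have h : (PresentedGroup.mk (BSRels m n)) ((FreeGroup.of 1)⁻¹ * (FreeGroup.of 0) ^ m *
        FreeGroup.of 1 * (FreeGroup.of 0) ^ (-n)) = 1 :=
      PresentedGroup.one_of_mem (by simp [BSRels])
    simp only [map_mul, map_inv, map_zpow] at h
    have h' : Y⁻¹ * X ^ m * Y * X ^ (-n) = 1 := by rw [← hX, ← hY]; exact h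
    rwa [zpow_neg, mul_inv_eq_one] at h'
  have cj : ∀ z : BS m n, Y⁻¹ * z * Y = MulAut.conj Y⁻¹ z := fun z => by simp
  have relN : ∀ N : ℕ, Y⁻¹ * X ^ (m * N) * Y = X ^ (n * N) := by
    intro N; rw [zpow_mul, zpow_mul, ← rel, cj, cj, map_zpow]
  have gx1 : ι X ≠ 1 := fun h => hx1 (ιi (by rw [h, map_one]))
  obtain ⟨L, k, hL, hlen⟩ := len_pow hZ (ιm X) gx1
  have tf : X ^ m ≠ 1 := by
    intro h
    have h2 := (hlen (m * (k + 1 : ℕ))).2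
    rw [← map_zpow, zpow_mul, h, one_zpow, map_one, len_one, Int.natAbs_mul, Int.natAbs_natCast] at h2
    have : 1 ≤ m.natAbs := Int.natAbs_pos.2 hm
    nlinarith [Nat.mul_le_mul this hL, Nat.zero_le k, Nat.mul_le_mul_right (k+1) (Nat.mul_le_mul this hL)]
  have bd : ∀ N : ℕ, m.natAbs * N * L ≤ n.natAbs * N * L + (2 * k + 2 * len (ι Y)) ∧
      n.natAbs * N * L ≤ m.natAbs * N * L + (2 * k + 2 * len (ι Y)) := by
    intro N
    have e1 := congrArg ι (relN N)
    have e2 : X ^ (m * N) = Y * X ^ (n * N) * Y⁻¹ := by rw [← relN]; group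
    replace e2 := congrArg ι e2
    simp only [map_mul, map_inv, map_zpow] at e1 e2
    have h1 := hlen (m * N)
    have h2 := hlen (n * N)
    rw [Int.natAbs_mul, Int.natAbs_natCast] at h1 h2
    have i1 := len_mul_le ((ι Y)⁻¹ * ι X ^ (m * N)) (ι Y)
    have i2 := len_mul_le (ι Y)⁻¹ (ι X ^ (m * N))
    have i3 := len_mul_le (ι Y * ι X ^ (n * N)) (ι Y)⁻¹
    have i4 := len_mul_le (ι Y) (ι X ^ (n * N))
    rw [e1] at i1; rw [← e2] at i3
    rw [len_inv] at i2 i3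
    omega
  have hmn : m.natAbs = n.natAbs := by
    by_contra hne
    obtain ⟨b1, b2⟩ := bd (2 * k + 2 * len (ι Y) + 1)
    generalize 2 * k + 2 * len (ι Y) = q at *
    have aux : ∀ a b : ℕ, a < b → b * (q + 1) * L ≤ a * (q + 1) * L + q → False := by
      intro a b hab h
      have : (a + 1) * ((q + 1) * L) ≤ b * ((q + 1) * L) := Nat.mul_le_mul_right _ hab
      nlinarith [Nat.mul_le_mul_left (q + 1) hL]
    rcases Nat.lt_or_gt_of_ne hne with h | h
    · exact aux _ _ h b2
    · exact aux _ _ h b1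
  have com : X ^ m * Y ^ 2 = Y ^ 2 * X ^ m := by
    have e3 : Y⁻¹ * (Y⁻¹ * X ^ m * Y) * Y = X ^ m := by
      rw [rel]
      rcases Int.natAbs_eq_natAbs_iff.1 hmn with h | h
      · have : X ^ n = X ^ m := congrArg (X ^ ·) h.symm
        rw [this, rel, this]
      · have : X ^ n = (X ^ m)⁻¹ := by
          rw [← zpow_neg]; exact congrArg (X ^ ·) (by omega : n = -m)
        rw [this, cj, map_inv, ← cj, rel, this, inv_inv]
    rw [pow_two]
    calc X ^ m * (Y * Y) = Y * Y * (Y⁻¹ * (Y⁻¹ * X ^ m * Y) * Y) := by group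
      _ = _ := by rw [e3]
  obtain ⟨a, b, ha, hab⟩ := centr hZ (ιm (X ^ m)) (fun h => tf (ιi (by rw [h, map_one])))
    (ιm (Y ^ 2)) (by rw [← map_mul, com, map_mul])
  rw [← map_pow, ← map_zpow] at hab
  have := congrArg ε (ιi hab)
  rw [map_pow, map_pow, map_zpow, map_zpow, εx, εy, one_zpow, one_zpow] at this
  have := congrArg Multiplicative.toAdd this
  simp at this
  omega
end NBS

/-! ### The kernel is not finitely presented -/
section NFP
variable {E S : Type} [RA E] [Sys E S]
open Sys Filter

theorem De_dn {x : RW E} {e f : E} (h : De x⁻¹ e) (hf : De (gs e * x) f) : De x f := by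
  have := De_mono (x := gs e * x) (e := e) (f := f)
    (by rw [mul_inv_rev, gs_inv, De_mul_self]; simpa using h) hf
  rwa [← mul_assoc, gs_mul_self, one_mul] at this

theorem top1 (u : RW E) (e : E) : (∀ a, De (gs e * u) a → De u a) ∨ (∀ a, De u a → De (gs e * u) a) := by
  by_cases h : De u⁻¹ e
  · exact .inl fun a => De_dn h
  · exact .inr fun a => De_mono h

theorem top2 (u : RW E) {e f : E} (hC : C e f) : ∃ t, (t = u ∨ t = gs e * u ∨ t = gs f * u ∨
    t = gs f * (gs e * u)) ∧ (∀ a, De u a → De t a) ∧ (∀ a, De (gs e * u) a → De t a) ∧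
    (∀ a, De (gs f * u) a → De t a) ∧ (∀ a, De (gs f * (gs e * u)) a → De t a) := by
  have c1 : De (gs f * u)⁻¹ e ↔ De u⁻¹ e := by rw [mul_inv_rev, gs_inv, De_mul_C hC]
  have c2 : De (gs e * u)⁻¹ f ↔ De u⁻¹ f := by rw [mul_inv_rev, gs_inv, De_mul_C (RA.symm hC)]
  have c3 : gs e * (gs f * u) = gs f * (gs e * u) := by rw [← mul_assoc, gs_comm hC, mul_assoc]
  by_cases h1 : De u⁻¹ e <;> by_cases h2 : De u⁻¹ f
  · refine ⟨u, .inl rfl, fun a h => h, fun a => De_dn h1, fun a => De_dn h2, fun a h => ?_⟩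
    exact De_dn h1 (De_dn (c2.2 h2) h)
  · refine ⟨gs f * u, .inr (.inr (.inl rfl)), fun a => De_mono h2, fun a h => De_mono h2 (De_dn h1 h),
      fun a h => h, fun a h => ?_⟩
    rw [← c3] at h
    exact De_dn (c1.2 h1) h
  · refine ⟨gs e * u, .inr (.inl rfl), fun a => De_mono h1, fun a h => h,
      fun a h => De_mono h1 (De_dn h2 h), fun a h => De_dn (c2.2 h2) h⟩
  · refine ⟨gs f * (gs e * u), .inr (.inr (.inr rfl)), fun a h => De_mono (mt c2.1 h2) (De_mono h1 h),
      fun a => De_mono (mt c2.1 h2), fun a h => ?_, fun a h => h⟩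
    rw [← c3]; exact De_mono (mt c1.1 h1) h

theorem hx_le_len (x : S) (g : RW E) : hx x g ≤ len g := by
  induction hn : len g generalizing g with
  | zero => rw [len_eq_zero hn]; simp
  | succ n ih =>
    obtain ⟨e, he⟩ := exists_De (g := g) (by rintro rfl; simp at hn)
    have h1 := len_De he
    have h2 := ih (g * gs e) (by omega)
    rw [← mul_gs_gs g e]
    by_cases h : v (sx x (g * gs e)) e
    · rw [hx_v h]; rcases dh1 h with h | h <;> push_cast <;> omega
    · rw [hx_n h]; push_cast; omega

variable {A : Type} [Group A] (cc : E → E → A) (ch : RW E → E) (x0 : S)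

def rho (u g : RW E) (e : E) : A := cc (ch (g⁻¹ * u)) (ch ((g * gs e)⁻¹ * u))

def CCok : Prop := ∀ e f g, v x0 e → v x0 f → v x0 g → (e = f ∨ C e f) → (f = g ∨ C f g) →
  (e = g ∨ C e g) → cc e f * cc f g = cc e g

variable {cc ch x0}

theorem in_cl {u h : RW E} (hu : Xt (vx x0) u) (hu0 : sx x0 u = x0) (hh : Xt (vx x0) h) {e : E}
    (he : De (h⁻¹ * u) e) : v x0 e := by
  have h1 := sx_inv (x := x0) (g := h) rfl
  have h2 := (Xm (Xi hh rfl) h1 hu).val_of_De (vdx _) he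
  rwa [vx, sx_mul, h1, hu0] at h2

theorem cc_tri (hcc : CCok cc x0) {u h : RW E} (hu : Xt (vx x0) u) (hu0 : sx x0 u = x0)
    (hh : Xt (vx x0) h) {e f g : E} (he : De (h⁻¹ * u) e) (hf : De (h⁻¹ * u) f)
    (hg : De (h⁻¹ * u) g) : cc e f * cc f g = cc e g := by
  refine hcc _ _ _ (in_cl hu hu0 hh he) (in_cl hu hu0 hh hf) (in_cl hu hu0 hh hg) ?_ ?_ ?_
  all_goals exact or_iff_not_imp_left.2 fun h => De_comm ‹_› ‹_› h

theorem cc_self (hcc : CCok cc x0) {e : E} (h : v x0 e) : cc e e = 1 := by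
  have := hcc e e e h h h (.inl rfl) (.inl rfl) (.inl rfl)
  simpa using this

theorem rho_flat (hcc : CCok cc x0) (hch : ∀ u : RW E, u ≠ 1 → De u (ch u)) {u : RW E}
    (hu : Xt (vx x0) u) (hu0 : sx x0 u = x0) :
    Flat (vx x0) (fun g => Xt (vx x0) g ∧ g ≠ u) (rho cc ch u) := by
  have hn : ∀ g, g ≠ u → De (g⁻¹ * u) (ch (g⁻¹ * u)) := fun g hg =>
    hch _ fun h => hg (inv_mul_eq_one.1 h)
  have hi : ∀ (g : RW E) e, (g * gs e)⁻¹ * u = gs e * (g⁻¹ * u) := fun g e => by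
    rw [mul_inv_rev, gs_inv, mul_assoc]
  constructor
  · intro g e hv h1 h2
    have a1 := hn g h1.2
    have a2 := hn _ h2.2
    rw [rho, rho, mul_gs_gs]
    have key : ∀ h, Xt (vx x0) h → (∀ a, De (g⁻¹ * u) a → De (h⁻¹ * u) a) →
        (∀ a, De ((g * gs e)⁻¹ * u) a → De (h⁻¹ * u) a) →
        cc (ch (g⁻¹ * u)) (ch ((g * gs e)⁻¹ * u)) * cc (ch ((g * gs e)⁻¹ * u)) (ch (g⁻¹ * u)) = 1 := by
      intro h hh b1 b2
      rw [cc_tri hcc hu hu0 hh (b1 _ a1) (b2 _ a2) (b1 _ a1)]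
      exact cc_self hcc (in_cl hu hu0 hh (b1 _ a1))
    rcases top1 (g⁻¹ * u) e with h | h <;> rw [← hi] at h
    · exact key g h1.1 (fun _ h => h) h
    · exact key _ h2.1 h (fun _ h => h)
  · intro g e f hC v1 v2 q1 q2 q3 q4
    have a1 := hn g q1.2
    have a2 := hn _ q2.2
    have a3 := hn _ q3.2
    have a4 := hn _ q4.2
    obtain ⟨t, ht, b1, b2, b3, b4⟩ := top2 (g⁻¹ * u) hC
    simp only [← hi] at ht b2 b3 b4
    obtain ⟨h, hh, rfl⟩ : ∃ h, Xt (vx x0) h ∧ h⁻¹ * u = t := by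
      rcases ht with rfl | rfl | rfl | rfl
      exacts [⟨_, q1.1, rfl⟩, ⟨_, q2.1, rfl⟩, ⟨_, q3.1, rfl⟩, ⟨_, q4.1, rfl⟩]
    have e1 : g * gs f * gs e = g * gs e * gs f := (mul_gs_comm g hC).symm
    simp only [rho, e1]
    rw [cc_tri hcc hu hu0 hh (b1 _ a1) (b2 _ a2) (b4 _ a4),
      cc_tri hcc hu hu0 hh (b1 _ a1) (b3 _ a3) (b4 _ a4)]

def Fok (cc : E → E → A) (ch : RW E → E) (x0 : S) (F : RW E → RW E → A) : Prop :=
  ∀ u, Xt (vx x0) u → sx x0 u = x0 → F u 1 = 1 ∧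
    ∀ g e, Xt (vx x0) g → vx x0 g e → len g < len u → len (g * gs e) < len u →
      F u (g * gs e) = F u g * rho cc ch u g e

theorem exists_F (hcc : CCok cc x0) (hch : ∀ u : RW E, u ≠ 1 → De u (ch u)) :
    ∃ F : RW E → RW E → A, Fok cc ch x0 F := by
  have : ∀ u, ∃ F : RW E → A, Xt (vx x0) u → sx x0 u = x0 → F 1 = 1 ∧
    ∀ g e, Xt (vx x0) g → vx x0 g e → len g < len u → len (g * gs e) < len u →
      F (g * gs e) = F g * rho cc ch u g e := by
    intro u
    by_cases h : Xt (vx x0) u ∧ sx x0 u = x0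
    · obtain ⟨F, -, h1, h2⟩ := pot (Q := fun g => Xt (vx x0) g ∧ len g < len u) (vdx x0)
        (fun h he => ⟨h.1.De_mul (vdx x0) he, by have := len_De he; omega⟩)
        ((rho_flat hcc hch h.1 h.2).mono fun g hg => ⟨hg.1, by rintro rfl; exact lt_irrefl _ hg.2⟩)
      exact ⟨F, fun _ _ => ⟨h1, fun g e a b c d => h2 a b ⟨a, c⟩ ⟨a.step b, d⟩⟩⟩
    · exact ⟨1, fun a b => absurd ⟨a, b⟩ h⟩
  choose F hF using this
  exact ⟨F, hF⟩

theorem tr_u {u : RW E} (hu : Xt (vx x0) u) (hu0 : sx x0 u = x0) (k : (ph E x0).ker) :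
    Xt (vx x0) ((iH x0 k)⁻¹ * u) ∧ sx x0 ((iH x0 k)⁻¹ * u) = x0 ∧
      hx x0 ((iH x0 k)⁻¹ * u) = hx x0 u := by
  rw [← map_inv]
  exact ⟨Xt_iH _ hu, by rw [sx_iH, hu0], hx_iH _ _⟩

theorem F_coc {F : RW E → RW E → A} (hF : Fok cc ch x0 F) {u : RW E} (hu : Xt (vx x0) u)
    (hu0 : sx x0 u = x0) (k : (ph E x0).ker) {g : RW E} (hg : Xt (vx x0) g)
    (hl : len (iH x0 k) + len g < len u) :
    F u (iH x0 k * g) = F u (iH x0 k) * F ((iH x0 k)⁻¹ * u) g := by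
  obtain ⟨t1, t2, t3⟩ := tr_u hu hu0 k
  induction hn : len g generalizing g with
  | zero => rw [len_eq_zero hn, (hF _ t1 t2).1]; simp
  | succ n ih =>
    obtain ⟨e, he⟩ := exists_De (g := g) (by rintro rfl; simp at hn)
    have h1 := len_De he
    have hg' := hg.De_mul (vdx x0) he
    have hve : vx x0 (g * gs e) e := (vdx x0).back (hg.val_of_De (vdx x0) he)
    have h2 := ih hg' (by omega) (by omega)
    have h3 := len_mul_le (iH x0 k) (g * gs e)
    have h4 := len_mul_le (iH x0 k) g
    have h5 := len_mul_le (iH x0 k) ((iH x0 k)⁻¹ * u)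
    rw [mul_inv_cancel_left] at h5
    have e1 := (hF u hu hu0).2 (iH x0 k * (g * gs e)) e (Xt_iH k hg') (by rwa [vx_iH]) (by omega)
      (by rw [mul_assoc, mul_gs_gs]; omega)
    have e2 := (hF _ t1 t2).2 (g * gs e) e hg' hve (by omega) (by rw [mul_gs_gs]; omega)
    rw [mul_gs_gs] at e2
    rw [mul_assoc, mul_gs_gs, h2] at e1
    rw [e1, e2, mul_assoc, rho, rho]
    simp only [mul_inv_rev, mul_assoc]

theorem nfp [Finite S] [Finite E] (hC : ∀ x : S, OctC E x (-1)) (hcc : CCok cc x0)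
    (hnp : ¬ ∃ p : E → A, ∀ e f, Oct x0 (-1) e → Oct x0 (-1) f → C e f → p e * cc e f = p f)
    (hz : ∃ z ∈ Gx E x0, 0 < hx x0 z) : ¬ IsFinitelyPresented (ph E x0).ker := by
  classical
  rintro ⟨n, R, Rfin, ⟨θ⟩⟩
  obtain ⟨e0, he0⟩ := (hC x0).1
  obtain ⟨ch, hch⟩ : ∃ ch : RW E → E, ∀ u : RW E, u ≠ 1 → De u (ch u) :=
    ⟨fun u => if h : ∃ e, De u e then h.choose else e0, fun u hu => by
      simp only; rw [dif_pos (exists_De hu)]; exact (exists_De hu).choose_spec⟩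
  obtain ⟨F, hF⟩ := exists_F hcc hch
  let H := (ph E x0).ker
  let π : FreeGroup (Fin n) →* H := θ.symm.toMonoidHom.comp (PresentedGroup.mk R)
  have πs : Function.Surjective π := θ.symm.surjective.comp (PresentedGroup.mk_surjective R)
  let Fh : RW E → H → H → A := fun u h k => F ((iH x0 h)⁻¹ * u) (iH x0 k)
  let W : RW E → Fin n → (Equiv.Perm (H × A))ᵐᵒᵖ := fun u j => .op
    { toFun := fun p => (p.1 * π (.of j), p.2 * Fh u p.1 (π (.of j)))
      invFun := fun p => (p.1 * (π (.of j))⁻¹, p.2 * (Fh u (p.1 * (π (.of j))⁻¹) (π (.of j)))⁻¹)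
      left_inv := fun p => by simp
      right_inv := fun p => by simp }
  let T : RW E → FreeGroup (Fin n) →* (Equiv.Perm (H × A))ᵐᵒᵖ := fun u => FreeGroup.lift (W u)
  have T1 : ∀ u w p, ((T u w).unop p).1 = p.1 * π w := by
    intro u w
    induction w using FreeGroup.induction_on with
    | C1 => intro p; rw [map_one, map_one]; simp
    | of j => intro p; simp only [T, FreeGroup.lift_apply_of]; rfl
    | inv_of j _ =>
      intro p; simp only [T, map_inv, FreeGroup.lift_apply_of]; rfl
    | mul a b ha hb =>
      intro p
      rw [map_mul, map_mul, MulOpposite.unop_mul, Equiv.Perm.mul_apply, hb, ha, mul_assoc]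
  have Fmul : ∀ {u : RW E}, Xt (vx x0) u → sx x0 u = x0 → ∀ (h k k' : H),
      ((len (iH x0 k) + len (iH x0 k') : ℕ) : ℤ) < hx x0 u → Fh u h (k * k') = Fh u h k * Fh u (h * k) k' := by
    intro u hu hu0 h k k' hl
    obtain ⟨t1, t2, t3⟩ := tr_u hu hu0 h
    have := F_coc hF t1 t2 k (iH_spec k').1 (by have := hx_le_len x0 ((iH x0 h)⁻¹ * u); omega)
    simp only [Fh, map_mul, mul_inv_rev, mul_assoc]
    exact this
  have F1 : ∀ {u : RW E}, Xt (vx x0) u → sx x0 u = x0 → ∀ h : H, Fh u h 1 = 1 := by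
    intro u hu hu0 h
    obtain ⟨t1, t2, t3⟩ := tr_u hu hu0 h
    simp only [Fh, map_one]; exact (hF _ t1 t2).1
  let good : ℕ → H → FreeGroup (Fin n) → Prop := fun N k w => ∀ u, Xt (vx x0) u → sx x0 u = x0 →
    (N : ℤ) ≤ hx x0 u → ∀ h a, ((T u w).unop (h, a)) = (h * k, a * Fh u h k)
  have gd : ∀ w, ∀ᶠ N in atTop, good N (π w) w := by
    intro w
    induction w using FreeGroup.induction_on with
    | C1 =>
      filter_upwards with N u hu hu0 _ h a
      rw [map_one, map_one, F1 hu hu0]; simp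
    | of j =>
      filter_upwards with N u hu hu0 _ h a
      simp only [T, FreeGroup.lift_apply_of]; rfl
    | inv_of j _ =>
      filter_upwards [eventually_gt_atTop (len (iH x0 (π (.of j))⁻¹) + len (iH x0 (π (.of j))))]
        with N hN u hu hu0 hh h a
      have e1 : (T u (FreeGroup.of j)⁻¹).unop (h, a) = (h * (π (.of j))⁻¹, a * (Fh u (h * (π (.of j))⁻¹) (π (.of j)))⁻¹) := by
        simp only [T, map_inv, FreeGroup.lift_apply_of]; rfl
      have e2 := Fmul hu hu0 h (π (.of j))⁻¹ (π (.of j)) (by omega)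
      rw [inv_mul_cancel, F1 hu hu0] at e2
      rw [e1, map_inv, eq_inv_of_mul_eq_one_left e2.symm]
    | mul x y hx hy =>
      filter_upwards [hx, hy, eventually_gt_atTop (len (iH x0 (π x)) + len (iH x0 (π y)))]
        with N h1 h2 hN u hu hu0 hh h a
      rw [map_mul, map_mul, MulOpposite.unop_mul, Equiv.Perm.mul_apply, h1 u hu hu0 hh, h2 u hu hu0 hh,
        Fmul hu hu0 h _ _ (by omega), mul_assoc, mul_assoc]
  have gdR : ∀ᶠ N in atTop, ∀ r ∈ R, good N 1 r := by
    rw [eventually_all_finite Rfin]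
    intro r hr
    have := gd r
    have e : π r = 1 := by
      show θ.symm _ = 1
      rw [PresentedGroup.one_of_mem hr, map_one]
    rwa [e] at this
  -- slab representatives
  let κ : RW E → S × ZMod 3 := fun g => (sx x0 g, ((hx x0 g : ℤ) : ZMod 3))
  obtain ⟨r, hr⟩ : ∃ r : S × ZMod 3 → RW E, ∀ g, Sl x0 g → Sl x0 (r (κ g)) ∧ κ (r (κ g)) = κ g :=
    ⟨fun z => if h : ∃ g, Sl x0 g ∧ κ g = z then h.choose else 1, fun g hg => by
      have h : ∃ g', Sl x0 g' ∧ κ g' = κ g := ⟨g, hg, rfl⟩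
      simp only
      rw [dif_pos h]; exact h.choose_spec⟩
  have hh : ∀ g, ∃ h : H, Sl x0 g → g = iH x0 h * r (κ g) := by
    intro g
    by_cases hg : Sl x0 g
    · obtain ⟨h1, h2⟩ := hr g hg
      have := (slab_ho (K := Unit) (Y := fun g _ => Sl x0 g) (fun _ _ h => h) (k := ()) (k' := ()) h1 hg).1
        (by simp only [κ, Prod.mk.injEq] at h2 ⊢; exact ⟨h2.1, h2.2, trivial⟩)
      obtain ⟨-, h, hh⟩ := this
      exact ⟨h, fun _ => hh⟩
    · exact ⟨1, fun h => absurd h hg⟩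
  choose η hη using hh
  have gdK : ∀ᶠ N in atTop, ∀ q : (S × ZMod 3) × E × (S × ZMod 3), ∀ k : H,
      iH x0 k = r q.1 * gs q.2.1 * (r q.2.2)⁻¹ →
      (∃ w, π w = k ∧ good N k w) ∧ len (iH x0 k) + len (r q.2.2) < N ∧ len (r q.1) + 1 < N := by
    rw [eventually_all]
    intro q
    by_cases h : ∃ k : H, iH x0 k = r q.1 * gs q.2.1 * (r q.2.2)⁻¹
    · obtain ⟨k, hk⟩ := h
      obtain ⟨w, rfl⟩ := πs k
      filter_upwards [gd w, eventually_gt_atTop (len (iH x0 (π w)) + len (r q.2.2)),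
        eventually_gt_atTop (len (r q.1) + 1)] with N h1 h2 h3 k' hk'
      obtain rfl : k' = π w := iH_inj x0 (hk'.trans hk.symm)
      exact ⟨⟨w, rfl, h1⟩, h2, h3⟩
    · filter_upwards with N k hk
      exact absurd ⟨k, hk⟩ h
  obtain ⟨N, hNR, hNK, hN3⟩ := (gdR.and (gdK.and (eventually_ge_atTop 3))).exists
  -- the far vertex
  obtain ⟨u, hu, hu0, huN⟩ : ∃ u, Xt (vx x0) u ∧ sx x0 u = x0 ∧ (N : ℤ) ≤ hx x0 u := by
    obtain ⟨z, hz, hz1⟩ := hz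
    have hp := (Gx E x0).pow_mem hz N
    refine ⟨z ^ N, hp.1, hp.2, ?_⟩
    have : ∀ m : ℕ, hx x0 (z ^ m) = m * hx x0 z := by
      intro m
      induction m with
      | zero => simp
      | succ m ih => rw [pow_succ, hx_mul, ((Gx E x0).pow_mem hz m).2, ih]; push_cast; ring
    rw [this]; nlinarith
  have hTR : ∀ r ∈ R, FreeGroup.lift (W u) r = 1 := by
    intro r hr
    apply MulOpposite.unop_injective
    ext1 ⟨h, a⟩
    have := hNR r hr u hu hu0 huN h a
    rw [F1 hu hu0, mul_one, mul_one] at this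
    exact this
  let Tb : PresentedGroup R →* (Equiv.Perm (H × A))ᵐᵒᵖ := PresentedGroup.toGroup hTR
  have TbT : ∀ w, Tb (θ (π w)) = T u w := by
    intro w
    have : θ (π w) = PresentedGroup.mk R w := θ.apply_symm_apply _
    rw [this]; rfl
  let fH : H → A := fun h => ((Tb (θ h)).unop (1, 1)).2
  have fHm : ∀ (h k : H) w, π w = k → good N k w → fH (h * k) = fH h * Fh u h k := by
    rintro h k w rfl hg
    have e1 : (Tb (θ h)).unop (1, 1) = (h, fH h) := by
      obtain ⟨w', rfl⟩ := πs h
      refine Prod.ext ?_ rfl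
      rw [TbT, T1]; simp
    show ((Tb (θ (h * π w))).unop (1, 1)).2 = _
    rw [map_mul, map_mul, MulOpposite.unop_mul, Equiv.Perm.mul_apply, e1, TbT, hg u hu hu0 huN]
  let f0 : RW E → A := fun g => fH (η g) * F ((iH x0 (η g))⁻¹ * u) (r (κ g))
  have hf0 : PotOn (vx x0) (Sl x0) (rho cc ch u) f0 := by
    intro g e hve hg hge
    have a1 := hη g hg
    have a2 := hη _ hge
    obtain ⟨k, hk⟩ : ∃ k : H, η (g * gs e) = η g * k := ⟨(η g)⁻¹ * η (g * gs e), by simp⟩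
    have ik : iH x0 k = r (κ g) * gs e * (r (κ (g * gs e)))⁻¹ := by
      rw [hk, map_mul] at a2
      nth_rewrite 1 [a1] at a2
      rw [mul_assoc, mul_assoc] at a2
      rw [mul_left_cancel a2, mul_inv_cancel_right]
    obtain ⟨⟨w, hw, hgw⟩, l1, l2⟩ := hNK (κ g, e, κ (g * gs e)) k ik
    simp only at l1 l2
    obtain ⟨t1, t2, t3⟩ := tr_u hu hu0 (η g)
    have lu := hx_le_len x0 ((iH x0 (η g))⁻¹ * u)
    have e1 := F_coc hF t1 t2 k (hr _ hge).1.1 (by omega)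
    have e2 : iH x0 k * r (κ (g * gs e)) = r (κ g) * gs e := by
      rw [ik, inv_mul_cancel_right]
    have lg := len_mul_le (r (κ g)) (gs e)
    have lg' := len_gs_le e
    have hre : vx x0 (r (κ g)) e := by
      have : sx x0 (r (κ g)) = sx x0 g := (Prod.ext_iff.1 (hr g hg).2).1
      rwa [vx, this]
    have e3 := (hF _ t1 t2).2 (r (κ g)) e (hr g hg).1.1 hre (by omega) (by omega)
    rw [e2, e3] at e1
    have e4 : rho cc ch ((iH x0 (η g))⁻¹ * u) (r (κ g)) e = rho cc ch u g e := by
      simp only [rho]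
      have : ∀ y : RW E, (r (κ g) * y)⁻¹ * ((iH x0 (η g))⁻¹ * u) = (g * y)⁻¹ * u := by
        intro y
        conv_rhs => rw [a1]
        simp only [mul_inv_rev, mul_assoc]
      have h1 := this 1
      rw [mul_one, mul_one] at h1
      rw [this, h1]
    simp only [f0]
    rw [hk, fHm _ k w hw hgw, map_mul, mul_inv_rev, mul_assoc, mul_assoc, mul_assoc, ← e4]
    congr 1
    exact e1.symm
  -- extend upwards
  let lo : RW E → Prop := fun g => Xt (vx x0) g ∧ 0 ≤ hx x0 g
  have ext : ∀ m : ℕ, (m : ℤ) + 2 < hx x0 u → ∃ f, PotOn (vx x0) (Vl x0 1 lo (m + 2)) (rho cc ch u) f := by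
    intro m
    induction m with
    | zero =>
      intro _
      exact ⟨f0, fun g e a b c => hf0 g e a ⟨b.1.1, b.1.2, by have := b.2; push_cast at this; omega⟩
        ⟨c.1.1, c.1.2, by have := c.2; push_cast at this; omega⟩⟩
    | succ m ih =>
      intro hm
      push_cast at hm
      obtain ⟨f, hf⟩ := ih (by omega)
      obtain ⟨f', -, h⟩ := E0step (σ := 1) (lo := lo) (n := m + 2) (Or.inl rfl) hC (fun g h => h.1)
        (fun g h h' => ⟨h, by omega⟩) ((rho_flat hcc hch hu hu0).mono (fun g hg => ⟨hg.1.1, by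
          rintro rfl; have := hg.2; omega⟩)) hf
      refine ⟨f', ?_⟩
      have : ((m + 1 : ℕ) : ℤ) + 2 = m + 2 + 1 := by push_cast; ring
      rwa [this]
  obtain ⟨m, hm⟩ : ∃ m : ℕ, (m : ℤ) + 3 = hx x0 u := ⟨(hx x0 u - 3).toNat, by omega⟩
  obtain ⟨f, hf⟩ := ext m (by omega)
  refine hnp ⟨fun e => f (u * gs e), fun e e' he he' hee => ?_⟩
  have ve : vx x0 u e := by rw [vx, hu0]; exact he.1
  have ve' : vx x0 u e' := by rw [vx, hu0]; exact he'.1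
  have h1 : hx x0 (u * gs e) = m + 2 := by rw [hx_v ve, hu0, he.2]; omega
  have h1' : hx x0 (u * gs e') = m + 2 := by rw [hx_v ve', hu0, he'.2]; omega
  have w1 : vx x0 (u * gs e) e' := (vdx x0).sq hee ve ve'
  have w2 : vx x0 (u * gs e') e := (vdx x0).sq (RA.symm hee) ve' ve
  have h2 : hx x0 (u * gs e * gs e') = m + 1 := by
    rw [hx_v w1, h1, dh_sq hee ve ve', hu0, he'.2]; omega
  have X1 := hu.step ve
  have X1' := hu.step ve'
  have X2 := X1.step w1
  have p1 := hf _ e' w1 ⟨⟨X1, by omega⟩, by omega⟩ ⟨⟨X2, by omega⟩, by omega⟩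
  have ecm := mul_gs_comm u hee
  have p2 := hf _ e w2 ⟨⟨X1', by omega⟩, by omega⟩
    (by rw [← ecm]; exact ⟨⟨X2, by omega⟩, by omega⟩)
  rw [← ecm, p1] at p2
  have ce : ∀ e : E, ch ((u * gs e)⁻¹ * u) = e := by
    intro e
    have : (u * gs e)⁻¹ * u = gs e := by simp [gs_inv]
    rw [this]
    refine De_gs.1 (hch _ fun h => ?_)
    exact De_one e (h ▸ De_gs.2 rfl)
  simp only [rho, ce, ← ecm] at p2
  have hq : (u * gs e * gs e')⁻¹ * u = gs e' * gs e := by simp [gs_inv, mul_assoc]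
  rw [hq] at p2
  generalize hch' : ch (gs e' * gs e) = d at p2
  have hd : De (gs e' * gs e) d := by
    rw [← hch']
    refine hch _ fun h => ?_
    have : De (gs e' * gs e) e := (De_mul_self (g := gs e') (e := e)).2
      fun h => irr e (by rw [De_gs.1 h] at hee ⊢; exact hee)
    rw [h] at this; exact De_one e this
  have hE1 : De (gs e' * gs e) e := (De_mul_self (g := gs e') (e := e)).2
      fun h => irr e (by rw [De_gs.1 h] at hee ⊢; exact hee)
  have hE2 : De (gs e' * gs e) e' := (De_mul_C (RA.symm hee)).2 (De_gs.2 rfl)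
  rw [← hq] at hd hE1 hE2
  have q1 := cc_tri hcc hu hu0 X2 hE1 hd hE2
  have q2 := cc_tri hcc hu hu0 X2 hE2 hd hE2
  rw [cc_self hcc he'.1] at q2
  show f (u * gs e) * cc e e' = f (u * gs e')
  rw [← q1, ← mul_assoc, p2, mul_assoc, q2, mul_one]
end NFP

/-! the complex L0 -/
abbrev V0 := Fin 21
def am : V0 → ℕ := ![2066784, 2073792, 2069152, 2082560, 2095104, 425989, 1146883, 720902, 851977, 1605644, 1441802, 1703953, 1376276, 819218, 229400, 25215, 20959, 19647, 13631, 11167, 7775]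
def ad (u v : V0) : Prop := (am u).testBit v.1 = true
instance : DecidableRel ad := fun u v => inferInstanceAs (Decidable (_ = _))
def kp (v : V0) : Fin 3 := if v.1 < 5 then 0 else if v.1 < 15 then 1 else 2
def lk : V0 → List V0 := ![[15, 5, 17, 5, 18, 8, 16, 6, 20, 11, 19], [15, 6, 16, 6, 20, 10, 17, 7, 19, 13, 18], [15, 5, 17, 5, 18, 12, 16, 7, 19, 9, 20], [15, 9, 19, 8, 16, 14, 17, 10, 18, 10, 20], [15, 13, 18, 12, 16, 14, 17, 11, 19, 11, 20], [15, 0, 17, 2, 18], [15, 0, 16, 1, 20], [16, 1, 17, 2, 19], [16, 0, 18, 3, 19], [15, 2, 19, 3, 20], [17, 1, 18, 3, 20], [17, 0, 19, 4, 20], [16, 2, 18, 4, 20], [15, 1, 18, 4, 19], [15, 3, 16, 4, 17], [0, 5, 2, 9, 3, 14, 4, 13, 1, 6], [0, 6, 1, 7, 2, 12, 4, 14, 3, 8], [0, 5, 2, 7, 1, 10, 3, 14, 4, 11], [0, 5, 2, 12, 4, 13, 1, 10, 3, 8], [0, 8, 3, 9, 2, 7, 1, 13, 4, 11], [0, 6,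 1, 10, 3, 9, 2, 12, 4, 11]]
def hp : List V0 := [0, 5, 2, 7, 1, 6, 15, 3, 8, 16, 12, 4, 11, 20, 9, 19, 13, 18, 10, 17, 14]
def pa : V0 → V0 := ![15, 15, 15, 15, 15, 15, 15, 2, 3, 15, 3, 4, 4, 15, 15, 15, 3, 5, 5, 3, 3]
def tb : List (ℕ × List ℤ) := [(8, [2]), (11, [2, -1, -2]), (16, [2]), (19, [2]), (20, [1, 2]), (28, [2, 1]), (31, [1, 2]), (37, [2]), (38, [2, 1]), (39, [1]), (40, [2, 1]), (41, [1, 2]), (54, [-1]), (58, [-1]), (80, [2, 1, -2]), (81, [-2]), (101, [2, 1, -2]), (102, [1]), (103, [2, 1]), (104, [1]), (142, [2]), (146, [1, 2]), (163, [-1]), (186, [-2]), (227, [2, 1, -2]), (228, [-2]), (248, [2, 1, -2]), (250, [2, 1]), (251, [1]), (270, [1]), (272, [1]), (291, [1]), (292, [2, 1]), (311, [2, 1, -2])]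
def stp : List (V0 × V0 × V0) := [(0, 15, 5), (0, 5, 17), (0, 5, 18), (0, 15, 6), (1, 15, 6), (1, 15, 13), (2, 15, 5), (2, 5, 17), (2, 5, 18), (7, 2, 17), (2, 15, 9), (8, 3, 16), (8, 3, 19), (3, 15, 9), (9, 3, 19), (2, 9, 19), (7, 2, 19), (9, 3, 20), (2, 9, 20), (10, 3, 20), (3, 15, 14), (14, 3, 16), (4, 15, 13), (4, 15, 14), (4, 14, 16), (12, 4, 16), (13, 1, 18), (4, 13, 18), (12, 4, 18), (2, 18, 12), (2, 12, 16), (7, 2, 16), (12, 2, 20), (4, 12, 20), (11, 4, 20), (0, 8, 16), (6, 0, 16), (8, 0, 18), (0, 8, 19), (1, 6, 16), (3, 8, 18), (10, 3, 18), (1, 16, 7), (1, 7, 17), (1, 7, 19), (1, 18, 10), (1, 10, 20), (6, 1, 20), (0, 6, 20), (13, 1, 19), (4, 13, 19), (11, 4, 19), (0, 19, 11), (11, 0, 17), (4, 11, 17), (14, 4, 17), (3, 14, 17), (10, 3, 17)]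
def tw (u v : V0) : List ℤ := (tb.lookup (21 * u.1 + v.1)).getD []

theorem ad_symm : ∀ u v, ad u v → ad v u := by decide +kernel
theorem ad_kp : ∀ u v, ad u v → kp u ≠ kp v := by decide +kernel
theorem ad_tri : ∀ u v, ad u v → ∃ w, ad u w ∧ ad v w := by decide +kernel
theorem ad_nb : ∀ u, ∃ w, ad u w := by decide +kernel
theorem kp_surj : ∀ i, ∃ u, kp u = i := by decide +kernel

theorem chain_const {T : Type*} {r : V0 → V0 → Prop} (f : V0 → T) {l : List V0} (hl : l.IsChain r)
    (hf : ∀ a ∈ l, ∀ b ∈ l, r a b → f a = f b) : ∀ a ∈ l, ∀ b ∈ l, f a = f b := by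
  induction l with
  | nil => simp
  | cons c l ih =>
    have key : ∀ a ∈ c :: l, f c = f a := by
      intro a ha
      rcases List.mem_cons.1 ha with rfl | ha
      · rfl
      · cases l with
        | nil => simp at ha
        | cons d l =>
          rw [List.isChain_cons_cons] at hl
          rw [hf c (by simp) d (by simp) hl.1]
          exact ih hl.2 (fun a ha b hb => hf a (by simp [ha]) b (by simp [hb])) d (by simp) a ha
    intro a ha b hb
    rw [← key a ha, ← key b hb]

theorem ad_conn {T : Type*} (f : V0 → T) (hf : ∀ u v, ad u v → f u = f v) (u v : V0) : f u = f v :=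
  chain_const (r := ad) f (l := hp) (by decide +kernel) (fun a _ b _ => hf a b) u
    ((by decide +kernel : ∀ u, u ∈ hp) u) v ((by decide +kernel : ∀ u, u ∈ hp) v)

theorem lk_mem : ∀ u v, ad u v ↔ v ∈ lk u := by decide +kernel
theorem lk_conn {T : Type*} (f : V0 → T) (w : V0) (hf : ∀ u v, ad w u → ad w v → ad u v → f u = f v)
    (u v : V0) (hu : ad w u) (hv : ad w v) : f u = f v :=
  chain_const (r := ad) f (l := lk w) ((by decide +kernel : ∀ w, (lk w).IsChain ad) w)
    (fun a ha b hb => hf a b ((lk_mem _ _).2 ha) ((lk_mem _ _).2 hb)) u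
    ((lk_mem _ _).1 hu) v ((lk_mem _ _).1 hv)

/-- exponents -/
def xa (u v : V0) : ℤ := ((tw u v).map fun z => if z = 1 then (1 : ℤ) else if z = -1 then -1 else 0).sum
  - ((tw v u).map fun z => if z = 1 then (1 : ℤ) else if z = -1 then -1 else 0).sum
def xb (u v : V0) : ℤ := ((tw u v).map fun z => if z = 2 then (1 : ℤ) else if z = -2 then -1 else 0).sum
  - ((tw v u).map fun z => if z = 2 then (1 : ℤ) else if z = -2 then -1 else 0).sum

def KK (l : List (V0 × V0 × V0)) (u v : V0) : Prop :=
  (pa v = u ∧ v ≠ 15) ∨ (pa u = v ∧ u ≠ 15) ∨ (u = 1 ∧ v = 18) ∨ (u = 18 ∧ v = 1) ∨ (u = 0 ∧ v = 8) ∨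
    (u = 8 ∧ v = 0) ∨ ∃ t ∈ l, (t.1 = u ∧ t.2.2 = v) ∨ (t.1 = v ∧ t.2.2 = u)
instance (l : List (V0 × V0 × V0)) (u v : V0) : Decidable (KK l u v) := inferInstanceAs (Decidable (_ ∨ _))
theorem KK_app {l : List (V0 × V0 × V0)} {t : V0 × V0 × V0} {u v : V0} (hk : KK (l ++ [t]) u v) :
    KK l u v ∨ (t.1 = u ∧ t.2.2 = v) ∨ (t.1 = v ∧ t.2.2 = u) := by
  simp only [KK, List.mem_append, List.mem_singleton] at hk ⊢
  rcases hk with hk | hk | hk | hk | hk | hk | ⟨t', ht' | rfl, hk⟩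
  on_goal 7 => exact Or.inl (by right; right; right; right; right; right; exact ⟨t', ht', hk⟩)
  on_goal 7 => exact Or.inr hk
  all_goals exact Or.inl (by tauto)
theorem KK_all : ∀ u v, ad u v → KK (stp.take 58) u v := by decide +kernel
theorem KK_chk : ∀ i : Fin 58, stp.take (i.1 + 1) = stp.take i.1 ++ [stp.getD i.1 (0, 0, 0)] ∧
    ad (stp.getD i.1 (0, 0, 0)).1 (stp.getD i.1 (0, 0, 0)).2.1 ∧
    ad (stp.getD i.1 (0, 0, 0)).2.1 (stp.getD i.1 (0, 0, 0)).2.2 ∧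
    ad (stp.getD i.1 (0, 0, 0)).1 (stp.getD i.1 (0, 0, 0)).2.2 ∧
    xa (stp.getD i.1 (0, 0, 0)).1 (stp.getD i.1 (0, 0, 0)).2.1 +
      xa (stp.getD i.1 (0, 0, 0)).2.1 (stp.getD i.1 (0, 0, 0)).2.2 =
      xa (stp.getD i.1 (0, 0, 0)).1 (stp.getD i.1 (0, 0, 0)).2.2 ∧
    xb (stp.getD i.1 (0, 0, 0)).1 (stp.getD i.1 (0, 0, 0)).2.1 +
      xb (stp.getD i.1 (0, 0, 0)).2.1 (stp.getD i.1 (0, 0, 0)).2.2 =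
      xb (stp.getD i.1 (0, 0, 0)).1 (stp.getD i.1 (0, 0, 0)).2.2 ∧
    KK (stp.take i.1) (stp.getD i.1 (0, 0, 0)).1 (stp.getD i.1 (0, 0, 0)).2.1 ∧
    KK (stp.take i.1) (stp.getD i.1 (0, 0, 0)).2.1 (stp.getD i.1 (0, 0, 0)).2.2 := by decide +kernel

theorem h1_aux {M : Type*} [CommGroup M] (b : V0 → V0 → M) (h1 : ∀ u v, ad u v → b u v * b v u = 1)
    (h2 : ∀ u v w, ad u v → ad v w → ad u w → b u v * b v w = b u w)
    (ht : ∀ v, v ≠ 15 → b (pa v) v = 1) : ∀ u v, ad u v → b u v = 1 := by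
  let x := b 1 18
  let y := b 0 8
  let G : V0 → V0 → Prop := fun u v => b u v = x ^ xa u v * y ^ xb u v
  have xs : ∀ u v, xa v u = - xa u v := by intro u v; simp [xa]
  have ys : ∀ u v, xb v u = - xb u v := by intro u v; simp [xb]
  have Gs : ∀ u v, ad u v → G u v → G v u := by
    intro u v h hg
    show b v u = _
    rw [xs u v, ys u v, ← inv_eq_of_mul_eq_one_right (h1 u v h), hg, mul_inv, zpow_neg, zpow_neg]
  have Gt : ∀ u v w, ad u v → ad v w → ad u w → xa u v + xa v w = xa u w → xb u v + xb v w = xb u w →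
      G u v → G v w → G u w := by
    intro u v w h h' h'' ha hb g g'
    show b u w = _
    rw [← h2 u v w h h' h'', g, g', ← ha, ← hb, zpow_add, zpow_add, mul_mul_mul_comm]
  have base : ∀ u v, ad u v → KK [] u v → G u v := by
    have b1 : ∀ v, v ≠ 15 → G (pa v) v := by
      intro v hv
      show _ = _
      rw [ht v hv, (by decide +kernel : ∀ v, v ≠ 15 → xa (pa v) v = 0) v hv,
        (by decide +kernel : ∀ v, v ≠ 15 → xb (pa v) v = 0) v hv]; simp
    have b2 : G 1 18 := by
      show _ = _
      rw [(by decide +kernel : xa 1 18 = 1), (by decide +kernel : xb 1 18 = 0)]; simp [x]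
    have b3 : G 0 8 := by
      show _ = _
      rw [(by decide +kernel : xa 0 8 = 0), (by decide +kernel : xb 0 8 = 1)]; simp [y]
    intro u v h hk
    rcases hk with ⟨rfl, hv⟩ | ⟨rfl, hv⟩ | ⟨rfl, rfl⟩ | ⟨rfl, rfl⟩ | ⟨rfl, rfl⟩ | ⟨rfl, rfl⟩ | ⟨t, ht, _⟩
    · exact b1 _ hv
    · exact Gs _ _ (ad_symm _ _ h) (b1 _ hv)
    · exact b2
    · exact Gs _ _ (ad_symm _ _ h) b2
    · exact b3
    · exact Gs _ _ (ad_symm _ _ h) b3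
    · simp at ht
  have ind : ∀ n, n ≤ 58 → ∀ u v, ad u v → KK (stp.take n) u v → G u v := by
    intro n
    induction n with
    | zero => intro _; simpa using base
    | succ n ih =>
      intro hn u v h hk
      obtain ⟨c0, c1, c2, c3, c4, c5, c6, c7⟩ := KK_chk ⟨n, by omega⟩
      obtain ⟨t, ht⟩ : ∃ t, stp.getD n (0, 0, 0) = t := ⟨_, rfl⟩
      simp only [ht] at c0 c1 c2 c3 c4 c5 c6 c7
      have gt : G t.1 t.2.2 := Gt _ _ _ c1 c2 c3 c4 c5 (ih (by omega) _ _ c1 c6) (ih (by omega) _ _ c2 c7)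
      rw [c0] at hk
      rcases KK_app hk with hk | ⟨rfl, rfl⟩ | ⟨rfl, rfl⟩
      · exact ih (by omega) u v h hk
      · exact gt
      · exact Gs _ _ (ad_symm _ _ h) gt
  have all : ∀ u v, ad u v → G u v := fun u v h => ind 58 le_rfl u v h (KK_all u v h)
  have tri : ∀ u v w, ad u v → ad v w → ad u w →
      x ^ (xa u v + xa v w - xa u w) * y ^ (xb u v + xb v w - xb u w) = 1 := by
    intro u v w h h' h''
    have := h2 u v w h h' h''
    rw [all u v h, all v w h', all u w h''] at this
    rw [zpow_sub, zpow_sub, zpow_add, zpow_add, mul_mul_mul_comm, ← mul_inv, ← this, mul_inv_eq_one,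
      mul_mul_mul_comm]
  have t1 := tri 0 11 20 (by decide +kernel) (by decide +kernel) (by decide +kernel)
  have t2 := tri 1 10 17 (by decide +kernel) (by decide +kernel) (by decide +kernel)
  rw [(by decide +kernel : xa 0 11 + xa 11 20 - xa 0 20 = -1), (by decide +kernel : xb 0 11 + xb 11 20 - xb 0 20 = -1)] at t1
  rw [(by decide +kernel : xa 1 10 + xa 10 17 - xa 1 17 = 1), (by decide +kernel : xb 1 10 + xb 10 17 - xb 1 17 = 0)] at t2
  have hx : x = 1 := by simpa using t2
  have hy : y = 1 := by rw [hx] at t1; simpa using t1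
  intro u v h
  have := all u v h
  simp only [G] at this
  rw [this, hx, hy]; simp

theorem h1_zero {M : Type*} [CommGroup M] (b : V0 → V0 → M) (h1 : ∀ u v, ad u v → b u v * b v u = 1)
    (h2 : ∀ u v w, ad u v → ad v w → ad u w → b u v * b v w = b u w) :
    ∃ p : V0 → M, ∀ u v, ad u v → p u * b u v = p v := by
  let b' : V0 → V0 → M := fun u v => if u = v then 1 else b u v
  let p : V0 → M := fun v => b' 15 (pa v) * b' (pa v) v
  have hb' : ∀ u v, ad u v → b' u v = b u v := by
    intro u v h
    have : u ≠ v := fun hh => ad_kp u v h (by rw [hh])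
    simp [b', this]
  refine ⟨p, fun u v h => ?_⟩
  have := h1_aux (fun u v => p u * b u v * (p v)⁻¹) ?_ ?_ ?_ u v h
  · exact mul_inv_eq_one.1 this
  · intro u v h
    have := h1 u v h
    show p u * b u v * (p v)⁻¹ * (p v * b v u * (p u)⁻¹) = 1
    rw [← mul_assoc, ← mul_assoc, inv_mul_cancel_right, mul_assoc (p u), this, mul_one, mul_inv_cancel]
  · intro u v w h h' h''
    show p u * b u v * (p v)⁻¹ * (p v * b v w * (p w)⁻¹) = p u * b u w * (p w)⁻¹
    rw [← h2 u v w h h' h'']; group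
  · intro v hv
    have hc := (by decide +kernel : ∀ v, v ≠ 15 → pa (pa v) = 15 ∧ ad (pa v) v) v hv
    show p (pa v) * b (pa v) v * (p v)⁻¹ = 1
    rw [mul_inv_eq_one, ← hb' _ _ hc.2]
    simp only [p]
    rw [hc.1]; simp [b']

def px : Equiv.Perm (Fin 5) := ⟨![1, 2, 3, 4, 0], ![4, 0, 1, 2, 3], by decide, by decide⟩
def py : Equiv.Perm (Fin 5) := ⟨![1, 3, 0, 4, 2], ![2, 0, 4, 1, 3], by decide, by decide⟩
def evw (l : List ℤ) : Equiv.Perm (Fin 5) :=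
  (l.map fun z => if z = 1 then px else if z = -1 then px⁻¹ else if z = 2 then py else py⁻¹).prod
def c0 (u v : V0) : Equiv.Perm (Fin 5) := evw (tw u v) * (evw (tw v u))⁻¹

theorem c0_cc : ∀ u v w, (u = v ∨ ad u v) → (v = w ∨ ad v w) → (u = w ∨ ad u w) →
    c0 u v * c0 v w = c0 u w := by decide +kernel

theorem c0_np : ¬ ∃ p : V0 → Equiv.Perm (Fin 5), ∀ u v, ad u v → p u * c0 u v = p v := by
  rintro ⟨p, hp⟩
  have e1 := hp 15 0 (by decide +kernel)
  have e2 := hp 15 3 (by decide +kernel)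
  have e3 := hp 3 8 (by decide +kernel)
  have e4 := hp 0 8 (by decide +kernel)
  rw [(by decide +kernel : c0 15 0 = 1), mul_one] at e1
  rw [(by decide +kernel : c0 15 3 = 1), mul_one] at e2
  rw [(by decide +kernel : c0 3 8 = 1), mul_one] at e3
  rw [← e1, ← e3, ← e2] at e4
  exact (by decide +kernel : c0 0 8 ≠ 1) (mul_eq_left.1 e4)

/-! concrete system -/
abbrev F89 := ZMod 89
abbrev Ut := Bool × Bool × F89
abbrev Dt := V0 × Bool × Bool × F89
abbrev Lt := Ut × Dt
abbrev Wv := Ut ⊕ Dt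

def xu (s k : Bool) : F89 := 2 * (if s then 1 else 0) + (if k then 1 else 0)
def md (v : V0) (s k : Bool) : F89 := 4 * (v.1 : F89) + 2 * (if s then 1 else 0) + (if k then 1 else 0)
def Rr (d : Dt) (u : Ut) : Prop := u.2.2 = md d.1 d.2.1 d.2.2.1 * xu u.1 u.2.1 + d.2.2.2

instance : Fact (Nat.Prime 89) := ⟨by norm_num⟩

theorem xu_inj : ∀ s k s' k', xu s k = xu s' k' → s = s' ∧ k = k' := by decide +kernel
theorem md_inj : ∀ v s k v' s' k', md v s k = md v' s' k' → v = v' ∧ s = s' ∧ k = k' := by decide +kernel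

theorem Rr4 {d d' : Dt} {u u' : Ut} (h1 : Rr d u) (h2 : Rr d u') (h3 : Rr d' u) (h4 : Rr d' u') :
    d = d' ∨ u = u' := by
  obtain ⟨v, s, k, c⟩ := d
  obtain ⟨v', s', k', c'⟩ := d'
  obtain ⟨a, b, y⟩ := u
  obtain ⟨a', b', y'⟩ := u'
  simp only [Rr] at h1 h2 h3 h4
  have : (md v s k - md v' s' k') * (xu a b - xu a' b') = 0 := by
    linear_combination -h1 + h2 + h3 - h4
  rcases mul_eq_zero.1 this with h | h
  · left
    have e := sub_eq_zero.1 h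
    obtain ⟨rfl, rfl, rfl⟩ := md_inj _ _ _ _ _ _ e
    have : c = c' := by linear_combination h3 - h1
    rw [this]
  · right
    obtain ⟨rfl, rfl⟩ := xu_inj _ _ _ _ (sub_eq_zero.1 h)
    have : y = y' := by linear_combination h1 - h2
    rw [this]

theorem Rr_d (u : Ut) (v : V0) (s : Bool) : ∃ d : Dt, d.1 = v ∧ d.2.1 = s ∧ Rr d u :=
  ⟨(v, s, false, u.2.2 - md v s false * xu u.1 u.2.1), rfl, rfl, by simp [Rr]⟩
theorem Rr_u (d : Dt) (s : Bool) : ∃ u : Ut, u.1 = s ∧ Rr d u :=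
  ⟨(s, false, md d.1 d.2.1 d.2.2.1 * xu s false + d.2.2.2), rfl, rfl⟩

theorem Rr_conn {T : Type*} (f : Ut → T) (g : Dt → T) (s : Bool) (v : V0) (t : Bool)
    (h : ∀ u d, u.1 = s → d.1 = v → d.2.1 = t → Rr d u → f u = g d) :
    ∀ u u', u.1 = s → u'.1 = s → f u = f u' := by
  have st : ∀ k k' l y, f (s, k, y) = f (s, k', y + md v t l * (xu s k' - xu s k)) := by
    intro k k' l y
    rw [h (s, k, y) (v, t, l, y - md v t l * xu s k) rfl rfl rfl (by simp [Rr]),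
      h (s, k', y + md v t l * (xu s k' - xu s k)) (v, t, l, y - md v t l * xu s k) rfl rfl rfl
        (by simp only [Rr]; ring)]
  have st1 : ∀ y, f (s, false, y) = f (s, false, y + 1) := by
    intro y
    rw [st false true true y, st true false false]
    congr 3
    simp only [md, xu]
    simp; ring
  have st2 : ∀ (n : ℕ) y, f (s, false, y) = f (s, false, y + n) := by
    intro n
    induction n with
    | zero => simp
    | succ n ih => intro y; rw [ih y, st1]; push_cast; ring_nf
  have st3 : ∀ y, f (s, false, y) = f (s, false, 0) := by
    intro y
    rw [st2 (y.val) 0]; simp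
  have st4 : ∀ u, u.1 = s → f u = f (s, false, 0) := by
    rintro ⟨_, k, y⟩ rfl
    rw [st k false false y, st3]
  intro u u' h h'
  rw [st4 u h, st4 u' h']

def cp : Wv → Wv → Prop
  | .inl _, _ => True
  | .inr d, .inl u => Rr d u
  | .inr d, .inr d' => ad d.1 d'.1
def Cm (i j : Fin 3) (a b : Wv) : Prop := (j = i + 1 → cp a b) ∧ (i = j + 1 → cp b a)
theorem Cm.symm {i j : Fin 3} {a b : Wv} (h : Cm i j a b) : Cm j i b a := ⟨h.2, h.1⟩
theorem Cm.rfl' (i : Fin 3) (a b : Wv) : Cm i i a b := by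
  have : ∀ i : Fin 3, i ≠ i + 1 := by decide
  exact ⟨fun h => (this i h).elim, fun h => (this i h).elim⟩
def kc (e : Lt) : Fin 3 := kp e.2.1
def En (e : Lt) (a : Wv) : Prop := a = .inl e.1 ∨ a = .inr e.2
def ot (e : Lt) : Wv → Wv
  | .inl _ => .inr e.2
  | .inr _ => .inl e.1
theorem En.ot {e : Lt} {a : Wv} (h : En e a) : En e (ot e a) := by
  rcases h with rfl | rfl
  · exact Or.inr rfl
  · exact Or.inl rfl
theorem En.otot {e : Lt} {a : Wv} (h : En e a) : _root_.ot e (_root_.ot e a) = a := by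
  rcases h with rfl | rfl <;> rfl

def CC (e f : Lt) : Prop := kc e ≠ kc f ∧ ∀ a b, En e a → En f b → Cm (kc e) (kc f) a b
instance : RA Lt where
  C := CC
  symm {_ _} h := ⟨h.1.symm, fun a b ha hb => (h.2 b a hb ha).symm⟩
  irr _ h := h.1 rfl

abbrev St := {x : Fin 3 → Wv // (∀ i d, x i = .inr d → kp d.1 = i) ∧ ∀ i j, Cm i j (x i) (x j)}

def vl (x : St) (e : Lt) : Prop :=
  En e (x.1 (kc e)) ∧ ∀ j, j ≠ kc e → ∀ a, En e a → Cm (kc e) j a (x.1 j)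
def sg (e : Lt) : ℤ := if e.1.1 = e.2.2.1 then 1 else -1
def dv (e : Lt) : Wv → ℤ
  | .inl _ => sg e
  | .inr _ => - sg e

open Classical in
noncomputable def mo (x : St) (e : Lt) : St :=
  if h : vl x e then ⟨Function.update x.1 (kc e) (ot e (x.1 (kc e))), by
    constructor
    · intro i d hd
      by_cases hi : i = kc e
      · subst hi
        rw [Function.update_self] at hd
        rcases h.1.ot with h' | h' <;> rw [hd] at h'
        · cases h'
        · cases h'; rfl
      · rw [Function.update_of_ne hi] at hd
        exact x.2.1 i d hd
    · intro i j
      by_cases hi : i = kc e <;> by_cases hj : j = kc e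
      · rw [hi, hj]; exact Cm.rfl' _ _ _
      · subst hi; rw [Function.update_self, Function.update_of_ne hj]
        exact h.2 j hj _ h.1.ot
      · subst hj; rw [Function.update_self, Function.update_of_ne hi]
        exact (h.2 i hi _ h.1.ot).symm
      · rw [Function.update_of_ne hi, Function.update_of_ne hj]; exact x.2.2 i j⟩
  else x

theorem mo_v {x : St} {e : Lt} (h : vl x e) : (mo x e).1 = Function.update x.1 (kc e) (ot e (x.1 (kc e))) := by
  simp [mo, h]
theorem mo_same {x : St} {e : Lt} (h : vl x e) : (mo x e).1 (kc e) = ot e (x.1 (kc e)) := by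
  rw [mo_v h, Function.update_self]
theorem mo_ne {x : St} {e : Lt} (h : vl x e) {j : Fin 3} (hj : j ≠ kc e) : (mo x e).1 j = x.1 j := by
  rw [mo_v h, Function.update_of_ne hj]

theorem vl_back {x : St} {e : Lt} (h : vl x e) : vl (mo x e) e :=
  ⟨by rw [mo_same h]; exact h.1.ot, fun j hj a ha => by rw [mo_ne h hj]; exact h.2 j hj a ha⟩
theorem vl_sq {x : St} {e f : Lt} (hc : CC e f) (h : vl x e) (h' : vl x f) : vl (mo x e) f := by
  refine ⟨by rw [mo_ne h hc.1.symm]; exact h'.1, fun j hj a ha => ?_⟩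
  by_cases hje : j = kc e
  · subst hje
    rw [mo_same h]
    exact (hc.2 _ _ h.1.ot ha).symm
  · rw [mo_ne h hje]; exact h'.2 j hj a ha

noncomputable instance : Sys Lt St where
  v := vl
  mv := mo
  dh x e := dv e (x.1 (kc e))
  back := vl_back
  mvmv := by
    intro x e h
    apply Subtype.ext
    rw [mo_v (vl_back h), mo_same h, mo_v h, h.1.otot]
    simp
  sq := vl_sq
  mvc := by
    intro x e f hc h h'
    apply Subtype.ext
    have hc : CC e f := hc
    have hc' : CC f e := RA.symm (E := Lt) hc
    rw [mo_v (vl_sq hc h h'), mo_v (vl_sq hc' h' h), mo_ne h hc'.1, mo_ne h' hc.1, mo_v h, mo_v h',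
      Function.update_comm hc.1]
  dhb := by
    intro x e h
    rw [mo_same h]
    rcases h.1 with h | h <;> rw [h] <;> simp [dv, ot]
  dhs := by
    intro x e f hc h h'
    have hc : CC e f := hc
    rw [mo_ne h hc.1.symm]
  dh1 := by
    intro x e h
    have : sg e = 1 ∨ sg e = -1 := by unfold sg; split <;> simp
    cases x.1 (kc e) <;> simp only [dv] <;> omega

/-! generic cohomology lemmas -/
section gen
variable {E : Type} [RA E]
def ConP (P : E → Prop) : Prop := (∃ e, P e) ∧ ∀ (T : Type) (f : E → T),
    (∀ e e', P e → P e' → C e e' → f e = f e') → ∀ e e', P e → P e' → f e = f e'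
def HomP (P : E → Prop) : Prop :=
  ∀ (M : Type) [CommGroup M] (b : E → E → M),
    (∀ e f, P e → P f → C e f → b e f * b f e = 1) →
    (∀ e f g, P e → P f → P g → C e f → C f g → C e g → b e f * b f g = b e g) →
    ∃ p : E → M, ∀ e f, P e → P f → C e f → p e * b e f = p f

variable {P B G A : E → Prop}

theorem joinC (hP : ∀ e, P e ↔ B e ∨ G e) {b0 g0 : E} (hb0 : B b0) (hg0 : G g0)
    (hbg : ∀ b g, B b → G g → C b g) : ConP P := by
  refine ⟨⟨b0, (hP _).2 (Or.inl hb0)⟩, fun T f hf => ?_⟩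
  have key : ∀ e, P e → f e = f b0 := by
    intro e he
    rcases (hP e).1 he with h | h
    · rw [hf e g0 he ((hP _).2 (Or.inr hg0)) (hbg _ _ h hg0),
        hf b0 g0 ((hP _).2 (Or.inl hb0)) ((hP _).2 (Or.inr hg0)) (hbg _ _ hb0 hg0)]
    · rw [hf b0 e ((hP _).2 (Or.inl hb0)) he (hbg _ _ hb0 h)]
  intro e e' he he'
  rw [key e he, key e' he']

theorem joinH (hP : ∀ e, P e ↔ B e ∨ G e) {b0 g0 : E} (hb0 : B b0) (hg0 : G g0)
    (hbg : ∀ b g, B b → G g → C b g) (hbb : ∀ b b', B b → B b' → ¬ C b b')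
    (hG : ∀ (T : Type) (f : E → T), (∀ g g', G g → G g' → C g g' → f g = f g') →
      ∀ g g', G g → G g' → f g = f g') : HomP P := by
  classical
  intro M _ c h1 h2
  have pB : ∀ {b}, B b → P b := fun h => (hP _).2 (Or.inl h)
  have pG : ∀ {b}, G b → P b := fun h => (hP _).2 (Or.inr h)
  have cgb : ∀ b g, B b → G g → C g b := fun b g h h' => RA.symm (hbg b g h h')
  have inv : ∀ e f, P e → P f → C e f → c f e = (c e f)⁻¹ := fun e f he hf h =>
    eq_inv_of_mul_eq_one_right (h1 e f he hf h)
  have key : ∀ b, B b → ∀ g g', G g → G g' → c b g * (c b0 g)⁻¹ = c b g' * (c b0 g')⁻¹ := by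
    intro b hb
    apply hG M (fun g => c b g * (c b0 g)⁻¹)
    intro g g' hg hg' h
    show c b g * (c b0 g)⁻¹ = c b g' * (c b0 g')⁻¹
    rw [← h2 b g g' (pB hb) (pG hg) (pG hg') (hbg _ _ hb hg) h (hbg _ _ hb hg'),
      ← h2 b0 g g' (pB hb0) (pG hg) (pG hg') (hbg _ _ hb0 hg) h (hbg _ _ hb0 hg')]
    rw [mul_inv_rev]; group
  have dis : ∀ e, B e → G e → False := fun e h h' => RA.irr e (hbg e e h h')
  let p : E → M := fun e => if B e then c g0 e else c g0 b0 * c b0 e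
  have qB : ∀ {b}, B b → p b = c g0 b := fun h => by simp [p, h]
  have qG : ∀ {b}, G b → p b = c g0 b0 * c b0 b := fun {b} h => by
    have : ¬ B b := fun h' => dis b h' h
    simp [p, this]
  have bg : ∀ b g, B b → G g → p b * c b g = p g := by
    intro b g hb hg
    have := key b hb g g0 hg hg0
    rw [qB hb, qG hg, inv b g0 (pB hb) (pG hg0) (hbg _ _ hb hg0), inv b0 g0 (pB hb0) (pG hg0) (hbg _ _ hb0 hg0)]
    rw [mul_inv_eq_iff_eq_mul] at this
    rw [this]
    simp only [mul_assoc, inv_mul_cancel_left]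
  refine ⟨p, fun e f he hf h => ?_⟩
  rcases (hP e).1 he with he' | he' <;> rcases (hP f).1 hf with hf' | hf'
  · exact (hbb _ _ he' hf' h).elim
  · exact bg e f he' hf'
  · rw [← bg f e hf' he', inv f e hf he (hbg _ _ hf' he'), mul_inv_cancel_right]
  · rw [qG he', qG hf', mul_assoc, h2 b0 e f (pB hb0) he hf (hbg _ _ hb0 he') h (hbg _ _ hb0 hf')]

variable {ty : E → V0}

/-- blow-up of the complex -/
theorem blowC (hC : ∀ e f, P e → P f → (C e f ↔ ad (ty e) (ty f))) {s : V0 → E} (hs : ∀ v, P (s v))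
    (ts : ∀ v, ty (s v) = v) : ConP P := by
  refine ⟨⟨s 0, hs 0⟩, fun T f hf => ?_⟩
  have key : ∀ e, P e → f e = f (s 0) := by
    intro e he
    obtain ⟨w, hw⟩ := ad_nb (ty e)
    rw [hf e (s w) he (hs w) ((hC _ _ he (hs w)).2 (by rwa [ts]))]
    exact ad_conn (fun v => f (s v)) (fun u v h => hf _ _ (hs u) (hs v)
      ((hC _ _ (hs _) (hs _)).2 (by rwa [ts, ts]))) w 0
  intro e e' he he'
  rw [key e he, key e' he']

theorem blowH (hC : ∀ e f, P e → P f → (C e f ↔ ad (ty e) (ty f))) {s : V0 → E} (hs : ∀ v, P (s v))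
    (ts : ∀ v, ty (s v) = v) : HomP P := by
  intro M _ c h1 h2
  have css : ∀ u v, ad u v → C (s u) (s v) := fun u v h => (hC _ _ (hs u) (hs v)).2 (by rwa [ts, ts])
  have cse : ∀ u e, P e → ad (ty e) u → C (s u) e := fun u e he h =>
    (hC _ _ (hs u) he).2 (by rw [ts]; exact ad_symm _ _ h)
  obtain ⟨p0, hp0⟩ := h1_zero (fun u v => c (s u) (s v)) (fun u v h => h1 _ _ (hs u) (hs v) (css _ _ h))
    (fun u v w h h' h'' => h2 _ _ _ (hs _) (hs _) (hs _) (css _ _ h) (css _ _ h') (css _ _ h''))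
  choose nb hnb using ad_nb
  let p : E → M := fun e => p0 (nb (ty e)) * c (s (nb (ty e))) e
  have key : ∀ e, P e → ∀ w, ad (ty e) w → p e = p0 w * c (s w) e := by
    intro e he w hw
    refine lk_conn (fun w => p0 w * c (s w) e) (ty e) (fun u v hu hv huv => ?_) _ _ (hnb _) hw
    show p0 u * c (s u) e = p0 v * c (s v) e
    rw [← hp0 u v huv, mul_assoc, h2 _ _ _ (hs u) (hs v) he (css _ _ huv) (cse _ _ he hv) (cse _ _ he hu)]
  refine ⟨p, fun e f he hf h => ?_⟩
  obtain ⟨w, hw, hw'⟩ := ad_tri _ _ ((hC e f he hf).1 h)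
  rw [key e he w hw, key f hf w hw', mul_assoc, h2 _ _ _ (hs w) he hf (cse _ _ he hw) h (cse _ _ hf hw')]

/-- the mixed case -/
theorem mixC (hP : ∀ e, P e ↔ A e ∨ B e ∨ G e) {a0 b0 : E} (ha0 : A a0) (hb0 : B b0)
    (hab : ∀ a b, A a → B b → C a b) (hga : ∀ g, G g → ∃ a, A a ∧ C g a) : ConP P := by
  have pA : ∀ {b}, A b → P b := fun h => (hP _).2 (Or.inl h)
  have pB : ∀ {b}, B b → P b := fun h => (hP _).2 (Or.inr (Or.inl h))
  refine ⟨⟨b0, pB hb0⟩, fun T f hf => ?_⟩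
  have kA : ∀ a, A a → f a = f b0 := fun a ha => hf _ _ (pA ha) (pB hb0) (hab _ _ ha hb0)
  have key : ∀ e, P e → f e = f b0 := by
    intro e he
    rcases (hP e).1 he with h | h | h
    · exact kA e h
    · rw [← kA a0 ha0, hf a0 e (pA ha0) he (hab _ _ ha0 h)]
    · obtain ⟨a, ha, hc⟩ := hga e h
      rw [hf e a he (pA ha) hc, kA a ha]
  intro e e' he he'
  rw [key e he, key e' he']

theorem mixH (hP : ∀ e, P e ↔ A e ∨ B e ∨ G e) {a0 b0 : E} (ha0 : A a0) (hb0 : B b0)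
    (hab : ∀ a b, A a → B b → C a b) {δ : V0} {i1 i2 : Fin 3} (hi : i1 ≠ i2)
    (hk : ∀ w, ad δ w → kp w = i1 ∨ kp w = i2)
    (hB : ∀ b, B b → kp (ty b) = i1 ∧ ad δ (ty b)) (hG : ∀ g, G g → kp (ty g) = i2 ∧ ad δ (ty g))
    (hbg : ∀ b g, B b → G g → (C b g ↔ ad (ty b) (ty g)))
    (sB : ∀ w, kp w = i1 → ad δ w → ∃ b, B b ∧ ty b = w)
    (hR : ∀ t, kp t = i2 → ad δ t → ∀ (T : Type) (f g : E → T),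
      (∀ a g', A a → G g' → ty g' = t → C g' a → f a = g g') → ∀ a a', A a → A a' → f a = f a')
    (naa : ∀ a a', A a → A a' → ¬ C a a') (nbb : ∀ a a', B a → B a' → ¬ C a a')
    (ngg : ∀ a a', G a → G a' → ¬ C a a')
    (dab : ∀ e, A e → B e → False) (dag : ∀ e, A e → G e → False)
    (hga : ∀ g, G g → ∃ a, A a ∧ C g a) : HomP P := by
  classical
  intro M _ c h1 h2
  have pA : ∀ {b}, A b → P b := fun h => (hP _).2 (Or.inl h)
  have pB : ∀ {b}, B b → P b := fun h => (hP _).2 (Or.inr (Or.inl h))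
  have pG : ∀ {b}, G b → P b := fun h => (hP _).2 (Or.inr (Or.inr h))
  have inv : ∀ e f, P e → P f → C e f → c f e = (c e f)⁻¹ := fun e f he hf h =>
    eq_inv_of_mul_eq_one_right (h1 e f he hf h)
  have k1 : ∀ b b' t, B b → B b' → kp t = i2 → ad δ t → ad (ty b) t → ad (ty b') t →
      ∀ a a', A a → A a' → c a b * (c a b')⁻¹ = c a' b * (c a' b')⁻¹ := by
    intro b b' t hb hb' ht hδ ht1 ht2
    refine hR t ht hδ M (fun a => c a b * (c a b')⁻¹) (fun g => c g b * (c g b')⁻¹) ?_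
    rintro a g ha hg rfl hc
    have hc' := RA.symm hc
    have t1 := RA.symm ((hbg b g hb hg).2 ht1)
    have t2 := RA.symm ((hbg b' g hb' hg).2 ht2)
    show c a b * (c a b')⁻¹ = c g b * (c g b')⁻¹
    rw [← h2 a g b (pA ha) (pG hg) (pB hb) hc' t1 (hab _ _ ha hb),
      ← h2 a g b' (pA ha) (pG hg) (pB hb') hc' t2 (hab _ _ ha hb')]
    rw [mul_comm (c a g), mul_comm (c a g)]; group
  let D : E → {a // A a} → {a // A a} → M := fun b a a' => c a.1 b * (c a'.1 b)⁻¹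
  have k2 : ∀ b b' t, B b → B b' → kp t = i2 → ad δ t → ad (ty b) t → ad (ty b') t → D b = D b' := by
    intro b b' t hb hb' ht hδ ht1 ht2
    funext a a'
    have := k1 b b' t hb hb' ht hδ ht1 ht2 a.1 a'.1 a.2 a'.2
    rw [mul_inv_eq_iff_eq_mul] at this
    simp only [D]
    rw [this, mul_inv_eq_iff_eq_mul]; simp only [mul_assoc, mul_comm, mul_left_comm]
  have tri : ∀ w, ad δ w → ∃ t, ad δ t ∧ ad w t := ad_tri δ
  haveI : Nonempty E := ⟨a0⟩
  choose! nb hnb using tri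
  choose! s hs using sB
  have other : ∀ w w', ad δ w → ad δ w' → ad w w' → kp w = i1 → kp w' = i2 := fun w w' _ h' h'' h =>
    (hk w' h').resolve_left fun hh => ad_kp _ _ h'' (by rw [h, hh])
  have other' : ∀ w w', ad δ w → ad δ w' → ad w w' → kp w = i2 → kp w' = i1 := fun w w' _ h' h'' h =>
    (hk w' h').resolve_right fun hh => ad_kp _ _ h'' (by rw [h, hh])
  let q : V0 → V0 := fun w => if kp w = i1 then w else nb w
  have q1 : ∀ w, kp w = i1 → q w = w := fun w h => by simp [q, h]
  have q2 : ∀ w, kp w = i2 → q w = nb w := fun w h => by simp [q, h, hi.symm]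
  have st : ∀ w t, ad δ w → ad δ t → ad w t → kp w = i1 → D (s (q w)) = D (s (q t)) := by
    intro w t hw ht hwt h
    have h' := other w t hw ht hwt h
    have h'' := other' _ _ ht (hnb t ht).1 (hnb t ht).2 h'
    rw [q1 w h, q2 t h']
    refine k2 _ _ t (hs w h hw).1 (hs _ h'' (hnb t ht).1).1 h' ht ?_ ?_
    · rwa [(hs w h hw).2]
    · rw [(hs _ h'' (hnb t ht).1).2]; exact ad_symm _ _ (hnb t ht).2
  have k3 : ∀ b b', B b → B b' → D b = D b' := by
    have : ∀ b, B b → D b = D (s (q (ty b))) := by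
      intro b hb
      obtain ⟨hb1, hb2⟩ := hB b hb
      have := hnb _ hb2
      rw [q1 _ hb1]
      refine k2 _ _ _ hb (hs _ hb1 hb2).1 (other _ _ hb2 this.1 this.2 hb1) this.1 this.2 ?_
      rw [(hs _ hb1 hb2).2]; exact this.2
    intro b b' hb hb'
    rw [this b hb, this b' hb']
    refine lk_conn (fun w => D (s (q w))) δ ?_ _ _ (hB b hb).2 (hB b' hb').2
    intro u v hu hv huv
    rcases hk u hu with h | h
    · exact st u v hu hv huv h
    · exact (st v u hv hu (ad_symm _ _ huv) (other' _ _ hu hv huv h)).symm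
  have gb : ∀ g, ∃ b, G g → B b ∧ C b g := by
    intro g
    by_cases hg : G g
    · obtain ⟨h1, h2⟩ := hG g hg
      have := hnb _ h2
      have hh := hs _ (other' _ _ h2 this.1 this.2 h1) this.1
      exact ⟨s (nb (ty g)), fun _ => ⟨hh.1, (hbg _ _ hh.1 hg).2 (by rw [hh.2]; exact ad_symm _ _ this.2)⟩⟩
    · exact ⟨g, fun h => (hg h).elim⟩
  choose β hβ using gb
  let pb : E → M := fun b => c b0 a0 * c a0 b
  let p : E → M := fun e => if A e then c b0 e else if B e then pb e else pb (β e) * c (β e) e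
  have qA : ∀ {e}, A e → p e = c b0 e := fun h => by simp [p, h]
  have qB : ∀ {e}, B e → p e = pb e := fun {e} h => by
    have : ¬ A e := fun h' => dab e h' h
    simp [p, h, this]
  have dbg : ∀ e, B e → G e → False := fun e h h' => hi (by rw [← (hB e h).1, ← (hG e h').1])
  have qG : ∀ {e}, G e → p e = pb (β e) * c (β e) e := fun {e} h => by
    have h1 : ¬ A e := fun h' => dag e h' h
    have h2 : ¬ B e := fun h' => dbg e h' h
    simp [p, h1, h2]
  have ab : ∀ a b, A a → B b → p a * c a b = p b := by
    intro a b ha hb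
    have := congrFun (congrFun (k3 b b0 hb hb0) ⟨a, ha⟩) ⟨a0, ha0⟩
    simp only [D] at this
    rw [qA ha, qB hb, inv a b0 (pA ha) (pB hb0) (hab _ _ ha hb0)]
    simp only [pb]
    rw [inv a0 b0 (pA ha0) (pB hb0) (hab _ _ ha0 hb0)]
    rw [mul_inv_eq_iff_eq_mul] at this
    rw [this, mul_assoc, inv_mul_cancel_left]
  have ag : ∀ a g, A a → G g → C a g → p a * c a g = p g := by
    intro a g ha hg h
    obtain ⟨hb, hc⟩ := hβ g hg
    rw [qG hg, ← qB hb, ← ab a _ ha hb, mul_assoc, h2 _ _ _ (pA ha) (pB hb) (pG hg) (hab _ _ ha hb) hc h]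
  have bg : ∀ b g, B b → G g → C b g → p b * c b g = p g := by
    intro b g hb hg h
    obtain ⟨a, ha, hc⟩ := hga g hg
    replace hc := RA.symm hc
    rw [← ag a g ha hg hc, ← ab a b ha hb, mul_assoc, h2 _ _ _ (pA ha) (pB hb) (pG hg) (hab _ _ ha hb) h hc]
  have sym : ∀ e f, P e → P f → C e f → p f * c f e = p e → p e * c e f = p f := by
    intro e f he hf h h'
    rw [← h', inv e f he hf h, inv_mul_cancel_right]
  refine ⟨p, fun e f he hf h => ?_⟩
  rcases (hP e).1 he with he' | he' | he' <;> rcases (hP f).1 hf with hf' | hf' | hf'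
  · exact (naa _ _ he' hf' h).elim
  · exact ab e f he' hf'
  · exact ag e f he' hf' h
  · exact sym e f he hf h (ab f e hf' he')
  · exact (nbb _ _ he' hf' h).elim
  · exact bg e f he' hf' h
  · exact sym e f he hf h (ag f e hf' he' (RA.symm h))
  · exact sym e f he hf h (bg f e hf' he' (RA.symm h))
  · exact (ngg _ _ he' hf' h).elim
end gen

/-! octants of the concrete system -/
theorem f3 : ∀ i : Fin 3, i + 1 + 1 = i + 2 ∧ i + 1 + 2 = i ∧ i + 2 + 1 = i ∧ i + 2 + 2 = i + 1 := by decide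
theorem f3c : ∀ i j : Fin 3, j = i ∨ j = i + 1 ∨ j = i + 2 := by decide
theorem f3n : ∀ i : Fin 3, i + 1 ≠ i ∧ i + 2 ≠ i ∧ i + 2 ≠ i + 1 := by decide

theorem Cm1 {i : Fin 3} {a b : Wv} : Cm i (i + 1) a b ↔ cp a b := by
  refine ⟨fun h => h.1 rfl, fun h => ⟨fun _ => h, fun h' => ?_⟩⟩
  rw [(f3 i).1] at h'; exact absurd h'.symm (f3n i).2.1
theorem Cm2 {i : Fin 3} {a b : Wv} : Cm i (i + 2) a b ↔ cp b a := by
  refine ⟨fun h => h.2 (f3 i).2.2.1.symm, fun h => ⟨fun h' => ?_, fun _ => h⟩⟩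
  exact absurd h' (f3n i).2.2

theorem vl_iff {x : St} {e : Lt} {i : Fin 3} (hk : kc e = i) : vl x e ↔ En e (x.1 i) ∧
    ∀ a, En e a → cp a (x.1 (i + 1)) ∧ cp (x.1 (i + 2)) a := by
  subst hk
  refine and_congr Iff.rfl ⟨fun h a ha => ⟨Cm1.1 (h _ (f3n _).1 a ha), Cm2.1 (h _ (f3n _).2.1 a ha)⟩, ?_⟩
  intro h j hj a ha
  rcases f3c (kc e) j with rfl | h' | h'
  · exact (hj rfl).elim
  · rw [h']; exact Cm1.2 (h a ha).1
  · rw [h']; exact Cm2.2 (h a ha).2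

theorem st1 (x : St) (i : Fin 3) : cp (x.1 i) (x.1 (i + 1)) := Cm1.1 (x.2.2 i (i + 1))
theorem st2 (x : St) (i : Fin 3) : cp (x.1 (i + 2)) (x.1 i) := Cm2.1 (x.2.2 i (i + 2))

def sb (τ : ℤ) (b : Bool) : Bool := if τ = 1 then b else !b
theorem sb_iff {τ : ℤ} (hτ : IsPM τ) (e : Lt) : (sg e = τ ↔ e.2.2.1 = sb τ e.1.1) ∧
    (-sg e = τ ↔ e.1.1 = sb (-τ) e.2.2.1) := by
  unfold sg sb
  rcases hτ with rfl | rfl <;> cases e.1.1 <;> cases e.2.2.1 <;> simp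

theorem octU {x : St} {τ : ℤ} (hτ : IsPM τ) {e : Lt} {i : Fin 3} (hk : kc e = i) {u : Ut} (hx : x.1 i = .inl u) :
    Oct x τ e ↔ e.1 = u ∧ e.2.2.1 = sb τ u.1 ∧ cp (.inr e.2) (x.1 (i + 1)) ∧ cp (x.1 (i + 2)) (.inr e.2) := by
  show vl x e ∧ dv e (x.1 (kc e)) = τ ↔ _
  have s1 := st1 x i
  have s2 := st2 x i
  rw [vl_iff hk, hk]
  rw [hx] at s1 s2 ⊢
  constructor
  · rintro ⟨⟨h1, h2⟩, h3⟩
    have hu : e.1 = u := by rcases h1 with h | h <;> cases h; rfl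
    exact ⟨hu, by rw [← hu]; exact (sb_iff hτ e).1.1 h3, h2 _ (Or.inr rfl)⟩
  · rintro ⟨rfl, h2, h3⟩
    refine ⟨⟨Or.inl rfl, ?_⟩, (sb_iff hτ e).1.2 h2⟩
    rintro a (rfl | rfl)
    · exact ⟨s1, s2⟩
    · exact h3

theorem octD {x : St} {τ : ℤ} (hτ : IsPM τ) {e : Lt} {i : Fin 3} (hk : kc e = i) {d : Dt} (hx : x.1 i = .inr d) :
    Oct x τ e ↔ e.2 = d ∧ e.1.1 = sb (-τ) d.2.1 ∧ cp (x.1 (i + 2)) (.inl e.1) := by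
  show vl x e ∧ dv e (x.1 (kc e)) = τ ↔ _
  have s1 := st1 x i
  have s2 := st2 x i
  rw [vl_iff hk, hk]
  rw [hx] at s1 s2 ⊢
  constructor
  · rintro ⟨⟨h1, h2⟩, h3⟩
    have hu : e.2 = d := by rcases h1 with h | h <;> cases h; rfl
    exact ⟨hu, by rw [← hu]; exact (sb_iff hτ e).2.1 h3, (h2 _ (Or.inl rfl)).2⟩
  · rintro ⟨rfl, h2, h3⟩
    refine ⟨⟨Or.inr rfl, ?_⟩, (sb_iff hτ e).2.2 h2⟩
    rintro a (rfl | rfl)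
    · exact ⟨trivial, h3⟩
    · exact ⟨s1, s2⟩

theorem CC_ne {e f : Lt} (h : C e f) : kc e ≠ kc f := And.left (h : CC e f)

theorem C_iff {x : St} {e f : Lt} {i : Fin 3} (he : vl x e) (hf : vl x f) (hi : kc e = i) (hj : kc f = i + 1) :
    C e f ↔ cp (ot e (x.1 i)) (ot f (x.1 (i + 1))) := by
  have he' := (vl_iff hi).1 he
  have hf' := (vl_iff hj).1 hf
  show CC e f ↔ _
  unfold CC
  rw [hi, hj]
  constructor
  · intro h
    exact Cm1.1 (h.2 _ _ he'.1.ot hf'.1.ot)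
  · intro h
    refine ⟨(f3n i).1.symm, fun a b ha hb => Cm1.2 ?_⟩
    have hA : ∀ (e : Lt) a b, En e a → En e b → a = b ∨ a = ot e b := by
      rintro e a b (rfl | rfl) (rfl | rfl) <;> simp [ot]
    rcases hA f b _ hb hf'.1 with rfl | rfl
    · exact (he'.2 a ha).1
    · rcases hA e a _ ha he'.1 with rfl | rfl
      · have := (hf'.2 _ hf'.1.ot).2
        rwa [(f3 i).2.1] at this
      · exact h

theorem C_symm' {e f : Lt} : C e f ↔ C f e := ⟨RA.symm, RA.symm⟩

theorem C_ad {e f : Lt} (h : C e f) : ad e.2.1 f.2.1 := by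
  have h : CC e f := h
  have := h.2 _ _ (Or.inr rfl) (Or.inr rfl)
  rcases f3c (kc e) (kc f) with h' | h' | h'
  · exact (h.1 h'.symm).elim
  · rw [h'] at this; exact Cm1.1 this
  · rw [h'] at this; exact ad_symm _ _ (Cm2.1 this)

theorem third {u v w : V0} (h : ad u v) (h1 : ad u w) (h2 : ad v w) {i : Fin 3} (hi : kp u = i) (hj : kp v = i + 1) :
    kp w = i + 2 := by
  have a := ad_kp _ _ h1
  have b := ad_kp _ _ h2
  rw [hi] at a; rw [hj] at b
  rcases f3c i (kp w) with h | h | h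
  · exact (a h.symm).elim
  · exact (b h.symm).elim
  · exact h

section
variable {x : St} {τ : ℤ}

theorem oct_ddd (hτ : IsPM τ) (h : ∀ i, ∃ d, x.1 i = .inr d) : ConP (Oct (E := Lt) x τ) ∧ HomP (Oct (E := Lt) x τ) := by
  choose d hd using h
  have ne : ∀ i, ∃ e, Oct x τ e ∧ kc e = i := by
    intro i
    obtain ⟨u, hu, hr⟩ := Rr_u (d (i + 2)) (sb (-τ) (d i).2.1)
    have hk : kc (u, d i) = i := x.2.1 i _ (hd i)
    exact ⟨(u, d i), (octD hτ hk (hd i)).2 ⟨rfl, hu, by rw [hd]; exact hr⟩, hk⟩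
  have com : ∀ e f, Oct x τ e → Oct x τ f → kc e ≠ kc f → C e f := by
    have : ∀ e f, Oct x τ e → Oct x τ f → kc f = kc e + 1 → C e f := by
      intro e f he hf h
      rw [C_iff he.1 hf.1 rfl h, hd]; trivial
    intro e f he hf h
    rcases f3c (kc e) (kc f) with h' | h' | h'
    · exact (h h'.symm).elim
    · exact this e f he hf h'
    · exact RA.symm (this f e hf he (by rw [h', (f3 _).2.2.1]))
  obtain ⟨e0, he0, hk0⟩ := ne 0
  obtain ⟨e1, he1, hk1⟩ := ne 1
  obtain ⟨e2, he2, hk2⟩ := ne 2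
  have hP : ∀ e, Oct x τ e ↔ (Oct x τ e ∧ kc e = 0) ∨ (Oct x τ e ∧ kc e ≠ 0) := fun e => by tauto
  have hbg : ∀ b g, (Oct x τ b ∧ kc b = 0) → (Oct x τ g ∧ kc g ≠ 0) → C b g := fun b g hb hg =>
    com b g hb.1 hg.1 (by rw [hb.2]; exact hg.2.symm)
  have hg0 : Oct x τ e1 ∧ kc e1 ≠ 0 := ⟨he1, by rw [hk1]; decide⟩
  refine ⟨joinC hP ⟨he0, hk0⟩ hg0 hbg, joinH hP ⟨he0, hk0⟩ hg0 hbg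
    (fun b b' hb hb' h => CC_ne h (by rw [hb.2, hb'.2])) ?_⟩
  intro T f hf
  have key : ∀ g, Oct x τ g ∧ kc g ≠ 0 → f g = f e1 := by
    intro g hg
    have hg2 : Oct x τ e2 ∧ kc e2 ≠ 0 := ⟨he2, by rw [hk2]; decide⟩
    by_cases h : kc g = 1
    · rw [hf g e2 hg hg2 (com _ _ hg.1 he2 (by rw [h, hk2]; decide)),
        hf e1 e2 hg0 hg2 (com _ _ he1 he2 (by rw [hk1, hk2]; decide))]
    · exact hf g e1 hg hg0 (com _ _ hg.1 he1 (by rwa [hk1]))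
  intro g g' hg hg'
  rw [key g hg, key g' hg']

theorem oct_ddu (hτ : IsPM τ) {i : Fin 3} {d d' : Dt} {u : Ut} (h0 : x.1 i = .inr d) (h1 : x.1 (i + 1) = .inr d')
    (h2 : x.1 (i + 2) = .inl u) : ConP (Oct (E := Lt) x τ) ∧ HomP (Oct (E := Lt) x τ) := by
  obtain ⟨q1, q2, q3, q4⟩ := f3 i
  obtain ⟨n1, n2, n3⟩ := f3n i
  have k0 := x.2.1 i _ h0
  have k1 := x.2.1 _ _ h1
  have hdd : ad d.1 d'.1 := by have := st1 x i; rw [h0, h1] at this; exact this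
  have hA : ∀ e, kc e = i → (Oct x τ e ↔ e.2 = d ∧ e.1.1 = sb (-τ) d.2.1) := by
    intro e hk; rw [octD hτ hk h0, h2]; simp [cp]
  have hB : ∀ e, kc e = i + 1 → (Oct x τ e ↔ e.2 = d' ∧ e.1.1 = sb (-τ) d'.2.1 ∧ Rr d e.1) := by
    intro e hk; rw [octD hτ hk h1, q2, h0]; simp [cp]
  have hG : ∀ e, kc e = i + 2 → (Oct x τ e ↔ e.1 = u ∧ e.2.2.1 = sb τ u.1 ∧ ad e.2.1 d.1 ∧ ad d'.1 e.2.1) := by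
    intro e hk; rw [octU hτ hk h2, q3, q4, h0, h1]; simp [cp]
  have cab : ∀ e f, Oct x τ e → Oct x τ f → kc e = i → kc f = i + 1 → C e f := by
    intro e f he hf h h'
    rw [C_iff he.1 hf.1 h h', h0]; trivial
  have cbg : ∀ e f, Oct x τ e → Oct x τ f → kc e = i + 1 → kc f = i + 2 → C e f := by
    intro e f he hf h h'
    rw [C_iff he.1 hf.1 h (by rw [h', q1]), h1]; trivial
  have cga : ∀ e f, Oct x τ e → Oct x τ f → kc e = i + 2 → kc f = i → (C e f ↔ Rr e.2 f.1) := by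
    intro e f he hf h h'
    rw [C_iff he.1 hf.1 h (by rw [h', q3]), q3, h0, h2]; rfl
  obtain ⟨u', hu', hr'⟩ := Rr_u d (sb (-τ) d'.2.1)
  have hb0 : Oct x τ (u', d') ∧ kc (u', d') = i + 1 := ⟨(hB (u', d') k1).2 ⟨rfl, hu', hr'⟩, k1⟩
  have hg0 : Oct x τ (((sb (-τ) d.2.1, false, 0) : Ut), d) ∧ kc (((sb (-τ) d.2.1, false, 0) : Ut), d) ≠ i + 1 :=
    ⟨(hA ((sb (-τ) d.2.1, false, 0), d) k0).2 ⟨rfl, rfl⟩, by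
      intro h; exact n1 (h.symm.trans k0)⟩
  have hP : ∀ e, Oct x τ e ↔ (Oct x τ e ∧ kc e = i + 1) ∨ (Oct x τ e ∧ kc e ≠ i + 1) := fun e => by tauto
  have hbg : ∀ b g, (Oct x τ b ∧ kc b = i + 1) → (Oct x τ g ∧ kc g ≠ i + 1) → C b g := by
    rintro b g ⟨hb, hb'⟩ ⟨hg, hg'⟩
    rcases f3c i (kc g) with h | h | h
    · exact RA.symm (cab g b hg hb h hb')
    · exact (hg' h).elim
    · exact cbg b g hb hg hb' h
  refine ⟨joinC hP hb0 hg0 hbg, joinH hP hb0 hg0 hbg (fun b b' hb hb' h => CC_ne h (by rw [hb.2, hb'.2])) ?_⟩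
  intro T f hf
  obtain ⟨w, hw, hw'⟩ := ad_tri _ _ hdd
  have kw := third hdd hw hw' k0 k1
  have cA : ∀ v v' : Ut, v.1 = sb (-τ) d.2.1 → v'.1 = sb (-τ) d.2.1 → f (v, d) = f (v', d) := by
    refine Rr_conn (fun v => f (v, d)) (fun d'' => f (u, d'')) _ w (sb τ u.1) ?_
    rintro v d'' hv rfl ht hr
    have o1 : Oct x τ (v, d) := (hA (v, d) k0).2 ⟨rfl, hv⟩
    have o2 : Oct x τ (u, d'') := (hG (u, d'') kw).2 ⟨rfl, ht, ad_symm _ _ hw, hw'⟩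
    exact hf _ _ ⟨o1, by show kp d.1 ≠ _; rw [k0]; exact n1.symm⟩ ⟨o2, by show kp d''.1 ≠ _; rw [kw]; exact n3⟩
      (RA.symm ((cga _ _ o2 o1 kw k0).2 hr))
  have key : ∀ g, Oct x τ g ∧ kc g ≠ i + 1 → f g = f (((sb (-τ) d.2.1, false, 0) : Ut), d) := by
    have kA : ∀ g, Oct x τ g → kc g = i → f g = f (((sb (-τ) d.2.1, false, 0) : Ut), d) := by
      rintro ⟨g, g'⟩ hg hk
      obtain ⟨h, h'⟩ := (hA _ hk).1 hg
      simp only at h h'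
      subst h
      exact cA _ _ h' rfl
    intro g hg
    rcases f3c i (kc g) with h | h | h
    · exact kA g hg.1 h
    · exact (hg.2 h).elim
    · obtain ⟨v, hv, hr⟩ := Rr_u g.2 (sb (-τ) d.2.1)
      have o1 : Oct x τ (v, d) := (hA (v, d) k0).2 ⟨rfl, hv⟩
      rw [hf g (v, d) hg ⟨o1, by show kp d.1 ≠ _; rw [k0]; exact n1.symm⟩ ((cga _ _ hg.1 o1 h k0).2 hr)]
      exact kA _ o1 k0
  intro g g' hg hg'
  rw [key g hg, key g' hg']

theorem oct_duu (hτ : IsPM τ) {i : Fin 3} {d : Dt} {u u' : Ut} (h0 : x.1 i = .inr d) (h1 : x.1 (i + 1) = .inl u)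
    (h2 : x.1 (i + 2) = .inl u') : ConP (Oct (E := Lt) x τ) ∧ HomP (Oct (E := Lt) x τ) := by
  obtain ⟨q1, q2, q3, q4⟩ := f3 i
  obtain ⟨n1, n2, n3⟩ := f3n i
  have k0 := x.2.1 i _ h0
  have hA : ∀ e, kc e = i → (Oct x τ e ↔ e.2 = d ∧ e.1.1 = sb (-τ) d.2.1) := by
    intro e hk; rw [octD hτ hk h0, h2]; simp [cp]
  have hB : ∀ e, kc e = i + 1 → (Oct x τ e ↔ e.1 = u ∧ e.2.2.1 = sb τ u.1 ∧ Rr e.2 u' ∧ ad d.1 e.2.1) := by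
    intro e hk; rw [octU hτ hk h1, q1, q2, h0, h2]; simp [cp]
  have hG : ∀ e, kc e = i + 2 → (Oct x τ e ↔ e.1 = u' ∧ e.2.2.1 = sb τ u'.1 ∧ ad e.2.1 d.1) := by
    intro e hk; rw [octU hτ hk h2, q3, q4, h0, h1]; simp [cp]
  have cab : ∀ e f, Oct x τ e → Oct x τ f → kc e = i → kc f = i + 1 → C e f := by
    intro e f he hf h h'
    rw [C_iff he.1 hf.1 h h', h0]; trivial
  have cbg : ∀ e f, Oct x τ e → Oct x τ f → kc e = i + 1 → kc f = i + 2 → (C e f ↔ ad e.2.1 f.2.1) := by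
    intro e f he hf h h'
    rw [C_iff he.1 hf.1 h (by rw [h', q1]), q1, h1, h2]; rfl
  have cga : ∀ e f, Oct x τ e → Oct x τ f → kc e = i + 2 → kc f = i → (C e f ↔ Rr e.2 f.1) := by
    intro e f he hf h h'
    rw [C_iff he.1 hf.1 h (by rw [h', q3]), q3, h0, h2]; rfl
  have hP : ∀ e, Oct x τ e ↔ (Oct x τ e ∧ kc e = i) ∨ (Oct x τ e ∧ kc e = i + 1) ∨ (Oct x τ e ∧ kc e = i + 2) :=
    fun e => by have := f3c i (kc e); tauto
  have hk : ∀ w, ad d.1 w → kp w = i + 1 ∨ kp w = i + 2 := by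
    intro w hw
    have := ad_kp _ _ hw
    rw [k0] at this
    rcases f3c i (kp w) with h | h
    · exact (this h.symm).elim
    · exact h
  have sB : ∀ w, kp w = i + 1 → ad d.1 w → ∃ b, (Oct x τ b ∧ kc b = i + 1) ∧ b.2.1 = w := by
    intro w hw ha
    obtain ⟨d', rfl, hs, hr⟩ := Rr_d u' w (sb τ u.1)
    exact ⟨(u, d'), ⟨(hB (u, d') hw).2 ⟨rfl, hs, hr, ha⟩, hw⟩, rfl⟩
  have hga : ∀ g, (Oct x τ g ∧ kc g = i + 2) → ∃ a, (Oct x τ a ∧ kc a = i) ∧ C g a := by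
    rintro g ⟨hg, hgk⟩
    obtain ⟨v, hv, hr⟩ := Rr_u g.2 (sb (-τ) d.2.1)
    have o1 : Oct x τ (v, d) := (hA (v, d) k0).2 ⟨rfl, hv⟩
    exact ⟨(v, d), ⟨o1, k0⟩, (cga _ _ hg o1 hgk k0).2 hr⟩
  have hab : ∀ a b, (Oct x τ a ∧ kc a = i) → (Oct x τ b ∧ kc b = i + 1) → C a b := fun a b ha hb =>
    cab a b ha.1 hb.1 ha.2 hb.2
  have ha0 : Oct x τ (((sb (-τ) d.2.1, false, 0) : Ut), d) ∧ kc (((sb (-τ) d.2.1, false, 0) : Ut), d) = i :=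
    ⟨(hA ((sb (-τ) d.2.1, false, 0), d) k0).2 ⟨rfl, rfl⟩, k0⟩
  have : ∃ w, kp w = i + 1 ∧ ad d.1 w := by
    obtain ⟨w, hw⟩ := ad_nb d.1
    rcases hk w hw with h | h
    · exact ⟨w, h, hw⟩
    · obtain ⟨w', h1', h2'⟩ := ad_tri _ _ hw
      rcases hk w' h1' with h' | h'
      · exact ⟨w', h', h1'⟩
      · exact (ad_kp _ _ h2' (by rw [h, h'])).elim
  obtain ⟨w, hw, hw'⟩ := this
  obtain ⟨b0, hb0, -⟩ := sB w hw hw'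
  refine ⟨mixC hP ha0 hb0 hab hga, mixH (ty := fun e => e.2.1) hP ha0 hb0 hab (i1 := i + 1) (i2 := i + 2) n3.symm hk ?_ ?_ ?_ sB
    ?_ (fun b b' hb hb' h => CC_ne h (by rw [hb.2, hb'.2])) (fun b b' hb hb' h => CC_ne h (by rw [hb.2, hb'.2]))
    (fun b b' hb hb' h => CC_ne h (by rw [hb.2, hb'.2])) (fun e h h' => n1 (h'.2.symm.trans h.2))
    (fun e h h' => n2 (h'.2.symm.trans h.2)) hga⟩
  · exact fun b hb => ⟨hb.2, ((hB b hb.2).1 hb.1).2.2.2⟩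
  · exact fun b hb => ⟨hb.2, ad_symm _ _ ((hG b hb.2).1 hb.1).2.2⟩
  · exact fun b g hb hg => cbg b g hb.1 hg.1 hb.2 hg.2
  · intro t ht hδ T f g hfg
    have := Rr_conn (fun v => f (v, d)) (fun d'' => g (u', d'')) (sb (-τ) d.2.1) t (sb τ u'.1) ?_
    · rintro ⟨v, d1⟩ ⟨v', d2⟩ ⟨ha, hak⟩ ⟨ha', hak'⟩
      obtain ⟨h, h'⟩ := (hA _ hak).1 ha
      obtain ⟨h3, h4⟩ := (hA _ hak').1 ha'
      simp only at h h' h3 h4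
      subst h h3
      exact this v v' h' h4
    · rintro v d'' hv rfl hs hr
      have o1 : Oct x τ (v, d) := (hA (v, d) k0).2 ⟨rfl, hv⟩
      have o2 : Oct x τ (u', d'') := (hG (u', d'') ht).2 ⟨rfl, hs, ad_symm _ _ hδ⟩
      exact hfg _ _ ⟨o1, k0⟩ ⟨o2, ht⟩ rfl ((cga _ _ o2 o1 ht k0).2 hr)

theorem uuu_sec (hτ : IsPM τ) {u : Fin 3 → Ut} (h : ∀ i, x.1 i = .inl (u i)) :
    (∀ e f : Lt, Oct x τ e → Oct x τ f → (C e f ↔ ad e.2.1 f.2.1)) ∧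
    ∃ s : V0 → Lt, ∀ v, Oct x τ (s v) ∧ (s v).2.1 = v := by
  constructor
  · have : ∀ e f : Lt, Oct x τ e → Oct x τ f → kc f = kc e + 1 → (C e f ↔ ad e.2.1 f.2.1) := by
      intro e f he hf hk
      rw [C_iff he.1 hf.1 rfl hk, h, h]; rfl
    intro e f he hf
    rcases f3c (kc e) (kc f) with h' | h' | h'
    · exact ⟨fun h => (CC_ne h h'.symm).elim, fun h => (ad_kp _ _ h h'.symm).elim⟩
    · exact this e f he hf h'
    · rw [C_symm', this f e hf he (by rw [h', (f3 _).2.2.1])]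
      exact ⟨ad_symm _ _, ad_symm _ _⟩
  · have : ∀ v, ∃ e : Lt, Oct x τ e ∧ e.2.1 = v := by
      intro v
      obtain ⟨d, rfl, hs, hr⟩ := Rr_d (u (kp v + 1)) v (sb τ (u (kp v)).1)
      exact ⟨(u (kp d.1), d), (octU (e := (u (kp d.1), d)) hτ rfl (h (kp d.1))).2 ⟨rfl, hs, by rw [h]; exact hr, by rw [h]; trivial⟩, rfl⟩
    choose s hs using this
    exact ⟨s, hs⟩

theorem oct_uuu (hτ : IsPM τ) {u : Fin 3 → Ut} (h : ∀ i, x.1 i = .inl (u i)) :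
    ConP (Oct (E := Lt) x τ) ∧ HomP (Oct (E := Lt) x τ) := by
  obtain ⟨hC, s, hs⟩ := uuu_sec hτ h
  exact ⟨blowC (ty := fun e => e.2.1) hC (fun v => (hs v).1) fun v => (hs v).2,
    blowH (ty := fun e => e.2.1) hC (fun v => (hs v).1) fun v => (hs v).2⟩

theorem oct_all (x : St) (hτ : IsPM τ) : OctC Lt x τ ∧ OctH Lt x τ := by
  show ConP (Oct (E := Lt) x τ) ∧ HomP (Oct (E := Lt) x τ)
  rcases h0 : x.1 0 with a | a <;> rcases h1 : x.1 1 with b | b <;> rcases h2 : x.1 2 with c | c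
  · exact oct_uuu (u := ![a, b, c]) hτ (by intro i; fin_cases i <;> assumption)
  · exact oct_duu (i := 2) hτ h2 h0 h1
  · exact oct_duu (i := 1) hτ h1 h2 h0
  · exact oct_ddu (i := 1) hτ h1 h2 h0
  · exact oct_duu (i := 0) hτ h0 h1 h2
  · exact oct_ddu (i := 2) hτ h2 h0 h1
  · exact oct_ddu (i := 0) hτ h0 h1 h2
  · exact oct_ddd hτ (by intro i; fin_cases i; exacts [⟨_, h0⟩, ⟨_, h1⟩, ⟨_, h2⟩])
end

/-! no split loops -/
section
variable {E S : Type} [RA E] [Sys E S]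
open Sys
open Classical in
theorem wd_filter {Q : E → Prop} {l : List E} (h : ∀ e ∈ l, ∀ f ∈ l, Q e → ¬ Q f → C e f) :
    wd l = wd (l.filter fun e => Q e) * wd (l.filter fun e => ¬ Q e) := by
  induction l with
  | nil => simp
  | cons e l ih =>
    have ih := ih fun a ha b hb => h a (by simp [ha]) b (by simp [hb])
    by_cases he : Q e
    · simp only [List.filter_cons, he, decide_true, if_true, wd_cons, not_true_eq_false, decide_false,
        Bool.false_eq_true, if_false]
      rw [ih, mul_assoc]
    · simp only [List.filter_cons, he, decide_true, if_true, wd_cons, not_false_eq_true, decide_false,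
        Bool.false_eq_true, if_false]
      rw [ih, ← mul_assoc, ← mul_assoc]
      congr 1
      have : ∀ l' : List E, (∀ f ∈ l', C f e) → gs e * wd l' = wd l' * gs e := by
        intro l' hl'
        induction l' with
        | nil => simp
        | cons f l' ih' =>
          rw [wd_cons, ← mul_assoc, ← gs_comm (hl' f (by simp)), mul_assoc, ih' fun f hf => hl' f (by simp [hf]), mul_assoc]
      apply this
      intro f hf
      rw [List.mem_filter] at hf
      exact h f (by simp [hf.1]) e (by simp) (by simpa using hf.2) he

theorem pot_no {x : S} {g : RW E} (hg : g ∈ Gx E x) {Q : E → Prop}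
    (hQ : ∀ e f, 0 < ct e g → 0 < ct f g → Q e → ¬ Q f → C e f) (hne : ∃ e, 0 < ct e g ∧ Q e)
    (F : S → RW E) (h1 : ∀ y e, 0 < ct e g → v y e → Q e → F (mv y e) = F y * gs e)
    (h2 : ∀ y e, 0 < ct e g → v y e → ¬ Q e → F (mv y e) = F y) : False := by
  classical
  obtain ⟨l, hl, rfl⟩ := exists_red g
  simp only [ct_pos hl] at *
  have key : ∀ l' : List E, Red l' → (∀ e ∈ l', e ∈ l) → Xt (vx x) (wd l') →
      F (sx x (wd l')) = F x * wd (l'.filter fun e => Q e) := by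
    intro l'
    induction l' using List.reverseRecOn with
    | nil => simp
    | append_singleton l' e ih =>
      intro hr hs hX
      have hd := hr.De
      have hv := hX.val_of_De (vdx x) hd
      have hX' := hX.step hv
      have e1 : wd (l' ++ [e]) * gs e = wd l' := by rw [wd_append, mul_assoc]; simp
      rw [e1] at hX'
      have hv' : v (sx x (wd l')) e := by
        have := (vdx x).1 hv
        rwa [e1] at this
      have ih := ih hr.left (fun a ha => hs a (by simp [ha])) hX'
      have he := hs e (by simp)
      rw [wd_append, wd_cons, wd_nil, mul_one, sx_v hv', List.filter_append]
      by_cases hq : Q e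
      · rw [h1 _ _ he hv' hq, ih]; simp [hq, mul_assoc]
      · rw [h2 _ _ he hv' hq, ih]; simp [hq]
  have h3 := key l hl (fun _ h => h) hg.1
  rw [hg.2] at h3
  have h4 : wd (l.filter fun e => Q e) = 1 := by simpa using h3
  have h5 := wd_filter (Q := Q) (l := l) fun e he f hf => hQ e f he hf
  rw [h4, one_mul] at h5
  have h6 := len_le (l.filter fun e => ¬ Q e)
  rw [← h5, hl] at h6
  obtain ⟨e, he, hq⟩ := hne
  have : (l.filter fun e => ¬ Q e).length < l.length := List.length_filter_lt_length_iff_exists.2 ⟨e, he, by simp [hq]⟩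
  omega
end

noncomputable def pU (c : Ut) : Wv → RW Lt
  | .inl _ => 1
  | .inr d => gs (c, d)
noncomputable def pD (c : Dt) : Wv → RW Lt
  | .inl u => gs (u, c)
  | .inr _ => 1
theorem pU_s {c : Ut} {e : Lt} (he : e.1 = c) {a : Wv} (h : En e a) : pU c (ot e a) = pU c a * gs e := by
  subst he
  rcases h with rfl | rfl <;> simp [pU, ot]
theorem pD_s {c : Dt} {e : Lt} (he : e.2 = c) {a : Wv} (h : En e a) : pD c (ot e a) = pD c a * gs e := by
  subst he
  rcases h with rfl | rfl <;> simp [pD, ot]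

theorem CC_R {e f : Lt} (h : C e f) (hk : kc f = kc e + 1) : Rr e.2 f.1 := by
  have h : CC e f := h
  have := h.2 (.inr e.2) (.inl f.1) (Or.inr rfl) (Or.inl rfl)
  rw [hk] at this; exact Cm1.1 this

theorem noSplit1 {x : St} {g : RW Lt} (hg : g ∈ Gx Lt x) {Q : Lt → Prop}
    (hQ : ∀ e f, 0 < ct e g → 0 < ct f g → Q e → ¬ Q f → C e f) (h1 : ∃ e, 0 < ct e g ∧ Q e)
    (h2 : ∃ e, 0 < ct e g ∧ ¬ Q e) {j : Fin 3} (hj : ∀ e, 0 < ct e g → Q e → kc e = j) : False := by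
  have hn : ∀ f, 0 < ct f g → ¬ Q f → kc f ≠ j := by
    intro f hf hq h
    obtain ⟨e, he, hqe⟩ := h1
    exact CC_ne (hQ e f he hf hqe hq) (by rw [hj e he hqe, h])
  -- two different u's
  have a1 : ∃ e f, 0 < ct e g ∧ Q e ∧ 0 < ct f g ∧ Q f ∧ e.1 ≠ f.1 := by
    by_contra hc
    push Not at hc
    obtain ⟨e0, he0, hq0⟩ := h1
    refine pot_no hg hQ ⟨e0, he0, hq0⟩ (fun y => pU e0.1 (y.1 j)) ?_ ?_
    · intro y e he hv hq
      have hv : vl y e := hv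
      have := hj e he hq
      show pU e0.1 ((mo y e).1 j) = pU e0.1 (y.1 j) * gs e
      rw [← this, mo_same hv]
      exact pU_s (hc e e0 he hq he0 hq0) hv.1
    · intro y e he hv hq
      show pU e0.1 ((mo y e).1 j) = pU e0.1 (y.1 j)
      rw [mo_ne hv (hn e he hq).symm]
  have a2 : ∃ e f, 0 < ct e g ∧ Q e ∧ 0 < ct f g ∧ Q f ∧ e.2 ≠ f.2 := by
    by_contra hc
    push Not at hc
    obtain ⟨e0, he0, hq0⟩ := h1
    refine pot_no hg hQ ⟨e0, he0, hq0⟩ (fun y => pD e0.2 (y.1 j)) ?_ ?_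
    · intro y e he hv hq
      have hv : vl y e := hv
      have := hj e he hq
      show pD e0.2 ((mo y e).1 j) = pD e0.2 (y.1 j) * gs e
      rw [← this, mo_same hv]
      exact pD_s (hc e e0 he hq he0 hq0) hv.1
    · intro y e he hv hq
      show pD e0.2 ((mo y e).1 j) = pD e0.2 (y.1 j)
      rw [mo_ne hv (hn e he hq).symm]
  have b1 : ∃ c : Ut, ∀ f, 0 < ct f g → ¬ Q f → kc f = j + 1 → f.1 = c := by
    obtain ⟨e, e', he, hq, he', hq', hne⟩ := a2
    by_cases h : ∃ f, 0 < ct f g ∧ ¬ Q f ∧ kc f = j + 1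
    · obtain ⟨f0, hf0, hqf0, hk0⟩ := h
      refine ⟨f0.1, fun f hf hqf hk => ?_⟩
      have R : ∀ e f, 0 < ct e g → 0 < ct f g → Q e → ¬ Q f → kc f = j + 1 → Rr e.2 f.1 :=
        fun e f he hf hq hq' hk => CC_R (hQ e f he hf hq hq') (by rw [hk, hj e he hq])
      exact (Rr4 (R e f he hf hq hqf hk) (R e f0 he hf0 hq hqf0 hk0) (R e' f he' hf hq' hqf hk)
        (R e' f0 he' hf0 hq' hqf0 hk0)).resolve_left hne
    · exact ⟨e.1, fun f hf hqf hk => (h ⟨f, hf, hqf, hk⟩).elim⟩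
  have b2 : ∃ c : Dt, ∀ f, 0 < ct f g → ¬ Q f → kc f = j + 2 → f.2 = c := by
    obtain ⟨e, e', he, hq, he', hq', hne⟩ := a1
    by_cases h : ∃ f, 0 < ct f g ∧ ¬ Q f ∧ kc f = j + 2
    · obtain ⟨f0, hf0, hqf0, hk0⟩ := h
      refine ⟨f0.2, fun f hf hqf hk => ?_⟩
      have R : ∀ e f, 0 < ct e g → 0 < ct f g → Q e → ¬ Q f → kc f = j + 2 → Rr f.2 e.1 :=
        fun e f he hf hq hq' hk => CC_R (RA.symm (hQ e f he hf hq hq')) (by rw [hk, hj e he hq, (f3 j).2.2.1])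
      exact (Rr4 (R e f he hf hq hqf hk) (R e' f he' hf hq' hqf hk) (R e f0 he hf0 hq hqf0 hk0)
        (R e' f0 he' hf0 hq' hqf0 hk0)).resolve_right hne
    · exact ⟨e.2, fun f hf hqf hk => (h ⟨f, hf, hqf, hk⟩).elim⟩
  obtain ⟨c1, hc1⟩ := b1
  obtain ⟨c2, hc2⟩ := b2
  refine pot_no hg (Q := fun e => ¬ Q e) (fun e f he hf hq hq' => RA.symm (hQ f e hf he (not_not.1 hq') hq)) h2
    (fun y => pD c2 (y.1 (j + 2)) * pU c1 (y.1 (j + 1))) ?_ ?_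
  · intro y e he hv hq
    have hv : vl y e := hv
    show pD c2 ((mo y e).1 (j + 2)) * pU c1 ((mo y e).1 (j + 1)) = pD c2 (y.1 (j + 2)) * pU c1 (y.1 (j + 1)) * gs e
    rcases f3c j (kc e) with h | h | h
    · exact (hn e he hq h).elim
    · rw [mo_ne hv (j := j + 2) (by rw [h]; exact (f3n j).2.2)]
      have := hc1 e he hq h
      rw [← h, mo_same hv, pU_s this hv.1, mul_assoc]
    · rw [mo_ne hv (j := j + 1) (by rw [h]; exact (f3n j).2.2.symm)]
      have := hc2 e he hq h
      have com : pU c1 (y.1 (j + 1)) * gs e = gs e * pU c1 (y.1 (j + 1)) := by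
        rcases hy : y.1 (j + 1) with u | d
        · simp [pU]
        · refine gs_comm ?_
          have hk : kc (c1, d) = j + 1 := y.2.1 _ _ hy
          show CC (c1, d) e
          refine ⟨by rw [hk, h]; exact (f3n j).2.2.symm, fun a b ha hb => ?_⟩
          rw [hk, h, ← (f3 j).1]
          refine Cm1.2 ?_
          rcases ha with rfl | rfl
          · trivial
          · have := ((vl_iff h).1 hv).2 b hb
            rw [(f3 j).2.2.2, hy] at this
            exact this.2
      rw [mul_assoc, com, ← mul_assoc, ← h, mo_same hv, pD_s this hv.1]
  · intro y e he hv hq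
    have hv : vl y e := hv
    have h := hj e he (not_not.1 hq)
    show pD c2 ((mo y e).1 (j + 2)) * pU c1 ((mo y e).1 (j + 1)) = pD c2 (y.1 (j + 2)) * pU c1 (y.1 (j + 1))
    rw [mo_ne hv (by rw [h]; exact (f3n j).2.1), mo_ne hv (by rw [h]; exact (f3n j).1)]

theorem noSplit (x : St) (g : RW Lt) (hg : g ∈ Gx Lt x) : ¬ Split g := by
  rintro ⟨Q, ⟨e, he, hq⟩, ⟨f, hf, hqf⟩, hQ⟩
  have hQ' : ∀ e f, 0 < ct e g → 0 < ct f g → ¬ Q e → ¬¬ Q f → C e f := fun e f he hf hq hq' =>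
    RA.symm (hQ f e hf he (not_not.1 hq') hq)
  have h3 : ∀ a b c d : Fin 3, a ≠ c → a ≠ d → b ≠ c → b ≠ d → a ≠ b → c = d := by decide
  by_cases h : ∀ e', 0 < ct e' g → Q e' → kc e' = kc e
  · exact noSplit1 hg hQ ⟨e, he, hq⟩ ⟨f, hf, hqf⟩ h
  · push Not at h
    obtain ⟨e', he', hq', hne⟩ := h
    refine noSplit1 hg hQ' ⟨f, hf, hqf⟩ ⟨e, he, not_not.2 hq⟩ (j := kc f) fun f' hf' hqf' => ?_
    exact h3 (kc e') (kc e) _ _ (CC_ne (hQ _ _ he' hf' hq' hqf')) (CC_ne (hQ _ _ he' hf hq' hqf))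
      (CC_ne (hQ _ _ he hf' hq hqf')) (CC_ne (hQ _ _ he hf hq hqf)) hne

/-! final assembly -/
def u0 : Ut := (true, false, 0)
def x00 : St := ⟨fun _ => .inl u0, fun _ _ h => (by cases h), fun _ _ => ⟨fun _ => trivial, fun _ => trivial⟩⟩

def Wk (i : Fin 3) (g : RW Lt) (a : Wv) (n : ℤ) : Prop :=
  Xt (vx x00) g ∧ (sx x00 g).1 = Function.update x00.1 i a ∧ hx x00 g = n

theorem Wk.step {i : Fin 3} {g : RW Lt} {a : Wv} {n : ℤ} (h : Wk i g a n) {e : Lt} (hk : kc e = i)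
    (he : En e a) (hr : Rr e.2 u0) : Wk i (g * gs e) (ot e a) (n + dv e a) := by
  obtain ⟨h1, h2, h3⟩ := h
  have hv : vl (sx x00 g) e := by
    rw [vl_iff hk, h2, Function.update_self, Function.update_of_ne (f3n i).1,
      Function.update_of_ne (f3n i).2.1]
    refine ⟨he, fun b hb => ⟨?_, trivial⟩⟩
    rcases hb with rfl | rfl
    · trivial
    · exact hr
  refine ⟨h1.step hv, ?_, ?_⟩
  · rw [sx_v hv]
    show (mo _ _).1 = _
    rw [mo_v hv, h2, hk]; simp
  · rw [hx_v hv, h3]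
    show _ + dv e ((sx x00 g).1 (kc e)) = _
    rw [h2, hk]; simp

theorem hz0 : ∃ z ∈ Gx Lt x00, 0 < hx x00 z := by
  obtain ⟨d, hd1, hd2, hd3⟩ := Rr_d u0 0 true
  obtain ⟨d', hd1', hd2', hd3'⟩ := Rr_d u0 0 false
  have w0 : Wk (kp 0) 1 (.inl u0) 0 := ⟨.one, by rw [sx_one]; simp [x00], hx_one _⟩
  have w1 := w0.step (e := (u0, d)) (by simp [kc, hd1]) (Or.inl rfl) hd3
  have w2 := w1.step (e := ((false, false, 0), d)) (by simp [kc, hd1]) (Or.inr rfl) hd3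
  have w3 := w2.step (e := ((false, false, 0), d')) (by simp [kc, hd1']) (Or.inl rfl) hd3'
  have w4 := w3.step (e := (u0, d')) (by simp [kc, hd1']) (Or.inr rfl) hd3'
  refine ⟨_, ⟨w4.1, Subtype.ext (w4.2.1.trans ?_)⟩, ?_⟩
  · simp [ot, x00]
  · rw [w4.2.2]; simp [ot, dv, sg, hd2, hd2', u0]

theorem nfp0 : ¬ IsFinitelyPresented (ph Lt x00).ker := by
  refine nfp (cc := fun e f : Lt => c0 e.2.1 f.2.1) (fun x => (oct_all x (Or.inr rfl)).1) ?_ ?_ hz0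
  · intro e f g _ _ _ h1 h2 h3
    exact c0_cc _ _ _ (h1.imp (fun h => by rw [h]) C_ad) (h2.imp (fun h => by rw [h]) C_ad)
      (h3.imp (fun h => by rw [h]) C_ad)
  · rintro ⟨p, hp⟩
    obtain ⟨h1, s, hs⟩ := uuu_sec (x := x00) (τ := -1) (Or.inr rfl) (u := fun _ => u0) (fun _ => rfl)
    refine c0_np ⟨fun v => p (s v), fun u v huv => ?_⟩
    have := hp (s u) (s v) (hs u).1 (hs v).1
      ((h1 _ _ (hs u).1 (hs v).1).2 (by rw [(hs u).2, (hs v).2]; exact huv))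
    rwa [(hs u).2, (hs v).2] at this

theorem rescale {G : Type} [Group G] (φ : G →* Multiplicative ℤ) (h : ∃ g, φ g ≠ 1) :
    ∃ ψ : G →* Multiplicative ℤ, Function.Surjective ψ ∧ ψ.ker = φ.ker := by
  have : Infinite φ.range := by
    obtain ⟨g, hg⟩ := h
    have hg' : (φ g).toAdd ≠ 0 := hg
    refine Infinite.of_injective (fun n : ℤ => (⟨φ (g ^ n), ⟨_, rfl⟩⟩ : φ.range)) ?_
    intro a b hab
    have h2 : φ (g ^ a) = φ (g ^ b) := congrArg Subtype.val hab
    rw [map_zpow, map_zpow] at h2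
    have h3 := congrArg Multiplicative.toAdd h2
    rw [toAdd_zpow, toAdd_zpow, smul_eq_mul, smul_eq_mul] at h3
    exact mul_right_cancel₀ hg' h3
  have e : Multiplicative ℤ ≃* φ.range :=
    mulEquivOfCyclicCardEq (by rw [Nat.card_eq_zero_of_infinite, Nat.card_eq_zero_of_infinite])
  refine ⟨e.symm.toMonoidHom.comp φ.rangeRestrict, ?_, ?_⟩
  · exact e.symm.surjective.comp φ.rangeRestrict_surjective
  · ext g
    simp [MonoidHom.mem_ker, Subtype.ext_iff]

/-- **Theorem A (finiteness-properties content).** There is a finitely presented group `G`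
with no Baumslag–Solitar subgroups (in particular no `ℤ × ℤ` subgroup) and a surjection
`φ : G → ℤ` whose kernel is of type `FP₂` over `ℤ` but not finitely presented. -/
theorem exists_fp_group_with_FP2_not_finitelyPresented_kernel :
    ∃ (G : Type) (_ : Group G),
      IsFinitelyPresented G ∧
      HasNoBSSubgroup G ∧
      (∀ K : Subgroup G, ¬ Nonempty (K ≃* Multiplicative (ℤ × ℤ))) ∧
      ∃ φ : G →* Multiplicative ℤ,
        Function.Surjective φ ∧
        IsTypeFP2 φ.ker ∧
        ¬ IsFinitelyPresented φ.ker := by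
  have hB : HasNoBSSubgroup (Gx Lt x00) := noBS (fun x g hg _ => noSplit x g hg) x00
  obtain ⟨z, hz, hp⟩ := hz0
  obtain ⟨ψ, hs, hk⟩ := rescale (ph Lt x00) ⟨⟨z, hz⟩, fun h => hp.ne' (congrArg Multiplicative.toAdd h)⟩
  refine ⟨Gx Lt x00, inferInstance, gfp x00, hB, no_int_sq_of_noBS hB, ψ, hs, ?_, ?_⟩
  · rw [hk]
    exact fp2 (fun x τ h => (oct_all x h).1) (fun x τ h => (oct_all x h).2)
  · rw [hk]; exact nfp0
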